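/- Let k = 𝔽₂(T), M = T⁴+T+1, let L be the unique subfield of k(Λ_M) with [L : k] = 5, let k₅ = k·𝔽₃₂ be the constant field extension of degree 5, and set L₅ = L·k₅, so Gal(L₅/k) ≅ C₅ × C₅. Among the four intermediate fields R of L₅/k with [R : k] = 5 other than L and k₅, exactly two fields R₁ and R₂ have the property that every place of k of degree at most 4 other than the place 𝔪 of M is inert in R/k; in these two fields 𝔪 is the only ramified place, and both R₁ and R₂ have genus 4 and class number 1. -/

import Mathlib

set_option synthInstance.maxHeartbeats 1000000
set_option maxHeartbeats 1000000

open scoped Classical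

noncomputable section

namespace CFF

variable (F : Type*) [Field F]

/-- `K` is a (congruence) function field in one variable over `F`: a finitely
generated field extension of transcendence degree one. -/
def IsFunctionField (K : Type*) [Field K] [Algebra F K] : Prop :=
  ∃ x : K, Transcendental F x ∧
    FiniteDimensional (IntermediateField.adjoin F {x}) K

/-- The exact field of constants of `K` is `F`: every element of `K` algebraic
over `F` already lies in `F`. -/
def HasExactConstants (K : Type*) [Field K] [Algebra F K] : Prop :=
  ∀ a : K, IsAlgebraic F a → a ∈ (algebraMap F K).range

variable (K : Type*) [Field K] [Algebra F K]

/-- A place of the function field `K/F`: a proper valuation subring of `K`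
containing the constants. -/
def IsPlace (O : ValuationSubring K) : Prop :=
  O ≠ ⊤ ∧ ∀ c : F, algebraMap F K c ∈ O

/-- The type of places (prime divisors) of `K/F`. -/
def Place := {O : ValuationSubring K // IsPlace F K O}

variable {K}

/-- `𝔪`-adic order of an element of a valuation subring. -/
def ordAux (O : ValuationSubring K) (x : O) : ℕ :=
  sSup {n : ℕ | x ∈ IsLocalRing.maximalIdeal O ^ n}

/-- The order (normalized valuation) of `f ∈ K` at a valuation subring `O`. -/
def ordAt (O : ValuationSubring K) (f : K) : ℤ :=
  if h : f ∈ O then (ordAux O ⟨f, h⟩ : ℤ)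
  else -(ordAux O ⟨f⁻¹, (O.mem_or_inv_mem f).resolve_left h⟩ : ℤ)

/-- The constants embed into (the valuation ring of) any place. -/
def constHom (p : Place F K) : F →+* p.1 :=
  (algebraMap F K).codRestrict p.1.toSubring fun c => p.2.2 c

/-- The map from the constants to the residue field of a place. -/
def residueHom (p : Place F K) : F →+* IsLocalRing.ResidueField p.1 :=
  (IsLocalRing.residue (p.1 : ValuationSubring K)).comp (constHom F p)

/-- The degree of a place: the dimension of its residue field over the
constants. -/
def placeDegree (p : Place F K) : ℕ :=
  letI := (residueHom F p).toAlgebra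
  Module.finrank F (IsLocalRing.ResidueField p.1)

variable (K)

/-- The group of divisors of `K/F`. -/
abbrev Divisor := Place F K →₀ ℤ

/-- The degree homomorphism on divisors. -/
def degHom : Divisor F K →+ ℤ :=
  Finsupp.liftAddHom fun p => AddMonoidHom.mulRight (placeDegree F p : ℤ)

variable {K}

/-- The Riemann-Roch space `L(D)` of a divisor `D` (the span coincides with the
set of `f` with `div f ≥ -D`, which is an `F`-subspace). -/
def RRspace (D : Divisor F K) : Submodule F K :=
  Submodule.span F {f : K | ∀ p : Place F K, 0 ≤ D p + ordAt p.1 f}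

/-- `ℓ(D)`, the dimension of the Riemann-Roch space of `D`. -/
def ell (D : Divisor F K) : ℕ := Module.finrank F (RRspace F D)

variable (K)

/-- The genus of `K/F`, via Riemann's theorem: `g = max_D (deg D + 1 - ℓ(D))`. -/
def genus : ℕ :=
  sSup {g : ℕ | ∃ D : Divisor F K, (g : ℤ) = degHom F K D + 1 - ell F D}

/-- The subgroup of divisors of degree zero. -/
def zeroDivisors : AddSubgroup (Divisor F K) := (degHom F K).ker

/-- The subgroup of principal divisors. -/
def principalDivisors : AddSubgroup (Divisor F K) :=
  AddSubgroup.closure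
    {D : Divisor F K | ∃ f : K, f ≠ 0 ∧ ∀ p : Place F K, D p = ordAt p.1 f}

/-- The group of divisor classes of degree zero of `K/F`. -/
def ClassGroup0 :=
  zeroDivisors F K ⧸ (principalDivisors F K).addSubgroupOf (zeroDivisors F K)

instance : AddGroup (ClassGroup0 F K) := by
  unfold ClassGroup0; infer_instance

/-- The class number of `K/F`: the order of the group of divisor classes of
degree zero. -/
def classNumber : ℕ := Nat.card (ClassGroup0 F K)

section Extension

variable {k L : Type*} [Field k] [Field L] [Algebra F k] [Algebra F L] [Algebra k L]

/-- A place `P` of `L` lies over the place `p` of `k`. -/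
def LiesOver (P : Place F L) (p : Place F k) : Prop :=
  P.1.comap (algebraMap k L) = p.1

variable (L)

/-- `p` is inert in `L/k`: there is a unique place of `L` above `p`, and its
degree is `[L:k] · deg p` (i.e. the residue degree is `[L:k]`, so `e = 1`). -/
def IsInert (p : Place F k) : Prop :=
  ∃ P : Place F L, LiesOver F P p ∧
    placeDegree F P = Module.finrank k L * placeDegree F p ∧
    ∀ P' : Place F L, LiesOver F P' p → P' = P

/-- `p` splits completely in `L/k`: there are `[L:k]` places above `p`, each of
the same degree as `p`. -/
def SplitsCompletely (p : Place F k) : Prop :=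
  Nat.card {P : Place F L // LiesOver F P p} = Module.finrank k L ∧
    ∀ P : Place F L, LiesOver F P p → placeDegree F P = placeDegree F p

/-- `p` is totally ramified in `L/k`: there is a unique place above `p`, of the
same degree (so `f = 1` and `e = [L:k]`). -/
def IsTotallyRamified (p : Place F k) : Prop :=
  ∃ P : Place F L, LiesOver F P p ∧ placeDegree F P = placeDegree F p ∧
    ∀ P' : Place F L, LiesOver F P' p → P' = P

/-- `p` is unramified in `L/k`: at every place above `p` the orders of elements
of `k` are preserved (`e = 1`). -/
def IsUnramifiedAt (p : Place F k) : Prop :=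
  ∀ P : Place F L, LiesOver F P p →
    ∀ x : k, ordAt P.1 (algebraMap k L x) = ordAt p.1 x

end Extension

section Rational

/-- The valuation ring of the finite place of `𝔽₂(T)` corresponding to an
irreducible polynomial `P`: it contains all polynomials and `P` lies in its
maximal ideal. -/
def IsFinitePlaceOf (O : ValuationSubring (RatFunc (ZMod 2)))
    (P : Polynomial (ZMod 2)) : Prop :=
  (∀ g : Polynomial (ZMod 2), algebraMap (Polynomial (ZMod 2)) (RatFunc (ZMod 2)) g ∈ O) ∧
    (algebraMap (Polynomial (ZMod 2)) (RatFunc (ZMod 2)) P)⁻¹ ∉ O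

/-- The infinite place `𝔭_∞` of `𝔽₂(T)`: the place where `T` has a pole. -/
def IsInfinitePlace (O : ValuationSubring (RatFunc (ZMod 2))) : Prop :=
  RatFunc.X ∉ O

end Rational

end CFF

namespace CFF

/-- The rational function field `𝔽₂(T)`. -/
abbrev k2 : Type := RatFunc (ZMod 2)

/-- A fixed algebraic closure of `𝔽₂(T)`. -/
abbrev Omega2 : Type := AlgebraicClosure k2

/-- The Carlitz action of `T`: the polynomial `X² + T·X` over `𝔽₂(T)`. -/
def carlitzT : Polynomial k2 :=
  Polynomial.X ^ 2 + Polynomial.C RatFunc.X * Polynomial.X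

/-- Iterates of the Carlitz action of `T`. -/
def carlitzIter : ℕ → Polynomial k2
  | 0 => Polynomial.X
  | n + 1 => carlitzT.comp (carlitzIter n)

/-- The Carlitz polynomial of `M ∈ 𝔽₂[T]` (the Carlitz module is `𝔽₂`-linear in
`M`), whose roots are the `M`-torsion `Λ_M` of the Carlitz module. -/
def carlitz (M : Polynomial (ZMod 2)) : Polynomial k2 :=
  M.sum fun i a => Polynomial.C (algebraMap (ZMod 2) k2 a) * carlitzIter i

/-- The cyclotomic function field `k(Λ_M)` inside the fixed algebraic closure. -/
def cycloField (M : Polynomial (ZMod 2)) : IntermediateField k2 Omega2 :=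
  IntermediateField.adjoin k2 ((carlitz M).rootSet Omega2)

/-- The constant field extension `k·𝔽₃₂` inside the fixed algebraic closure. -/
def constExt32 : IntermediateField k2 Omega2 :=
  IntermediateField.adjoin k2 {x : Omega2 | x ^ 32 = x}

/-- The polynomial `M = T⁴+T+1 ∈ 𝔽₂[T]`. -/
def M0 : Polynomial (ZMod 2) := Polynomial.X ^ 4 + Polynomial.X + 1

end CFF

namespace CFF

/-- `R` is one of the intermediate fields of `L·k₅ / k` of degree `5` other
than `L` and `k₅` in which every place of `k = 𝔽₂(T)` of degree at most `4`
other than the place `𝔪` of `M = T⁴+T+1` is inert. -/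
def IsStirpeCandidate (L : IntermediateField k2 Omega2)
    (R : IntermediateField k2 Omega2) : Prop :=
  R ≤ L ⊔ constExt32 ∧ Module.finrank k2 R = 5 ∧
    R ≠ L ∧ R ≠ constExt32 ∧
    ∀ p : Place (ZMod 2) k2, placeDegree (ZMod 2) p ≤ 4 →
      ¬ IsFinitePlaceOf p.1 M0 → IsInert (ZMod 2) R p

end CFF

namespace CFF

section DVR

open IsLocalRing

variable {K : Type*} [Field K] (O : ValuationSubring K) [IsDiscreteValuationRing O]

theorem ordAux_unit_mul_pow {π : O} (hπ : Irreducible π) (u : Oˣ) (n : ℕ) :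
    ordAux O (u * π ^ n) = n := by
  have hset : {m : ℕ | (u : O) * π ^ n ∈ maximalIdeal O ^ m} = Set.Iic n := by
    ext m
    rw [Set.mem_ofPred_eq, (IsDiscreteValuationRing.irreducible_iff_uniformizer π).1 hπ,
      Ideal.span_singleton_pow, Ideal.mem_span_singleton, Set.mem_Iic, Units.dvd_mul_left]
    exact pow_dvd_pow_iff hπ.ne_zero hπ.not_isUnit
  rw [ordAux, hset, csSup_Iic]

theorem ordAt_unit_mul_zpow {π : O} (hπ : Irreducible π) (u : Oˣ) (n : ℤ) :
    ordAt O (((u : O) : K) * (π : K) ^ n) = n := by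
  have hπ0 : (π : K) ≠ 0 := by simpa using hπ.ne_zero
  obtain ⟨m, rfl | rfl⟩ := n.eq_nat_or_neg
  · have hmem : ((u : O) : K) * (π : K) ^ (m : ℤ) ∈ O := by
      rw [zpow_natCast]; exact O.mul_mem _ _ (u : O).2 (pow_mem π.2 m)
    rw [ordAt, dif_pos hmem]
    have := ordAux_unit_mul_pow O hπ u m
    rw [show (⟨((u : O) : K) * (π : K) ^ (m : ℤ), hmem⟩ : O) = u * π ^ m by
      ext; simp, this]
  · have heq : (((u : O) : K) * (π : K) ^ (-(m : ℤ)))⁻¹ =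
        (((u⁻¹ : Oˣ) : O) : K) * (π : K) ^ m := by
      have hu : ((u : O) : K) * (((u⁻¹ : Oˣ) : O) : K) = 1 := by
        exact_mod_cast congrArg (Subtype.val) (u.mul_inv)
      rw [mul_inv, zpow_neg, inv_inv, zpow_natCast, inv_eq_of_mul_eq_one_right hu]
    by_cases h : ((u : O) : K) * (π : K) ^ (-(m : ℤ)) ∈ O
    · have hm : m = 0 := by
        by_contra hm
        apply hπ.not_isUnit
        have h1 : (π : K) ^ m * (((u : O) : K) * (π : K) ^ (-(m : ℤ))) = ((u : O) : K) := by
          rw [zpow_neg, zpow_natCast]; field_simp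
        have h2 : π ^ m * ⟨_, h⟩ = (u : O) := by ext; simpa using h1
        have h3 : IsUnit (π ^ m) := isUnit_of_mul_isUnit_left (h2 ▸ u.isUnit)
        exact (isUnit_pow_iff hm).1 h3
      subst hm
      rw [ordAt, dif_pos h]
      have := ordAux_unit_mul_pow O hπ u 0
      rw [show (⟨((u : O) : K) * (π : K) ^ (-((0 : ℕ) : ℤ)), h⟩ : O) = u * π ^ 0 by
        ext; simp, this]
      simp
    · rw [ordAt, dif_neg h]
      have := ordAux_unit_mul_pow O hπ u⁻¹ m
      have h2 : (⟨(((u : O) : K) * (π : K) ^ (-(m : ℤ)))⁻¹,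
          (O.mem_or_inv_mem _).resolve_left h⟩ : O) = (u⁻¹ : Oˣ) * π ^ m := by
        ext; simpa using heq
      rw [h2, this]

theorem exists_unit_mul_zpow {π : O} (hπ : Irreducible π) {f : K} (hf : f ≠ 0) :
    ∃ (u : Oˣ), f = ((u : O) : K) * (π : K) ^ (ordAt O f) := by
  suffices h : ∃ (n : ℤ) (u : Oˣ), f = ((u : O) : K) * (π : K) ^ n by
    obtain ⟨n, u, rfl⟩ := h
    exact ⟨u, by rw [ordAt_unit_mul_zpow O hπ]⟩
  rcases O.mem_or_inv_mem f with h | h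
  · obtain ⟨n, u, hu⟩ := IsDiscreteValuationRing.eq_unit_mul_pow_irreducible
      (x := (⟨f, h⟩ : O)) (by simpa [Subtype.ext_iff] using hf) hπ
    exact ⟨n, u, by simpa using congrArg Subtype.val hu⟩
  · obtain ⟨n, u, hu⟩ := IsDiscreteValuationRing.eq_unit_mul_pow_irreducible
      (x := (⟨f⁻¹, h⟩ : O)) (by simpa [Subtype.ext_iff] using hf) hπ
    refine ⟨-n, u⁻¹, ?_⟩
    have h1 : f⁻¹ = ((u : O) : K) * (π : K) ^ n := by simpa using congrArg Subtype.val hu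
    have hu : ((u : O) : K) * (((u⁻¹ : Oˣ) : O) : K) = 1 := by
      exact_mod_cast congrArg (Subtype.val) (u.mul_inv)
    rw [← inv_inv f, h1, mul_inv, zpow_neg, zpow_natCast, inv_eq_of_mul_eq_one_right hu]

theorem exists_uniformizer : ∃ π : O, Irreducible π :=
  IsDiscreteValuationRing.exists_irreducible O

theorem coe_unit_ne_zero (u : Oˣ) : ((u : O) : K) ≠ 0 := by
  simpa using u.ne_zero

variable {O}

theorem coe_irreducible_ne_zero {π : O} (hπ : Irreducible π) : (π : K) ≠ 0 := by
  simpa using hπ.ne_zero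

theorem ordAt_mul {f g : K} (hf : f ≠ 0) (hg : g ≠ 0) :
    ordAt O (f * g) = ordAt O f + ordAt O g := by
  obtain ⟨π, hπ⟩ := exists_uniformizer O
  obtain ⟨u, hu⟩ := exists_unit_mul_zpow O hπ hf
  obtain ⟨v, hv⟩ := exists_unit_mul_zpow O hπ hg
  have h := ordAt_unit_mul_zpow O hπ (u * v) (ordAt O f + ordAt O g)
  rw [← h]
  congr 1
  conv_lhs => rw [hu, hv]
  rw [zpow_add₀ (coe_irreducible_ne_zero hπ)]
  push_cast
  ring

theorem ordAt_one : ordAt O (1 : K) = 0 := by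
  have := ordAt_mul (O := O) (one_ne_zero (α := K)) one_ne_zero
  rw [mul_one] at this; omega

theorem ordAt_inv {f : K} (hf : f ≠ 0) : ordAt O f⁻¹ = -ordAt O f := by
  have := ordAt_mul (O := O) hf (inv_ne_zero hf)
  rw [mul_inv_cancel₀ hf, ordAt_one] at this; omega

theorem ordAt_pow {f : K} (hf : f ≠ 0) (n : ℕ) : ordAt O (f ^ n) = n * ordAt O f := by
  induction n with
  | zero => simp [ordAt_one]
  | succ n ih => rw [pow_succ, ordAt_mul (pow_ne_zero _ hf) hf, ih]; push_cast; ring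

theorem ordAt_nonneg_of_mem {f : K} (h : f ∈ O) : 0 ≤ ordAt O f := by
  rw [ordAt, dif_pos h]; positivity

theorem mem_of_ordAt_nonneg {f : K} (h : 0 ≤ ordAt O f) : f ∈ O := by
  by_cases hf : f = 0
  · rw [hf]; exact O.zero_mem
  obtain ⟨π, hπ⟩ := exists_uniformizer O
  obtain ⟨u, hu⟩ := exists_unit_mul_zpow O hπ hf
  rw [hu]
  refine O.mul_mem _ _ (u : O).2 ?_
  lift ordAt O f to ℕ using h with n
  rw [zpow_natCast]
  exact pow_mem π.2 n

theorem ordAt_nonneg_iff {f : K} : 0 ≤ ordAt O f ↔ f ∈ O :=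
  ⟨mem_of_ordAt_nonneg, ordAt_nonneg_of_mem⟩

theorem ordAt_uniformizer {π : O} (hπ : Irreducible π) : ordAt O (π : K) = 1 := by
  simpa using ordAt_unit_mul_zpow O hπ 1 1

theorem le_ordAt_iff {π : O} (hπ : Irreducible π) {f : K} (hf : f ≠ 0) (n : ℤ) :
    n ≤ ordAt O f ↔ f * (π : K) ^ (-n) ∈ O := by
  have hπ0 := coe_irreducible_ne_zero hπ
  have h1 : ordAt O ((π : K) ^ (-n)) = -n := by simpa using ordAt_unit_mul_zpow O hπ 1 (-n)
  rw [← ordAt_nonneg_iff, ordAt_mul hf (zpow_ne_zero _ hπ0), h1]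
  omega

theorem ordAt_add {f g : K} {n : ℤ} (hfg : f + g ≠ 0) (hf : f = 0 ∨ n ≤ ordAt O f)
    (hg : g = 0 ∨ n ≤ ordAt O g) : n ≤ ordAt O (f + g) := by
  obtain ⟨π, hπ⟩ := exists_uniformizer O
  have key : ∀ {x : K}, (x = 0 ∨ n ≤ ordAt O x) → x * (π : K) ^ (-n) ∈ O := by
    intro x hx
    by_cases h0 : x = 0
    · rw [h0, zero_mul]; exact O.zero_mem
    · exact (le_ordAt_iff hπ h0 n).1 (hx.resolve_left h0)
  rw [le_ordAt_iff hπ hfg, add_mul]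
  exact O.add_mem _ _ (key hf) (key hg)

theorem mem_nonunits_iff_ordAt_pos {f : K} (hf : f ≠ 0) : f ∈ O.nonunits ↔ 0 < ordAt O f := by
  rw [ValuationSubring.mem_nonunits_iff_or, ← ordAt_nonneg_iff (O := O), ordAt_inv hf]
  simp only [hf, false_or]
  omega

theorem exists_ordAt_eq_one : ∃ t : K, t ≠ 0 ∧ ordAt O t = 1 := by
  obtain ⟨π, hπ⟩ := exists_uniformizer O
  exact ⟨π, coe_irreducible_ne_zero hπ, ordAt_uniformizer hπ⟩

end DVR

section Localization

open IsLocalRing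

theorem exists_mul_eq_of_dedekind {A : Type*} [CommRing A] [IsDedekindDomain A] (q : Ideal A)
    [hq : q.IsPrime] (hq0 : q ≠ ⊥) (a b : A) :
    ∃ n s : A, s ∉ q ∧ (a * s = b * n ∨ b * s = a * n) := by
  have hdvr := IsLocalization.AtPrime.isDiscreteValuationRing_of_dedekind_domain A hq0
    (Localization.AtPrime q)
  have hinj : Function.Injective (algebraMap A (Localization.AtPrime q)) :=
    IsLocalization.injective _ q.primeCompl_le_nonZeroDivisors
  have key : ∀ x y : A, algebraMap A (Localization.AtPrime q) x ∣ algebraMap A _ y →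
      ∃ n s : A, s ∉ q ∧ y * s = x * n := by
    rintro x y ⟨c, hc⟩
    obtain ⟨⟨n, s⟩, hns⟩ := IsLocalization.surj q.primeCompl c
    refine ⟨n, s, s.2, hinj ?_⟩
    rw [map_mul, map_mul, hc, mul_assoc, hns]
  rcases ValuationRing.dvd_total (algebraMap A (Localization.AtPrime q) b) (algebraMap A _ a) with h | h
  · obtain ⟨n, s, hs, h⟩ := key _ _ h
    exact ⟨n, s, hs, Or.inl h⟩
  · obtain ⟨n, s, hs, h⟩ := key _ _ h
    exact ⟨n, s, hs, Or.inr h⟩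

variable {K : Type*} [Field K]

section

variable (O : ValuationSubring K)
  (A : Type*) [CommRing A] [IsDedekindDomain A] [Algebra A K] [IsFractionRing A K]
  [Algebra A O] [IsScalarTower A O K]

theorem under_maximalIdeal_ne_bot (hO : O ≠ ⊤) : (maximalIdeal O).under A ≠ ⊥ := by
  intro h
  apply hO
  rw [eq_top_iff]
  rintro x -
  obtain ⟨a, s, hs, rfl⟩ := IsFractionRing.div_surjective (A := A) x
  have hs0 : s ≠ 0 := nonZeroDivisors.ne_zero hs
  have hu : IsUnit (algebraMap A O s) := by
    by_contra hu
    have : s ∈ (maximalIdeal O).under A := hu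
    rw [h] at this
    exact hs0 this
  obtain ⟨u, hu⟩ := hu
  have h1 : algebraMap A K s * (((u⁻¹ : Oˣ) : O) : K) = 1 := by
    rw [IsScalarTower.algebraMap_apply A O K, ← hu]
    exact congrArg Subtype.val u.mul_inv
  rw [div_eq_mul_inv, inv_eq_of_mul_eq_one_right h1, IsScalarTower.algebraMap_apply A O K]
  exact O.mul_mem _ _ (algebraMap A O a).2 (u⁻¹ : Oˣ).1.2

theorem isLocalization_place (hO : O ≠ ⊤) :
    IsLocalization.AtPrime O ((maximalIdeal O).under A) := by
  have hinj : Function.Injective (algebraMap A K) := IsFractionRing.injective A K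
  have hval : ∀ a : A, ((algebraMap A O a : O) : K) = algebraMap A K a := fun a =>
    (IsScalarTower.algebraMap_apply A O K a).symm
  have hunit : ∀ s : A, s ∉ (maximalIdeal O).under A → IsUnit (algebraMap A O s) := by
    intro s hs; by_contra h; exact hs h
  refine ⟨⟨?_, ?_, ?_⟩⟩
  · rintro ⟨s, hs⟩
    exact hunit s hs
  · intro x
    obtain ⟨a, b, hb, hx⟩ := IsFractionRing.div_surjective (A := A) (x : K)
    have hb0 : algebraMap A K b ≠ 0 := by
      simpa using nonZeroDivisors.ne_zero hb
    rw [div_eq_iff hb0] at hx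
    obtain ⟨n, s, hs, h | h⟩ := exists_mul_eq_of_dedekind ((maximalIdeal O).under A)
      (under_maximalIdeal_ne_bot O A hO) a b
    · refine ⟨⟨n, ⟨s, hs⟩⟩, Subtype.ext ?_⟩
      change (x : K) * ((algebraMap A O s : O) : K) = ((algebraMap A O n : O) : K)
      rw [hval, hval]
      apply mul_left_cancel₀ hb0
      rw [← map_mul, ← h, map_mul, hx]; ring
    · have hxn : algebraMap A K b * algebraMap A K s = algebraMap A K b * (x * algebraMap A K n) := by
        rw [← map_mul, h, map_mul, hx]; ring
      have hxn := mul_left_cancel₀ hb0 hxn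
      have hxn' : algebraMap A O s = x * algebraMap A O n := by
        apply Subtype.ext
        change ((algebraMap A O s : O) : K) = (x : K) * ((algebraMap A O n : O) : K)
        rw [hval, hval, hxn]
      have hn : n ∉ (maximalIdeal O).under A := by
        intro hn
        apply hs
        change algebraMap A O s ∈ maximalIdeal O
        rw [hxn']
        exact Ideal.mul_mem_left _ _ hn
      refine ⟨⟨s, ⟨n, hn⟩⟩, ?_⟩
      exact hxn'.symm
  · intro x y hxy
    refine ⟨1, ?_⟩
    have : x = y := hinj (by rw [← hval, ← hval, hxy])
    rw [this]

end

theorem isDVR_place (O : ValuationSubring K) (A : Type*) [CommRing A] [IsDedekindDomain A]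
    [Algebra A K] [IsFractionRing A K] [Algebra A O] [IsScalarTower A O K] (hO : O ≠ ⊤) : IsDiscreteValuationRing O := by
  have := isLocalization_place O A hO
  exact IsLocalization.AtPrime.isDiscreteValuationRing_of_dedekind_domain A
    (under_maximalIdeal_ne_bot O A hO) O

end Localization

section RationalPlaces

open IsLocalRing Polynomial

section Card

variable {K : Type*} [Field K] [Algebra (ZMod 2) K] (p : Place (ZMod 2) K)

theorem card_residueField [Finite (ResidueField p.1)] :
    Nat.card (ResidueField p.1) = 2 ^ placeDegree (ZMod 2) p := by
  let := (residueHom (ZMod 2) p).toAlgebra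
  have : Module.Finite (ZMod 2) (ResidueField p.1) := Module.Finite.of_finite
  have h := Module.natCard_eq_pow_finrank (K := ZMod 2) (V := ResidueField p.1)
  rw [Nat.card_zmod] at h
  exact h

theorem placeDegree_eq_of_card {n : ℕ} (h : Nat.card (ResidueField p.1) = 2 ^ n) :
    placeDegree (ZMod 2) p = n := by
  have : Finite (ResidueField p.1) := Nat.finite_of_card_ne_zero (by rw [h]; positivity)
  rw [card_residueField] at h
  exact Nat.pow_right_injective le_rfl h

theorem placeDegree_pos [Finite (ResidueField p.1)] : 0 < placeDegree (ZMod 2) p := by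
  have h := card_residueField p
  by_contra h0
  have h1 : placeDegree (ZMod 2) p = 0 := by omega
  rw [h1, pow_zero] at h
  have : 1 < Nat.card (ResidueField p.1) := Finite.one_lt_card
  omega

theorem residue_pow_two_pow [Finite (ResidueField p.1)] (x : ResidueField p.1) :
    x ^ 2 ^ placeDegree (ZMod 2) p = x := by
  let := Fintype.ofFinite (ResidueField p.1)
  rw [← card_residueField, Nat.card_eq_fintype_card]
  exact FiniteField.pow_card x

end Card

/-- The polynomial `g`, seen in the rational function field. -/
abbrev polyToRat (g : (ZMod 2)[X]) : k2 := algebraMap (ZMod 2)[X] k2 g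

theorem polyToRat_mem (O : ValuationSubring k2) (hT : RatFunc.X ∈ O)
    (hc : ∀ c : ZMod 2, algebraMap (ZMod 2) k2 c ∈ O) (g : (ZMod 2)[X]) : polyToRat g ∈ O := by
  induction g using Polynomial.induction_on' with
  | add a b ha hb => rw [polyToRat, map_add]; exact O.add_mem _ _ ha hb
  | monomial n c =>
    rw [polyToRat, ← Polynomial.C_mul_X_pow_eq_monomial, map_mul, map_pow, RatFunc.algebraMap_X]
    refine O.mul_mem _ _ ?_ (pow_mem hT n)
    have h : (algebraMap (ZMod 2)[X] k2).comp C = algebraMap (ZMod 2) k2 := Subsingleton.elim _ _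
    have h2 : algebraMap (ZMod 2)[X] k2 (C c) = algebraMap (ZMod 2) k2 c :=
      RingHom.congr_fun h c
    rw [h2]
    exact hc c

section Finite

variable (p : Place (ZMod 2) k2) (hT : RatFunc.X ∈ p.1)

/-- Polynomials as elements of the valuation ring of a finite place. -/
def polyHom : (ZMod 2)[X] →+* p.1 :=
  (algebraMap (ZMod 2)[X] k2).codRestrict p.1.toSubring (polyToRat_mem p.1 hT p.2.2)

theorem coe_polyHom (g : (ZMod 2)[X]) : (polyHom p hT g : k2) = polyToRat g := rfl

theorem mem_nonunits_iff_polyHom (g : (ZMod 2)[X]) :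
    polyToRat g ∈ p.1.nonunits ↔ polyHom p hT g ∈ maximalIdeal p.1 := by
  rw [← coe_polyHom p hT, ValuationSubring.coe_mem_nonunits_iff]

include hT in
theorem finitePlace_isDVR : IsDiscreteValuationRing p.1 := by
  let := (polyHom p hT).toAlgebra
  have : IsScalarTower (ZMod 2)[X] p.1 k2 := IsScalarTower.of_algebraMap_eq fun _ => rfl
  exact isDVR_place p.1 (ZMod 2)[X] p.2.1

include hT in
theorem finitePlace_exists_irreducible : ∃ π : (ZMod 2)[X], Irreducible π ∧
    (∀ g, polyToRat g ∈ p.1.nonunits ↔ π ∣ g) ∧ ordAt p.1 (polyToRat π) = 1 ∧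
    Finite (ResidueField p.1) ∧ placeDegree (ZMod 2) p = π.natDegree ∧
    (∀ x : k2, x ∈ p.1 ↔ ∃ n s, ¬ π ∣ s ∧ x * polyToRat s = polyToRat n) := by
  let := (polyHom p hT).toAlgebra
  have : IsScalarTower (ZMod 2)[X] p.1 k2 := IsScalarTower.of_algebraMap_eq fun _ => rfl
  have hne := under_maximalIdeal_ne_bot p.1 (ZMod 2)[X] p.2.1
  have hloc := isLocalization_place p.1 (ZMod 2)[X] p.2.1
  have hdvr := finitePlace_isDVR p hT
  obtain ⟨π, hπ⟩ := IsPrincipalIdealRing.principal ((maximalIdeal p.1).under (ZMod 2)[X])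
  rw [Ideal.submodule_span_eq] at hπ
  have hπ0 : π ≠ 0 := by
    rintro rfl; apply hne; rw [hπ]; simp
  have hprime : Prime π := by
    rw [← Ideal.span_singleton_prime hπ0, ← hπ]; infer_instance
  have hmem : ∀ g, polyToRat g ∈ p.1.nonunits ↔ π ∣ g := by
    intro g
    rw [mem_nonunits_iff_polyHom p hT, ← Ideal.mem_span_singleton, ← hπ]
    rfl
  have huni : Irreducible (polyHom p hT π) := by
    rw [IsDiscreteValuationRing.irreducible_iff_uniformizer]
    have := IsLocalization.AtPrime.map_eq_maximalIdeal
      ((maximalIdeal p.1).under (ZMod 2)[X]) p.1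
    rw [← this]
    conv_lhs => rw [hπ]
    rw [Ideal.map_span, Set.image_singleton]
    rfl
  have hcard : Nat.card (ResidueField p.1) = 2 ^ π.natDegree := by
    have h1 : Nat.card ((ZMod 2)[X] ⧸ Ideal.span {π}) = Nat.card (ResidueField p.1) := by
      have hmax : ((maximalIdeal p.1).under (ZMod 2)[X]).IsMaximal :=
        Ideal.IsPrime.isMaximal inferInstance hne
      rw [← hπ]
      exact Nat.card_congr (IsLocalization.AtPrime.equivQuotMaximalIdeal
        ((maximalIdeal p.1).under (ZMod 2)[X]) p.1).toEquiv
    rw [← h1]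
    change Nat.card (AdjoinRoot π) = _
    have := (AdjoinRoot.powerBasis hπ0).finite
    have h2 := Module.natCard_eq_pow_finrank (K := ZMod 2) (V := AdjoinRoot π)
    rw [h2, Nat.card_zmod, (AdjoinRoot.powerBasis hπ0).finrank, AdjoinRoot.powerBasis_dim]
  refine ⟨π, hprime.irreducible, hmem, ordAt_uniformizer huni, ?_,
    placeDegree_eq_of_card p hcard, ?_⟩
  · exact Nat.finite_of_card_ne_zero (by rw [hcard]; positivity)
  · intro x
    constructor
    · intro hx
      obtain ⟨⟨n, s⟩, h⟩ := IsLocalization.surj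
        ((maximalIdeal p.1).under (ZMod 2)[X]).primeCompl (⟨x, hx⟩ : p.1)
      refine ⟨n, s, ?_, congrArg Subtype.val h⟩
      rw [← hmem, mem_nonunits_iff_polyHom p hT]
      exact s.2
    · rintro ⟨n, s, hs, h⟩
      rw [← hmem, ValuationSubring.mem_nonunits_iff_or] at hs
      push Not at hs
      rw [eq_mul_inv_iff_mul_eq₀ hs.1 |>.2 h]
      exact p.1.mul_mem _ _ (polyHom p hT n).2 hs.2

end Finite

section Infinite

variable (p : Place (ZMod 2) k2) (hT : RatFunc.X ∉ p.1)

include hT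

theorem invX_mem_nonunits : (RatFunc.X : k2)⁻¹ ∈ p.1.nonunits := by
  rw [ValuationSubring.inv_mem_nonunits_iff]
  exact Or.inr hT

theorem ratFuncX_ne_zero : (RatFunc.X : k2) ≠ 0 := RatFunc.X_ne_zero

/-- At a pole of `T`, the monomial of highest degree dominates. -/
theorem polyToRat_sub_mem_nonunits (g : (ZMod 2)[X]) (hg : g ≠ 0) :
    polyToRat g * ((RatFunc.X : k2)⁻¹) ^ g.natDegree - 1 ∈ p.1.nonunits := by
  have hX := ratFuncX_ne_zero p hT
  have hlead : g.leadingCoeff = 1 := by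
    have : ∀ c : ZMod 2, c ≠ 0 → c = 1 := by decide
    exact this _ (leadingCoeff_ne_zero.2 hg)
  have hsum : polyToRat g * ((RatFunc.X : k2)⁻¹) ^ g.natDegree - 1 =
      ∑ i ∈ Finset.range g.natDegree,
        polyToRat (C (g.coeff i)) * ((RatFunc.X : k2)⁻¹) ^ (g.natDegree - i) := by
    rw [sub_eq_iff_eq_add]
    have hg : polyToRat g = polyToRat (∑ i ∈ Finset.range (g.natDegree + 1), C (g.coeff i) * X ^ i) :=
      congrArg _ g.as_sum_range_C_mul_X_pow
    rw [hg]
    rw [Finset.sum_range_succ, polyToRat, map_add, map_sum, add_mul, Finset.sum_mul]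
    congr 1
    · refine Finset.sum_congr rfl fun i hi => ?_
      have hi := (Finset.mem_range.1 hi).le
      rw [map_mul, map_pow, RatFunc.algebraMap_X, mul_assoc]
      congr 1
      obtain ⟨m, hm⟩ := Nat.exists_eq_add_of_le hi
      rw [hm, pow_add, ← mul_assoc, inv_pow, mul_inv_cancel₀ (pow_ne_zero _ hX)]
      simp
    · rw [coeff_natDegree, hlead, map_mul, map_pow, RatFunc.algebraMap_X, mul_assoc, inv_pow,
        mul_inv_cancel₀ (pow_ne_zero _ hX)]
      simp
  rw [hsum]
  refine sum_mem fun i hi => ?_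
  have hi := Finset.mem_range.1 hi
  have h1 : ((RatFunc.X : k2)⁻¹) ^ (g.natDegree - i) ∈ p.1.nonunits := by
    obtain ⟨m, hm⟩ := Nat.exists_eq_add_of_lt hi
    rw [show g.natDegree - i = m + 1 by omega]
    obtain ⟨h1, h2⟩ := ValuationSubring.mem_nonunits_iff_exists_mem_maximalIdeal.1
      (invX_mem_nonunits p hT)
    refine ValuationSubring.mem_nonunits_iff_exists_mem_maximalIdeal.2 ⟨pow_mem h1 _, ?_⟩
    exact Ideal.pow_mem_of_mem _ h2 _ (Nat.succ_pos _)
  have : ∀ c : ZMod 2, c = 0 ∨ c = 1 := by decide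
  rcases this (g.coeff i) with h | h
  · rw [h, polyToRat, map_zero, map_zero, zero_mul]; exact zero_mem _
  · rwa [h, polyToRat, map_one, map_one, one_mul]

theorem add_one_mem_of_sub_mem_nonunits {x : k2} (hx : x - 1 ∈ p.1.nonunits) :
    x ≠ 0 ∧ x ∈ p.1 ∧ x⁻¹ ∈ p.1 := by
  obtain ⟨h1, h2⟩ := ValuationSubring.mem_nonunits_iff_exists_mem_maximalIdeal.1 hx
  have hxO : x ∈ p.1 := by
    have := p.1.add_mem _ _ h1 p.1.one_mem
    simpa using this
  have hu : IsUnit (⟨x, hxO⟩ : p.1) := by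
    by_contra hu
    have h3 : (⟨x, hxO⟩ : p.1) ∈ maximalIdeal p.1 := hu
    have h4 := Ideal.sub_mem _ h3 h2
    apply (Ideal.ne_top_iff_one _).1 (Ideal.IsPrime.ne_top (inferInstance :
      (maximalIdeal p.1).IsPrime))
    convert h4
    apply Subtype.ext
    change (1 : k2) = x - (x - 1)
    ring
  obtain ⟨u, hu⟩ := hu
  have hux : ((u : p.1) : k2) = x := congrArg Subtype.val hu
  have h5 : x * (((u⁻¹ : p.1ˣ) : p.1) : k2) = 1 := by
    rw [← hux]; exact congrArg Subtype.val u.mul_inv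
  refine ⟨left_ne_zero_of_mul_eq_one h5, hxO, ?_⟩
  rw [inv_eq_of_mul_eq_one_right h5]
  exact (u⁻¹ : p.1ˣ).1.2

/-- Every nonzero rational function is a power of `T⁻¹` times a principal unit, at infinity. -/
theorem exists_eq_principal_unit_mul (f : k2) (hf : f ≠ 0) :
    ∃ u : k2, u - 1 ∈ p.1.nonunits ∧ f = u * ((RatFunc.X : k2)⁻¹) ^ (-f.intDegree) := by
  have hX := ratFuncX_ne_zero p hT
  have hn : f.num ≠ 0 := RatFunc.num_ne_zero hf
  have hd : f.denom ≠ 0 := f.denom_ne_zero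
  have h1 := polyToRat_sub_mem_nonunits p hT f.num hn
  have h2 := polyToRat_sub_mem_nonunits p hT f.denom hd
  obtain ⟨h20, h21, h22⟩ := add_one_mem_of_sub_mem_nonunits p hT h2
  set a := polyToRat f.num * ((RatFunc.X : k2)⁻¹) ^ f.num.natDegree with ha
  set b := polyToRat f.denom * ((RatFunc.X : k2)⁻¹) ^ f.denom.natDegree with hb
  refine ⟨a * b⁻¹, ?_, ?_⟩
  · have h3 : a * b⁻¹ - 1 = ((a - 1) - (b - 1)) * b⁻¹ := by
      field_simp; ring
    rw [h3]
    have h4 := sub_mem h1 h2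
    obtain ⟨h5, h6⟩ := ValuationSubring.mem_nonunits_iff_exists_mem_maximalIdeal.1 h4
    exact ValuationSubring.mem_nonunits_iff_exists_mem_maximalIdeal.2
      ⟨p.1.mul_mem _ _ h5 h22, Ideal.mul_mem_right ⟨b⁻¹, h22⟩ _ h6⟩
  · have hd0 : polyToRat f.denom ≠ 0 := by simpa using hd
    conv_lhs => rw [← RatFunc.num_div_denom f]
    rw [RatFunc.intDegree, ha, hb, neg_sub, zpow_sub₀ (inv_ne_zero hX), zpow_natCast, zpow_natCast]
    change polyToRat f.num / polyToRat f.denom = _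
    field_simp

theorem mem_infinitePlace_iff (f : k2) : f ∈ p.1 ↔ f = 0 ∨ f.intDegree ≤ 0 := by
  by_cases hf : f = 0
  · simp [hf, p.1.zero_mem]
  have hX := ratFuncX_ne_zero p hT
  obtain ⟨u, hu, hfu⟩ := exists_eq_principal_unit_mul p hT f hf
  obtain ⟨hu0, hu1, hu2⟩ := add_one_mem_of_sub_mem_nonunits p hT hu
  have hXi := ValuationSubring.nonunits_subset (invX_mem_nonunits p hT)
  constructor
  · intro h
    right
    by_contra hd
    push Not at hd
    apply hT
    have h1 : (RatFunc.X : k2) =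
        f * u⁻¹ * ((RatFunc.X : k2)⁻¹) ^ (f.intDegree - 1).toNat := by
      rw [← zpow_natCast, Int.toNat_of_nonneg (by omega)]
      generalize f.intDegree = d at hfu
      rw [hfu, mul_right_comm u, mul_inv_cancel₀ hu0, one_mul, ← zpow_add₀ (inv_ne_zero hX)]
      simp
    rw [h1]
    exact p.1.mul_mem _ _ (p.1.mul_mem _ _ h hu2) (pow_mem hXi _)
  · rintro (h | h)
    · exact absurd h hf
    · rw [hfu]
      obtain ⟨n, hn⟩ := Int.eq_ofNat_of_zero_le (show 0 ≤ -f.intDegree by omega)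
      rw [hn, zpow_natCast]
      exact p.1.mul_mem _ _ hu1 (pow_mem hXi n)

theorem infinitePlace_isDVR : IsDiscreteValuationRing p.1 := by
  have hX := ratFuncX_ne_zero p hT
  obtain ⟨hXi, hXm⟩ := ValuationSubring.mem_nonunits_iff_exists_mem_maximalIdeal.1
    (invX_mem_nonunits p hT)
  set t : p.1 := ⟨_, hXi⟩ with ht
  have ht0 : t ≠ 0 := by
    intro h; exact inv_ne_zero hX (congrArg Subtype.val h)
  have key : ∀ x : p.1, x ≠ 0 → ∃ n : ℕ, Associated (t ^ n) x := by
    rintro ⟨f, hfO⟩ hf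
    have hf0 : f ≠ 0 := fun h => hf (Subtype.ext h)
    obtain ⟨u, hu, hfu⟩ := exists_eq_principal_unit_mul p hT f hf0
    obtain ⟨hu0, hu1, hu2⟩ := add_one_mem_of_sub_mem_nonunits p hT hu
    have hdeg := ((mem_infinitePlace_iff p hT f).1 hfO).resolve_left hf0
    obtain ⟨n, hn⟩ := Int.eq_ofNat_of_zero_le (show 0 ≤ -f.intDegree by omega)
    let v : p.1ˣ := ⟨⟨u, hu1⟩, ⟨u⁻¹, hu2⟩, Subtype.ext (mul_inv_cancel₀ hu0),
      Subtype.ext (inv_mul_cancel₀ hu0)⟩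
    refine ⟨n, v, Subtype.ext ?_⟩
    change ((RatFunc.X : k2)⁻¹) ^ n * u = f
    conv_rhs => rw [hfu, hn, zpow_natCast]
    ring
  refine IsDiscreteValuationRing.ofHasUnitMulPowIrreducibleFactorization ⟨t, ?_, fun {x} => key x⟩
  refine ⟨hXm, ?_⟩
  intro a b hab
  have ha : a ≠ 0 := by rintro rfl; rw [zero_mul] at hab; exact ht0 hab
  have hb : b ≠ 0 := by rintro rfl; rw [mul_zero] at hab; exact ht0 hab
  obtain ⟨m, hm⟩ := key a ha
  obtain ⟨n, hn⟩ := key b hb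
  rcases Nat.eq_zero_or_pos m with rfl | hm0
  · left; rw [pow_zero] at hm; exact (hm.isUnit_iff).1 isUnit_one
  rcases Nat.eq_zero_or_pos n with rfl | hn0
  · right; rw [pow_zero] at hn; exact (hn.isUnit_iff).1 isUnit_one
  exfalso
  have h1 : Associated (t ^ m * t ^ n) (t * 1) := by rw [mul_one]; nth_rw 3 [hab]; exact hm.mul_mul hn
  obtain ⟨i, rfl⟩ := Nat.exists_eq_add_of_lt hm0
  rw [zero_add, pow_succ', mul_assoc] at h1
  have h2 := (Associated.of_mul_left h1 (Associated.refl t) ht0).symm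
  have h3 : IsUnit (t ^ i * t ^ n) := h2.isUnit_iff.1 isUnit_one
  have h4 := isUnit_of_mul_isUnit_right h3
  exact hXm ((isUnit_pow_iff hn0.ne').1 h4)

theorem ordAt_infinitePlace (f : k2) (hf : f ≠ 0) : ordAt p.1 f = -f.intDegree := by
  have hX := ratFuncX_ne_zero p hT
  have hdvr := infinitePlace_isDVR p hT
  have key : ∀ (f : k2), f ≠ 0 → (0 ≤ ordAt p.1 f ↔ f.intDegree ≤ 0) := fun f hf => by
    rw [ordAt_nonneg_iff, mem_infinitePlace_iff p hT]; simp [hf]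
  obtain ⟨t, ht0, ht⟩ := exists_ordAt_eq_one (O := p.1)
  have htinv : ordAt p.1 t⁻¹ = -1 := by rw [ordAt_inv ht0, ht]
  have hXpos : 0 < ordAt p.1 (RatFunc.X : k2)⁻¹ :=
    (mem_nonunits_iff_ordAt_pos (inv_ne_zero hX)).1 (invX_mem_nonunits p hT)
  have htd : t.intDegree < 0 := by
    have h := (key t⁻¹ (inv_ne_zero ht0)).not
    rw [RatFunc.intDegree_inv, htinv] at h
    omega
  have hX1 : ordAt p.1 (RatFunc.X : k2)⁻¹ = 1 := by
    have h := (key (t * RatFunc.X) (mul_ne_zero ht0 hX)).2 (by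
      rw [RatFunc.intDegree_mul ht0 hX, RatFunc.intDegree_X]; omega)
    rw [ordAt_mul ht0 hX, ht] at h
    rw [ordAt_inv hX] at hXpos ⊢
    omega
  obtain ⟨u, hu, hfu⟩ := exists_eq_principal_unit_mul p hT f hf
  obtain ⟨hu0, hu1, hu2⟩ := add_one_mem_of_sub_mem_nonunits p hT hu
  have huord : ordAt p.1 u = 0 := by
    have h1 := ordAt_nonneg_of_mem hu1
    have h2 := ordAt_nonneg_of_mem hu2
    rw [ordAt_inv hu0] at h2
    omega
  have hpow : ∀ n : ℤ, ordAt p.1 (((RatFunc.X : k2)⁻¹) ^ n) = n := by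
    intro n
    obtain ⟨m, rfl | rfl⟩ := n.eq_nat_or_neg
    · rw [zpow_natCast, ordAt_pow (inv_ne_zero hX), hX1, mul_one]
    · rw [zpow_neg, zpow_natCast, ordAt_inv (pow_ne_zero _ (inv_ne_zero hX)),
        ordAt_pow (inv_ne_zero hX), hX1, mul_one]
  conv_lhs => rw [hfu]
  rw [ordAt_mul hu0 (zpow_ne_zero _ (inv_ne_zero hX)), huord, hpow, zero_add]

theorem infinitePlace_residue (x : ResidueField p.1) : x = 0 ∨ x = 1 := by
  have hdvr := infinitePlace_isDVR p hT
  obtain ⟨⟨f, hfO⟩, rfl⟩ := residue_surjective x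
  by_cases hf : f ∈ p.1.nonunits
  · left
    rw [residue_eq_zero_iff]
    exact ValuationSubring.coe_mem_nonunits_iff.1 hf
  · right
    have hf0 : f ≠ 0 := by rintro rfl; exact hf (zero_mem _)
    rw [mem_nonunits_iff_ordAt_pos hf0, ordAt_infinitePlace p hT f hf0] at hf
    have hdeg := ((mem_infinitePlace_iff p hT f).1 hfO).resolve_left hf0
    have hd : f.intDegree = 0 := by omega
    obtain ⟨u, hu, hfu⟩ := exists_eq_principal_unit_mul p hT f hf0
    rw [hd, neg_zero, zpow_zero, mul_one] at hfu
    subst hfu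
    obtain ⟨h1, h2⟩ := ValuationSubring.mem_nonunits_iff_exists_mem_maximalIdeal.1 hu
    have h3 := (residue_eq_zero_iff _).2 h2
    rw [← sub_eq_zero, ← map_one (residue p.1), ← map_sub]
    exact h3

theorem infinitePlace_finite : Finite (ResidueField p.1) := by
  have : (Set.univ : Set (ResidueField p.1)) ⊆ {0, 1} := fun x _ => infinitePlace_residue p hT x
  exact Set.finite_univ_iff.1 ((Set.toFinite _).subset this)

theorem infinitePlace_degree : placeDegree (ZMod 2) p = 1 := by
  apply placeDegree_eq_of_card
  have h := infinitePlace_finite p hT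
  have : Fintype (ResidueField p.1) := Fintype.ofFinite _
  have hu : (Finset.univ : Finset (ResidueField p.1)) = {0, 1} := by
    ext x; simpa using infinitePlace_residue p hT x
  rw [Nat.card_eq_fintype_card, ← Finset.card_univ, hu, Finset.card_pair zero_ne_one, pow_one]

end Infinite

theorem infinitePlace_unique (p p' : Place (ZMod 2) k2) (hT : RatFunc.X ∉ p.1)
    (hT' : RatFunc.X ∉ p'.1) : p = p' := by
  apply Subtype.ext
  ext f
  rw [mem_infinitePlace_iff p hT, mem_infinitePlace_iff p' hT']

theorem place_isDVR (p : Place (ZMod 2) k2) : IsDiscreteValuationRing p.1 := by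
  by_cases hT : RatFunc.X ∈ p.1
  · exact finitePlace_isDVR p hT
  · exact infinitePlace_isDVR p hT

theorem place_finite (p : Place (ZMod 2) k2) : Finite (ResidueField p.1) := by
  by_cases hT : RatFunc.X ∈ p.1
  · obtain ⟨π, -, -, -, h, -⟩ := finitePlace_exists_irreducible p hT
    exact h
  · exact infinitePlace_finite p hT

end RationalPlaces

section ExtensionPlaces

open IsLocalRing

theorem mem_of_isIntegral {K A : Type*} [Field K] [CommRing A] [Algebra A K]
    (V : ValuationSubring K) (hA : ∀ a : A, algebraMap A K a ∈ V) {x : K} (hx : IsIntegral A x) :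
    x ∈ V := by
  let := ((algebraMap A K).codRestrict V.toSubring hA).toAlgebra
  have : IsScalarTower A V K := IsScalarTower.of_algebraMap_eq fun _ => rfl
  obtain ⟨y, rfl⟩ := IsIntegrallyClosed.isIntegral_iff.1 (hx.tower_top (A := V))
  exact y.2

theorem constants_mem {K : Type*} [Field K] [Algebra (ZMod 2) K] (V : ValuationSubring K)
    (c : ZMod 2) : algebraMap (ZMod 2) K c ∈ V := by
  have : ∀ c : ZMod 2, c = 0 ∨ c = 1 := by decide
  rcases this c with rfl | rfl
  · rw [map_zero]; exact V.zero_mem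
  · rw [map_one]; exact V.one_mem

variable {K : Type*} [Field K] [Algebra (ZMod 2) K] [Algebra k2 K]

theorem comap_ne_top {k K : Type*} [Field k] [Field K] [Algebra k K] [Algebra.IsAlgebraic k K]
    {V : ValuationSubring K} (hV : V ≠ ⊤) : V.comap (algebraMap k K) ≠ ⊤ := by
  intro h
  apply hV
  rw [eq_top_iff]
  rintro x -
  refine mem_of_isIntegral V (A := k) (fun a => ?_) (Algebra.IsIntegral.isIntegral x)
  have : a ∈ V.comap (algebraMap k K) := by rw [h]; exact ValuationSubring.mem_top a
  exact this

theorem ne_top_of_comap {k K : Type*} [Field k] [Field K] [Algebra k K]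
    {V : ValuationSubring K} (hV : V.comap (algebraMap k K) ≠ ⊤) : V ≠ ⊤ := by
  rintro rfl
  apply hV
  rw [eq_top_iff]
  rintro x -
  exact ValuationSubring.mem_top _

/-- The place of `k` below a place of an algebraic extension. -/
def placeBelow [Algebra.IsAlgebraic k2 K] (P : Place (ZMod 2) K) : Place (ZMod 2) k2 :=
  ⟨P.1.comap (algebraMap k2 K), comap_ne_top P.2.1, constants_mem _⟩

theorem liesOver_placeBelow [Algebra.IsAlgebraic k2 K] (P : Place (ZMod 2) K) :
    LiesOver (ZMod 2) P (placeBelow P) := rfl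

variable (p : Place (ZMod 2) k2)

theorem integralClosure_mem {P : Place (ZMod 2) K} (hP : LiesOver (ZMod 2) P p)
    (b : integralClosure p.1 K) : (b : K) ∈ P.1 := by
  refine mem_of_isIntegral P.1 (A := p.1) (fun a => ?_) b.2
  have : (a : k2) ∈ P.1.comap (algebraMap k2 K) := by rw [hP]; exact a.2
  exact this

/-- The integral closure of the valuation ring below is contained in the valuation ring above. -/
def integralClosureHom {P : Place (ZMod 2) K} (hP : LiesOver (ZMod 2) P p) :
    integralClosure p.1 K →+* P.1 :=
  (algebraMap (integralClosure p.1 K) K).codRestrict P.1.toSubring (integralClosure_mem p hP)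

/-- The prime of the integral closure attached to a place above. -/
def primeOf {P : Place (ZMod 2) K} (hP : LiesOver (ZMod 2) P p) : Ideal (integralClosure p.1 K) :=
  (maximalIdeal P.1).comap (integralClosureHom p hP)

theorem mem_primeOf {P : Place (ZMod 2) K} (hP : LiesOver (ZMod 2) P p)
    (b : integralClosure p.1 K) : b ∈ primeOf p hP ↔ (b : K) ∈ P.1.nonunits := by
  rw [primeOf, Ideal.mem_comap, ← ValuationSubring.coe_mem_nonunits_iff]
  rfl

theorem nonunits_comap {P : Place (ZMod 2) K} (hP : LiesOver (ZMod 2) P p) (x : k2) :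
    algebraMap k2 K x ∈ P.1.nonunits ↔ x ∈ p.1.nonunits := by
  rw [ValuationSubring.mem_nonunits_iff_or, ValuationSubring.mem_nonunits_iff_or, ← map_inv₀,
    ← hP]
  simp

instance primeOf_liesOver {P : Place (ZMod 2) K} (hP : LiesOver (ZMod 2) P p) :
    (primeOf p hP).LiesOver (maximalIdeal p.1) := by
  constructor
  ext a
  rw [Ideal.under, Ideal.mem_comap, mem_primeOf, ← ValuationSubring.coe_mem_nonunits_iff,
    ← nonunits_comap p hP]
  rfl

instance primeOf_isPrime {P : Place (ZMod 2) K} (hP : LiesOver (ZMod 2) P p) :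
    (primeOf p hP).IsPrime := by
  unfold primeOf; infer_instance

variable [FiniteDimensional k2 K] [Algebra.IsSeparable k2 K]

theorem mem_place_iff {P : Place (ZMod 2) K} (hP : LiesOver (ZMod 2) P p) (x : K) :
    x ∈ P.1 ↔ ∃ n s : integralClosure p.1 K, s ∉ primeOf p hP ∧ x * s = n := by
  have := place_isDVR p
  let := (integralClosureHom p hP).toAlgebra
  have : IsScalarTower (integralClosure p.1 K) P.1 K := IsScalarTower.of_algebraMap_eq fun _ => rfl
  have := integralClosure.isDedekindDomain p.1 k2 K
  have := integralClosure.isFractionRing_of_finite_extension (A := p.1) k2 K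
  have hloc := isLocalization_place P.1 (integralClosure p.1 K) P.2.1
  constructor
  · intro hx
    obtain ⟨⟨n, s⟩, h⟩ := IsLocalization.surj
      ((maximalIdeal P.1).under (integralClosure p.1 K)).primeCompl (⟨x, hx⟩ : P.1)
    exact ⟨n, s, s.2, congrArg Subtype.val h⟩
  · rintro ⟨n, s, hs, h⟩
    rw [mem_primeOf, ValuationSubring.mem_nonunits_iff_or] at hs
    push Not at hs
    rw [eq_mul_inv_iff_mul_eq₀ hs.1 |>.2 h]
    exact P.1.mul_mem _ _ (integralClosure_mem p hP n) hs.2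

theorem primeOf_injective {P P' : Place (ZMod 2) K} (hP : LiesOver (ZMod 2) P p)
    (hP' : LiesOver (ZMod 2) P' p) (h : primeOf p hP = primeOf p hP') : P = P' := by
  apply Subtype.ext
  ext x
  rw [mem_place_iff p hP, mem_place_iff p hP', h]

theorem maximalIdeal_ne_bot : maximalIdeal p.1 ≠ ⊥ := by
  have := place_isDVR p
  exact IsDiscreteValuationRing.not_a_field p.1

theorem exists_place_of_prime (Q : Ideal (integralClosure p.1 K)) [hQ : Q.IsPrime]
    [hQl : Q.LiesOver (maximalIdeal p.1)] :
    ∃ (P : Place (ZMod 2) K) (hP : LiesOver (ZMod 2) P p), primeOf p hP = Q := by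
  have := place_isDVR p
  have := integralClosure.isDedekindDomain p.1 k2 K
  have := integralClosure.isFractionRing_of_finite_extension (A := p.1) k2 K
  have hQ0 : Q ≠ ⊥ := by
    rintro rfl
    apply maximalIdeal_ne_bot p
    rw [hQl.over]
    ext a
    rw [Ideal.under, Ideal.mem_comap, Ideal.mem_bot, Ideal.mem_bot]
    constructor
    · intro h
      have h1 : algebraMap k2 K (a : k2) = 0 := congrArg Subtype.val h
      rw [map_eq_zero] at h1
      exact Subtype.ext h1
    · rintro rfl
      exact map_zero _
  let v : IsDedekindDomain.HeightOneSpectrum (integralClosure p.1 K) := ⟨Q, hQ, hQ0⟩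
  let V := (v.valuation K).valuationSubring
  have hmem : ∀ x : K, x ∈ V ↔ v.valuation K x ≤ 1 := fun x => Valuation.mem_valuationSubring_iff _ x
  have hB : ∀ b : integralClosure p.1 K, (b : K) ∈ V := fun b => by
    rw [hmem]; exact v.valuation_le_one b
  have hcoe : ∀ a : p.1, ((algebraMap p.1 (integralClosure p.1 K) a : integralClosure p.1 K) : K) =
    algebraMap k2 K a := fun a => rfl
  have hle : p.1 ≤ V.comap (algebraMap k2 K) := by
    intro a ha
    exact hB (algebraMap p.1 (integralClosure p.1 K) ⟨a, ha⟩)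
  have hcomap : V.comap (algebraMap k2 K) = p.1 := by
    apply le_antisymm _ hle
    intro x hx
    by_contra hxp
    have hx0 : x ≠ 0 := by rintro rfl; exact hxp p.1.zero_mem
    have h1 : x⁻¹ ∈ p.1.nonunits := by
      rw [ValuationSubring.inv_mem_nonunits_iff]; exact Or.inr hxp
    obtain ⟨h2, h3⟩ := ValuationSubring.mem_nonunits_iff_exists_mem_maximalIdeal.1 h1
    have h4 : algebraMap p.1 (integralClosure p.1 K) ⟨x⁻¹, h2⟩ ∈ Q := by
      rw [hQl.over] at h3; exact h3
    have h5 := (v.valuation_lt_one_iff_mem (K := K) _).2 h4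
    have h6 : v.valuation K (algebraMap k2 K x) ≤ 1 := (hmem _).1 hx
    have h7 : v.valuation K (algebraMap k2 K x⁻¹) < 1 := h5
    rw [map_inv₀, map_inv₀] at h7
    have h8 : v.valuation K (algebraMap k2 K x) ≠ 0 := by simpa using hx0
    exact absurd h7 (not_lt.2 ((one_le_inv₀ (zero_lt_iff.2 h8)).2 h6))
  let P : Place (ZMod 2) K :=
    ⟨V, ne_top_of_comap (by rw [hcomap]; exact p.2.1), constants_mem _⟩
  have hP : LiesOver (ZMod 2) P p := hcomap
  refine ⟨P, hP, ?_⟩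
  ext b
  refine (mem_primeOf p hP b).trans ?_
  rw [← IsDedekindDomain.HeightOneSpectrum.valuation_lt_one_iff_mem (K := K) v]
  change (b : K) ∈ V.nonunits ↔ v.valuation K (b : K) < 1
  rw [ValuationSubring.mem_nonunits_iff_or, hmem]
  by_cases hb : (b : K) = 0
  · simp [hb]
  · have h8 : v.valuation K (b : K) ≠ 0 := by simpa using hb
    rw [map_inv₀, inv_le_one₀ (zero_lt_iff.2 h8)]
    simp [hb]

end ExtensionPlaces

section Galois

open IsLocalRing

theorem mem_maximalIdeal_pow_iff {K : Type*} [Field K] (O : ValuationSubring K)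
    [IsDiscreteValuationRing O] {x : O} (hx : (x : K) ≠ 0) (n : ℕ) :
    x ∈ maximalIdeal O ^ n ↔ (n : ℤ) ≤ ordAt O (x : K) := by
  obtain ⟨π, hπ⟩ := exists_uniformizer O
  have hπ0 := coe_irreducible_ne_zero hπ
  rw [(IsDiscreteValuationRing.irreducible_iff_uniformizer π).1 hπ,
    Ideal.span_singleton_pow, Ideal.mem_span_singleton, le_ordAt_iff hπ hx]
  constructor
  · rintro ⟨c, rfl⟩
    have : ((π ^ n * c : O) : K) * (π : K) ^ (-(n : ℤ)) = c := by
      push_cast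
      rw [zpow_neg, zpow_natCast]; field_simp
    rw [this]; exact c.2
  · intro h
    refine ⟨⟨_, h⟩, Subtype.ext ?_⟩
    push_cast
    rw [zpow_neg, zpow_natCast]; field_simp

variable {K : Type*} [Field K] [Algebra (ZMod 2) K] [Algebra k2 K]
variable [FiniteDimensional k2 K]

theorem place_isDVR_above [Algebra.IsSeparable k2 K] (P : Place (ZMod 2) K) :
    IsDiscreteValuationRing P.1 := by
  have hP := liesOver_placeBelow P
  set p := placeBelow P
  have := place_isDVR p
  let := (integralClosureHom p hP).toAlgebra
  have : IsScalarTower (integralClosure p.1 K) P.1 K := IsScalarTower.of_algebraMap_eq fun _ => rfl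
  have := integralClosure.isDedekindDomain p.1 k2 K
  have := integralClosure.isFractionRing_of_finite_extension (A := p.1) k2 K
  exact isDVR_place P.1 (integralClosure p.1 K) P.2.1

theorem ordAt_algebraMap_of_uniformizer {P : Place (ZMod 2) K} {p : Place (ZMod 2) k2}
    [IsDiscreteValuationRing P.1] [IsDiscreteValuationRing p.1]
    (hP : LiesOver (ZMod 2) P p) {π : p.1} (hπ : Irreducible π) {x : k2} (hx : x ≠ 0) :
    ordAt P.1 (algebraMap k2 K x) = ordAt P.1 (algebraMap k2 K π) * ordAt p.1 x := by
  obtain ⟨u, hu⟩ := exists_unit_mul_zpow p.1 hπ hx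
  have hu0 : algebraMap k2 K ((u : p.1) : k2) ≠ 0 := by
    simpa using (coe_unit_ne_zero p.1 u)
  have hmem : ∀ a : p.1, algebraMap k2 K a ∈ P.1 := fun a => by
    have : (a : k2) ∈ P.1.comap (algebraMap k2 K) := by rw [hP]; exact a.2
    exact this
  have hord : ordAt P.1 (algebraMap k2 K ((u : p.1) : k2)) = 0 := by
    have h1 := ordAt_nonneg_of_mem (hmem u)
    have h2 := ordAt_nonneg_of_mem (hmem (u⁻¹ : p.1ˣ))
    have h3 := ordAt_mul (O := P.1) hu0 (g := algebraMap k2 K ((u⁻¹ : p.1ˣ) : p.1))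
      (by simpa using (coe_unit_ne_zero p.1 u⁻¹))
    have h4 : ((u : p.1) : k2) * ((u⁻¹ : p.1ˣ) : p.1) = 1 := by
      exact congrArg Subtype.val u.mul_inv
    rw [← map_mul, h4, map_one, ordAt_one] at h3
    omega
  have hπ0 : algebraMap k2 K π ≠ 0 := by simpa using coe_irreducible_ne_zero hπ
  have hz : ∀ n : ℤ, ordAt P.1 (algebraMap k2 K (π : k2) ^ n) = ordAt P.1 (algebraMap k2 K π) * n := by
    intro n
    obtain ⟨m, rfl | rfl⟩ := n.eq_nat_or_neg
    · rw [zpow_natCast, ordAt_pow hπ0]; ring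
    · rw [zpow_neg, zpow_natCast, ordAt_inv (pow_ne_zero _ hπ0), ordAt_pow hπ0]; ring
  conv_lhs => rw [hu]
  rw [map_mul, map_zpow₀, ordAt_mul hu0 (zpow_ne_zero _ hπ0), hord, zero_add, hz]

theorem galois_efr [IsGalois k2 K] (p : Place (ZMod 2) k2) :
    ∃ e f : ℕ, 0 < e ∧ 0 < f ∧ {P : Place (ZMod 2) K | LiesOver (ZMod 2) P p}.Finite ∧
      {P : Place (ZMod 2) K | LiesOver (ZMod 2) P p}.ncard * (e * f) = Module.finrank k2 K ∧
      ∀ P : Place (ZMod 2) K, LiesOver (ZMod 2) P p →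
        Finite (ResidueField P.1) ∧ placeDegree (ZMod 2) P = f * placeDegree (ZMod 2) p ∧
        ∀ x : k2, x ≠ 0 → ordAt P.1 (algebraMap k2 K x) = e * ordAt p.1 x := by
  have hp1 := place_isDVR p
  have := integralClosure.isDedekindDomain p.1 k2 K
  have := integralClosure.isFractionRing_of_finite_extension (A := p.1) k2 K
  have hfin : Module.Finite p.1 (integralClosure p.1 K) :=
    IsIntegralClosure.finite p.1 k2 K (integralClosure p.1 K)
  have : IsGaloisGroup (K ≃ₐ[k2] K) p.1 (integralClosure p.1 K) :=
    IsGaloisGroup.of_isFractionRing _ p.1 (integralClosure p.1 K) k2 K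
  have hmax : (maximalIdeal p.1).IsMaximal := inferInstance
  set B := integralClosure p.1 K with hB
  have key := Ideal.ncard_primesOver_mul_ramificationIdxIn_mul_inertiaDegIn
    (maximalIdeal p.1) B (K ≃ₐ[k2] K)
  rw [IsGalois.card_aut_eq_finrank] at key
  have hbij : Set.BijOn (fun P : Place (ZMod 2) K =>
      if h : LiesOver (ZMod 2) P p then primeOf p h else ⊥)
      {P : Place (ZMod 2) K | LiesOver (ZMod 2) P p} ((maximalIdeal p.1).primesOver B) := by
    refine ⟨?_, ?_, ?_⟩
    · intro P hP
      have hP' : LiesOver (ZMod 2) P p := hP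
      simp only [hP', dif_pos]
      exact ⟨primeOf_isPrime p hP', primeOf_liesOver p hP'⟩
    · intro P hP P' hP' h
      have h1 : LiesOver (ZMod 2) P p := hP
      have h2 : LiesOver (ZMod 2) P' p := hP'
      simp only [h1, h2, dif_pos] at h
      exact primeOf_injective p h1 h2 h
    · rintro Q ⟨hQ1, hQ2⟩
      obtain ⟨P, hP, h⟩ := exists_place_of_prime p Q
      refine ⟨P, hP, ?_⟩
      simp only [hP, dif_pos]
      exact h
  have hncard : {P : Place (ZMod 2) K | LiesOver (ZMod 2) P p}.ncard =
      ((maximalIdeal p.1).primesOver B).ncard := by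
    rw [← hbij.image_eq, hbij.injOn.ncard_image]
  have hpos : 0 < Module.finrank k2 K := Module.finrank_pos
  have h0 : 0 < (maximalIdeal p.1).ramificationIdxIn B ∧ 0 < (maximalIdeal p.1).inertiaDegIn B := by
    rw [← key] at hpos
    constructor
    · exact Nat.pos_of_ne_zero fun h => by simp [h] at hpos
    · exact Nat.pos_of_ne_zero fun h => by simp [h] at hpos
  refine ⟨_, _, h0.1, h0.2, ?_, by rw [hncard]; exact key, ?_⟩
  · apply Set.finite_of_ncard_ne_zero
    intro h
    rw [← hncard, h, zero_mul] at key
    omega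
  · intro P hP
    have := primeOf_isPrime p hP
    have := primeOf_liesOver p hP
    let := (integralClosureHom p hP).toAlgebra
    have : IsScalarTower B P.1 K := IsScalarTower.of_algebraMap_eq fun _ => rfl
    have hloc : IsLocalization.AtPrime P.1 (primeOf p hP) := isLocalization_place P.1 B P.2.1
    have hPdvr := place_isDVR_above P
    have hqmax : (primeOf p hP).IsMaximal :=
      Ideal.IsMaximal.of_liesOver_isMaximal _ (maximalIdeal p.1)
    rw [Ideal.ramificationIdxIn_eq_ramificationIdx (maximalIdeal p.1) (primeOf p hP) (K ≃ₐ[k2] K),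
      Ideal.inertiaDegIn_eq_inertiaDeg (maximalIdeal p.1) (primeOf p hP) (K ≃ₐ[k2] K)]
    have hcard : Nat.card (ResidueField P.1) =
        2 ^ ((primeOf p hP).inertiaDeg p.1 * placeDegree (ZMod 2) p) := by
      have h1 := Ideal.cardQuot_pow_inertiaDeg (maximalIdeal p.1) (primeOf p hP)
      have h2 : Nat.card (B ⧸ primeOf p hP) = Nat.card (ResidueField P.1) :=
        Nat.card_congr (IsLocalization.AtPrime.equivQuotMaximalIdeal (primeOf p hP) P.1).toEquiv
      have := place_finite p
      have h3 : Nat.card (p.1 ⧸ maximalIdeal p.1) = 2 ^ placeDegree (ZMod 2) p :=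
        card_residueField p
      change Nat.card (p.1 ⧸ maximalIdeal p.1) ^ _ = Nat.card (B ⧸ primeOf p hP) at h1
      rw [h2, h3, ← pow_mul, mul_comm] at h1
      exact h1.symm
    have hfinP : Finite (ResidueField P.1) := Nat.finite_of_card_ne_zero (by rw [hcard]; positivity)
    refine ⟨hfinP, placeDegree_eq_of_card P hcard, ?_⟩
    obtain ⟨π, hπ⟩ := exists_uniformizer p.1
    intro x hx
    rw [ordAt_algebraMap_of_uniformizer hP hπ hx]
    congr 1
    have hmap : (maximalIdeal p.1).map (algebraMap p.1 B) = Ideal.span {algebraMap p.1 B π} := by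
      rw [(IsDiscreteValuationRing.irreducible_iff_uniformizer π).1 hπ, Ideal.map_span,
        Set.image_singleton]
    have hπB : algebraMap k2 K π ≠ 0 := by simpa using coe_irreducible_ne_zero hπ
    have hne : (maximalIdeal p.1).map (algebraMap p.1 B) ≠ ⊥ := by
      rw [hmap, Ne, Ideal.span_singleton_eq_bot]
      intro h
      exact hπB (congrArg Subtype.val h)
    rw [Ideal.IsDedekindDomain.ramificationIdx_eq_multiplicity (maximalIdeal p.1) (primeOf p hP) hne, hmap]
    have hiff : ∀ n : ℕ, primeOf p hP ^ n ∣ Ideal.span {algebraMap p.1 B π} ↔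
        (n : ℤ) ≤ ordAt P.1 (algebraMap k2 K π) := by
      intro n
      rw [Ideal.dvd_span_singleton]
      have h1 := IsLocalization.AtPrime.under_maximalIdeal_pow (primeOf p hP) P.1 n
      refine (SetLike.ext_iff.1 h1 _).symm.trans ?_
      exact mem_maximalIdeal_pow_iff P.1 (x := algebraMap B P.1 (algebraMap p.1 B π)) hπB n
    have hnn : 0 ≤ ordAt P.1 (algebraMap k2 K π) :=
      ordAt_nonneg_of_mem (algebraMap B P.1 (algebraMap p.1 B π)).2
    obtain ⟨n, hn⟩ := Int.eq_ofNat_of_zero_le hnn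
    rw [hn, multiplicity_eq_of_dvd_of_not_dvd ((hiff n).2 (by rw [hn]))
      (by rw [hiff, hn]; push_cast; omega)]

end Galois

section SmallPlaces

open IsLocalRing Polynomial

variable (p : Place (ZMod 2) k2)

theorem residue_X_pow (hT : RatFunc.X ∈ p.1) (g : (ZMod 2)[X]) (n : ℕ)
    (h : X ^ n - X = g) (hn : n = 2 ^ placeDegree (ZMod 2) p) : polyToRat g ∈ p.1.nonunits := by
  have := place_finite p
  rw [mem_nonunits_iff_polyHom p hT, ← residue_eq_zero_iff, ← h, map_sub, map_sub, map_pow, map_pow,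
    hn, residue_pow_two_pow, sub_self]

theorem polyToRat_mul_mem_nonunits (hT : RatFunc.X ∈ p.1) {g h : (ZMod 2)[X]} :
    polyToRat (g * h) ∈ p.1.nonunits ↔ polyToRat g ∈ p.1.nonunits ∨ polyToRat h ∈ p.1.nonunits := by
  simp only [mem_nonunits_iff_polyHom p hT]
  rw [map_mul]
  exact (inferInstance : (maximalIdeal p.1).IsPrime).mul_mem_iff_mem_or_mem

theorem placeDegree_le_natDegree (hT : RatFunc.X ∈ p.1) {g : (ZMod 2)[X]} (hg : g ≠ 0)
    (h : polyToRat g ∈ p.1.nonunits) : placeDegree (ZMod 2) p ≤ g.natDegree := by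
  obtain ⟨π, hπ, h1, -, -, h2, -⟩ := finitePlace_exists_irreducible p hT
  rw [h2]
  exact natDegree_le_of_dvd ((h1 g).1 h) hg

theorem natDegree_pos_ne {g : (ZMod 2)[X]} (h : 0 < g.natDegree) : g ≠ 0 := by
  rintro rfl; simp at h

theorem polyChar2 : (2 : (ZMod 2)[X]) = 0 := by
  exact_mod_cast CharP.cast_eq_zero ((ZMod 2)[X]) 2

theorem finitePlace_cases (hT : RatFunc.X ∈ p.1) (hd : placeDegree (ZMod 2) p ≤ 4) :
    (placeDegree (ZMod 2) p = 1 ∧ (polyToRat X ∈ p.1.nonunits ∨ polyToRat (X + 1) ∈ p.1.nonunits)) ∨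
    (placeDegree (ZMod 2) p = 2 ∧ polyToRat (X ^ 2 + X + 1) ∈ p.1.nonunits) ∨
    (placeDegree (ZMod 2) p = 3 ∧ (polyToRat (X ^ 3 + X + 1) ∈ p.1.nonunits ∨
      polyToRat (X ^ 3 + X ^ 2 + 1) ∈ p.1.nonunits)) ∨
    (placeDegree (ZMod 2) p = 4 ∧ (polyToRat M0 ∈ p.1.nonunits ∨
      polyToRat (X ^ 4 + X ^ 3 + 1) ∈ p.1.nonunits ∨
      polyToRat (X ^ 4 + X ^ 3 + X ^ 2 + X + 1) ∈ p.1.nonunits)) := by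
  have h0 : 0 < placeDegree (ZMod 2) p := by
    have := place_finite p
    exact placeDegree_pos p
  have c2 := polyChar2
  have d1 : (X : (ZMod 2)[X]).natDegree = 1 := natDegree_X
  have d2 : (X + 1 : (ZMod 2)[X]).natDegree = 1 := by compute_degree!
  have d3 : (X ^ 2 + X + 1 : (ZMod 2)[X]).natDegree = 2 := by compute_degree!
  have e1 : polyToRat X ∈ p.1.nonunits → placeDegree (ZMod 2) p ≤ 1 := fun h => by
    refine le_of_le_of_eq (?_) d1; exact placeDegree_le_natDegree p hT (natDegree_pos_ne (by omega)) h
  have e2 : polyToRat (X + 1) ∈ p.1.nonunits → placeDegree (ZMod 2) p ≤ 1 := fun h => by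
    refine le_of_le_of_eq (?_) d2; exact placeDegree_le_natDegree p hT (natDegree_pos_ne (by omega)) h
  have e3 : polyToRat (X ^ 2 + X + 1) ∈ p.1.nonunits → placeDegree (ZMod 2) p ≤ 2 := fun h => by
    refine le_of_le_of_eq (?_) d3; exact placeDegree_le_natDegree p hT (natDegree_pos_ne (by omega)) h
  have hd4 : placeDegree (ZMod 2) p = 1 ∨ placeDegree (ZMod 2) p = 2 ∨
      placeDegree (ZMod 2) p = 3 ∨ placeDegree (ZMod 2) p = 4 := by omega
  rcases hd4 with hdd | hdd | hdd | hdd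
  · have h := residue_X_pow p hT (X * (X + 1)) 2 (by linear_combination (-X) * c2) (by rw [hdd]; rfl)
    rw [polyToRat_mul_mem_nonunits p hT] at h
    exact Or.inl ⟨hdd, h⟩
  · have h := residue_X_pow p hT (X * (X + 1) * (X ^ 2 + X + 1)) 4
      (by linear_combination (-X ^ 3 - X ^ 2 - X) * c2) (by rw [hdd]; rfl)
    simp only [polyToRat_mul_mem_nonunits p hT] at h
    rw [hdd] at e1 e2
    rcases h with (h | h) | h
    · exact absurd (e1 h) (by norm_num)
    · exact absurd (e2 h) (by norm_num)
    · exact Or.inr (Or.inl ⟨hdd, h⟩)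
  · have h := residue_X_pow p hT (X * (X + 1) * ((X ^ 3 + X + 1) * (X ^ 3 + X ^ 2 + 1))) 8
      (by linear_combination (-X ^ 7 - X ^ 6 - 2 * X ^ 5 - 2 * X ^ 4 - X ^ 3 - X ^ 2 - X) * c2)
      (by rw [hdd]; rfl)
    simp only [polyToRat_mul_mem_nonunits p hT] at h
    rw [hdd] at e1 e2
    rcases h with (h | h) | h
    · exact absurd (e1 h) (by norm_num)
    · exact absurd (e2 h) (by norm_num)
    · exact Or.inr (Or.inr (Or.inl ⟨hdd, h⟩))
  · have h := residue_X_pow p hT (X * (X + 1) * ((X ^ 2 + X + 1) * (M0 * ((X ^ 4 + X ^ 3 + 1) *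
        (X ^ 4 + X ^ 3 + X ^ 2 + X + 1))))) 16
      (by
        rw [M0]
        linear_combination (-(X : (ZMod 2)[X]) - 2 * X ^ 2 - 4 * X ^ 3 - 6 * X ^ 4 - 9 * X ^ 5 - 13 * X ^ 6
          - 16 * X ^ 7 - 17 * X ^ 8 - 17 * X ^ 9 - 16 * X ^ 10 - 13 * X ^ 11 - 9 * X ^ 12
          - 6 * X ^ 13 - 4 * X ^ 14 - 2 * X ^ 15) * c2) (by rw [hdd]; rfl)
    simp only [polyToRat_mul_mem_nonunits p hT] at h
    rw [hdd] at e1 e2 e3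
    rcases h with (h | h) | h | h
    · exact absurd (e1 h) (by norm_num)
    · exact absurd (e2 h) (by norm_num)
    · exact absurd (e3 h) (by norm_num)
    · exact Or.inr (Or.inr (Or.inr ⟨hdd, h⟩))

theorem natDegree_M0 : M0.natDegree = 4 := by unfold M0; compute_degree!

theorem M0_ne_zero : M0 ≠ 0 := natDegree_pos_ne (by rw [natDegree_M0]; norm_num)

theorem isFinitePlaceOf_M0_iff : IsFinitePlaceOf p.1 M0 ↔
    RatFunc.X ∈ p.1 ∧ polyToRat M0 ∈ p.1.nonunits := by
  rw [ValuationSubring.mem_nonunits_iff_or]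
  have h0 : polyToRat M0 ≠ 0 := by simpa [polyToRat] using M0_ne_zero
  constructor
  · rintro ⟨h1, h2⟩
    refine ⟨?_, Or.inr h2⟩
    have := h1 X
    rwa [RatFunc.algebraMap_X] at this
  · rintro ⟨h1, h2⟩
    exact ⟨polyToRat_mem p.1 h1 p.2.2, h2.resolve_left h0⟩

theorem placeDegree_of_M0 (h : IsFinitePlaceOf p.1 M0) : placeDegree (ZMod 2) p = 4 := by
  obtain ⟨hT, hM⟩ := (isFinitePlaceOf_M0_iff p).1 h
  have hle := placeDegree_le_natDegree p hT M0_ne_zero hM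
  rw [natDegree_M0] at hle
  have h1 : polyToRat 1 ∉ p.1.nonunits := by
    rw [polyToRat, map_one, ValuationSubring.mem_nonunits_iff_or]; simp [p.1.one_mem]
  have c2 := polyChar2
  have comb : ∀ (g a b : (ZMod 2)[X]), polyToRat g ∈ p.1.nonunits → a * g + b * M0 = 1 → False := by
    intro g a b hg hab
    apply h1
    rw [mem_nonunits_iff_polyHom p hT] at hg hM ⊢
    rw [← hab, map_add, map_mul, map_mul]
    exact add_mem (Ideal.mul_mem_left _ _ hg) (Ideal.mul_mem_left _ _ hM)
  rcases finitePlace_cases p hT hle with ⟨-, h2 | h2⟩ | ⟨-, h2⟩ | ⟨-, h2 | h2⟩ | ⟨h2, -⟩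
  · exact (comb _ (X ^ 3 + 1) 1 h2 (by rw [M0]; linear_combination (X ^ 4 + X) * c2)).elim
  · exact (comb _ (X ^ 3 + X ^ 2 + X) 1 h2
      (by rw [M0]; linear_combination (X ^ 4 + X ^ 3 + X ^ 2 + X) * c2)).elim
  · exact (comb _ (X ^ 2 + X) 1 h2
      (by rw [M0]; linear_combination (X ^ 4 + X ^ 3 + X ^ 2 + X) * c2)).elim
  · exact (comb _ (X ^ 2 + 1) X h2
      (by rw [M0]; linear_combination (X ^ 5 + X ^ 3 + X ^ 2 + X) * c2)).elim
  · exact (comb _ (X ^ 2) (X + 1) h2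
      (by rw [M0]; linear_combination (X ^ 5 + X ^ 4 + X ^ 2 + X) * c2)).elim
  · exact h2

theorem finitePlace_M0_unique (p p' : Place (ZMod 2) k2) (h : IsFinitePlaceOf p.1 M0)
    (h' : IsFinitePlaceOf p'.1 M0) : p = p' := by
  have key : ∀ p : Place (ZMod 2) k2, IsFinitePlaceOf p.1 M0 →
      ∀ x : k2, x ∈ p.1 ↔ ∃ n s, ¬ M0 ∣ s ∧ x * polyToRat s = polyToRat n := by
    intro p h
    obtain ⟨hT, hM⟩ := (isFinitePlaceOf_M0_iff p).1 h
    have hd := placeDegree_of_M0 p h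
    obtain ⟨π, hπ, h1, -, -, h2, h3⟩ := finitePlace_exists_irreducible p hT
    have h4 : π ∣ M0 := (h1 _).1 hM
    have h5 : M0 ∣ π := by
      have : Associated π M0 := associated_of_dvd_of_natDegree_le h4 M0_ne_zero
        (by rw [natDegree_M0, ← h2, hd])
      exact this.symm.dvd
    intro x
    rw [h3]
    have : ∀ s, π ∣ s ↔ M0 ∣ s := fun s => ⟨h5.trans, h4.trans⟩
    simp only [this]
  apply Subtype.ext
  ext x
  rw [key p h, key p' h']

theorem exists_infinitePlace : ∃ p : Place (ZMod 2) k2, RatFunc.X ∉ p.1 := by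
  let V := (RatFunc.inftyValuation (ZMod 2)).valuationSubring
  have hX : (RatFunc.X : k2) ∉ V := by
    rw [Valuation.mem_valuationSubring_iff, RatFunc.inftyValuation.X, not_le]
    exact WithZero.exp_lt_exp.2 zero_lt_one
  refine ⟨⟨V, ?_, constants_mem V⟩, hX⟩
  intro h
  exact hX (h ▸ ValuationSubring.mem_top _)

theorem exists_place_M0 : ∃ p : Place (ZMod 2) k2, IsFinitePlaceOf p.1 M0 := by
  obtain ⟨Q, hQ, hM⟩ : ∃ Q : Ideal (ZMod 2)[X], Q.IsMaximal ∧ Ideal.span {M0} ≤ Q := by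
    apply Ideal.exists_le_maximal
    rw [Ne, Ideal.span_singleton_eq_top]
    intro h
    have := natDegree_eq_zero_of_isUnit h
    rw [natDegree_M0] at this
    omega
  rw [Ideal.span_singleton_le_iff_mem] at hM
  have hQ0 : Q ≠ ⊥ := by
    rintro rfl
    exact M0_ne_zero hM
  let v : IsDedekindDomain.HeightOneSpectrum (ZMod 2)[X] := ⟨Q, hQ.isPrime, hQ0⟩
  let V := (v.valuation k2).valuationSubring
  have hlt : v.valuation k2 (polyToRat M0) < 1 := (v.valuation_lt_one_iff_mem (K := k2) _).2 hM
  have h0 : polyToRat M0 ≠ 0 := by simpa [polyToRat] using M0_ne_zero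
  have hinv : (polyToRat M0)⁻¹ ∉ V := by
    rw [Valuation.mem_valuationSubring_iff, map_inv₀, not_le]
    exact (one_lt_inv₀ (zero_lt_iff.2 (by simpa using h0))).2 hlt
  refine ⟨⟨V, fun h => hinv (h ▸ ValuationSubring.mem_top _), constants_mem V⟩, fun g => ?_, hinv⟩
  rw [Valuation.mem_valuationSubring_iff]
  exact v.valuation_le_one g

end SmallPlaces

section RiemannRoch

open IsLocalRing

variable {K : Type*} [Field K] [Algebra (ZMod 2) K] [Algebra k2 K]
variable [FiniteDimensional k2 K] [IsGalois k2 K]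

instance placeDVR (P : Place (ZMod 2) K) : IsDiscreteValuationRing P.1 := place_isDVR_above P

instance placeFinite (P : Place (ZMod 2) K) : Finite (ResidueField P.1) := by
  obtain ⟨e, f, -, -, -, -, h⟩ := galois_efr (K := K) (placeBelow P)
  exact (h P (liesOver_placeBelow P)).1

theorem zmod_two_smul {V : Type*} [AddCommGroup V] [Module (ZMod 2) V] (S : AddSubgroup V)
    (c : ZMod 2) {x : V} (hx : x ∈ S) : c • x ∈ S := by
  have : ∀ c : ZMod 2, c = 0 ∨ c = 1 := by decide
  rcases this c with rfl | rfl
  · rw [zero_smul]; exact S.zero_mem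
  · rwa [one_smul]

omit [FiniteDimensional k2 K] [IsGalois k2 K] in
theorem char_two_neg (x : K) : -x = x := by
  have h : (2 : K) = 0 := by
    have := map_natCast (algebraMap (ZMod 2) K) 2
    have h0 : ((2 : ℕ) : ZMod 2) = 0 := by decide
    rw [h0, map_zero] at this
    exact_mod_cast this.symm
  linear_combination -x * h

theorem mem_RRspace (D : Divisor (ZMod 2) K) (f : K) :
    f ∈ RRspace (ZMod 2) D ↔ f = 0 ∨ ∀ P : Place (ZMod 2) K, -D P ≤ ordAt P.1 f := by
  let S : AddSubgroup K :=
    { carrier := {f | f = 0 ∨ ∀ P : Place (ZMod 2) K, -D P ≤ ordAt P.1 f}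
      zero_mem' := Or.inl rfl
      neg_mem' := fun {x} hx => by rw [char_two_neg]; exact hx
      add_mem' := fun {x y} hx hy => by
        by_cases h : x + y = 0
        · exact Or.inl h
        · refine Or.inr fun P => ordAt_add h ?_ ?_
          · exact hx.imp_right fun h => h P
          · exact hy.imp_right fun h => h P }
  let S' : Submodule (ZMod 2) K := { S with smul_mem' := fun c x hx => zmod_two_smul S c hx }
  have h1 : RRspace (ZMod 2) D ≤ S' := by
    refine Submodule.span_le.2 fun x hx => ?_
    refine Or.inr fun P => ?_
    have := hx P
    omega
  constructor
  · exact fun h => h1 h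
  · rintro (rfl | h)
    · exact Submodule.zero_mem _
    · refine Submodule.subset_span fun P => ?_
      have := h P
      omega

theorem RRspace_mono {D D' : Divisor (ZMod 2) K} (h : D ≤ D') :
    RRspace (ZMod 2) D ≤ RRspace (ZMod 2) D' := by
  intro f hf
  rw [mem_RRspace] at hf ⊢
  refine hf.imp_right fun h' P => ?_
  have h1 := h' P
  have h2 : D P ≤ D' P := h P
  omega

theorem card_RRspace (D : Divisor (ZMod 2) K) [Finite (RRspace (ZMod 2) D)] :
    Nat.card (RRspace (ZMod 2) D) = 2 ^ ell (ZMod 2) D := by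
  have : Module.Finite (ZMod 2) (RRspace (ZMod 2) D) := Module.Finite.of_finite
  have h := Module.natCard_eq_pow_finrank (K := ZMod 2) (V := RRspace (ZMod 2) D)
  rwa [Nat.card_zmod] at h

theorem finite_and_card_le_of_ker {G H : Type*} [AddCommGroup G] [AddCommGroup H] [Finite H]
    (φ : G →+ H) [Finite φ.ker] : Finite G ∧ Nat.card G ≤ Nat.card φ.ker * Nat.card H := by
  have hinj := QuotientAddGroup.kerLift_injective φ
  have hfin : Finite (G ⧸ φ.ker) := Finite.of_injective _ hinj
  have hcard : Nat.card G = Nat.card (G ⧸ φ.ker) * Nat.card φ.ker :=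
    AddSubgroup.card_eq_card_quotient_mul_card_addSubgroup _
  have hle := Nat.card_le_card_of_injective _ hinj
  refine ⟨?_, ?_⟩
  · apply Nat.finite_of_card_ne_zero
    rw [hcard]
    exact mul_ne_zero Nat.card_pos.ne' Nat.card_pos.ne'
  · rw [hcard, mul_comm]
    exact Nat.mul_le_mul_left _ hle

theorem ell_add_single (D : Divisor (ZMod 2) K) [Finite (RRspace (ZMod 2) D)]
    (P : Place (ZMod 2) K) :
    Finite (RRspace (ZMod 2) (D + Finsupp.single P 1)) ∧
      ell (ZMod 2) (D + Finsupp.single P 1) ≤ ell (ZMod 2) D + placeDegree (ZMod 2) P := by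
  obtain ⟨t, ht0, ht⟩ := exists_ordAt_eq_one (O := P.1)
  set D' := D + Finsupp.single P 1 with hD'
  have hDP : D' P = D P + 1 := by simp [hD']
  have hDQ : ∀ Q, Q ≠ P → D' Q = D Q := fun Q hQ => by simp [hD', hQ.symm]
  have htz : ∀ n : ℤ, ordAt P.1 (t ^ n) = n := by
    intro n
    obtain ⟨m, rfl | rfl⟩ := n.eq_nat_or_neg
    · rw [zpow_natCast, ordAt_pow ht0, ht]; ring
    · rw [zpow_neg, zpow_natCast, ordAt_inv (pow_ne_zero _ ht0), ordAt_pow ht0, ht]; ring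
  have hmem : ∀ f : RRspace (ZMod 2) D', (f : K) * t ^ D' P ∈ P.1 := by
    intro f
    rcases (mem_RRspace D' f).1 f.2 with h | h
    · rw [h, zero_mul]; exact P.1.zero_mem
    · by_cases hf : (f : K) = 0
      · rw [hf, zero_mul]; exact P.1.zero_mem
      rw [← ordAt_nonneg_iff, ordAt_mul hf (zpow_ne_zero _ ht0), htz]
      have := h P
      omega
  let φ : RRspace (ZMod 2) D' →+ ResidueField P.1 :=
    { toFun := fun f => residue P.1 ⟨_, hmem f⟩
      map_zero' := by
        rw [residue_eq_zero_iff]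
        convert (maximalIdeal P.1).zero_mem
        simp
      map_add' := fun f g => by
        rw [← map_add]
        congr 1
        exact Subtype.ext (add_mul _ _ _) }
  have hker : ∀ f : φ.ker, ((f : RRspace (ZMod 2) D') : K) ∈ RRspace (ZMod 2) D := by
    rintro ⟨f, hf⟩
    have hf' : residue P.1 ⟨_, hmem f⟩ = 0 := hf
    rw [residue_eq_zero_iff, ← ValuationSubring.coe_mem_nonunits_iff] at hf'
    rw [mem_RRspace]
    rcases (mem_RRspace D' f).1 f.2 with h | h
    · exact Or.inl h
    · by_cases hf0 : (f : K) = 0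
      · exact Or.inl hf0
      right
      intro Q
      by_cases hQ : Q = P
      · subst hQ
        change (f : K) * t ^ D' Q ∈ Q.1.nonunits at hf'
        rw [mem_nonunits_iff_ordAt_pos (mul_ne_zero hf0 (zpow_ne_zero _ ht0)),
          ordAt_mul hf0 (zpow_ne_zero _ ht0), htz] at hf'
        change -D Q ≤ ordAt Q.1 (f : K)
        omega
      · have := h Q
        rw [hDQ Q hQ] at this
        exact this
  have hkinj : Function.Injective (fun f : φ.ker => (⟨_, hker f⟩ : RRspace (ZMod 2) D)) := by
    intro f g h
    have h' : ((f : RRspace (ZMod 2) D') : K) = ((g : RRspace (ZMod 2) D') : K) :=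
      congrArg (fun x : RRspace (ZMod 2) D => (x : K)) h
    exact Subtype.ext (Subtype.ext h')
  have : Finite φ.ker := Finite.of_injective _ hkinj
  obtain ⟨hfin, hle⟩ := finite_and_card_le_of_ker φ
  refine ⟨hfin, ?_⟩
  have h2 := Nat.card_le_card_of_injective _ hkinj
  rw [card_RRspace, card_residueField] at hle
  rw [card_RRspace] at h2
  have h3 : 2 ^ ell (ZMod 2) D' ≤ 2 ^ (ell (ZMod 2) D + placeDegree (ZMod 2) P) := by
    rw [pow_add]
    exact hle.trans (Nat.mul_le_mul_right _ h2)
  exact (Nat.pow_le_pow_iff_right (by norm_num)).1 h3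

theorem degHom_single (P : Place (ZMod 2) K) (n : ℤ) :
    degHom (ZMod 2) K (Finsupp.single P n) = n * placeDegree (ZMod 2) P := by
  simp [degHom]

theorem ell_add_nat (E : Place (ZMod 2) K →₀ ℕ) : ∀ (D : Divisor (ZMod 2) K),
    Finite (RRspace (ZMod 2) D) →
    Finite (RRspace (ZMod 2) (D + E.mapRange (fun n : ℕ => (n : ℤ)) rfl)) ∧
      (ell (ZMod 2) (D + E.mapRange (fun n : ℕ => (n : ℤ)) rfl) : ℤ) ≤
        ell (ZMod 2) D + degHom (ZMod 2) K (E.mapRange (fun n : ℕ => (n : ℤ)) rfl) := by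
  induction E using Finsupp.induction_linear with
  | zero =>
    intro D hD
    simp only [Finsupp.mapRange_zero, add_zero, map_zero]
    exact ⟨hD, le_rfl⟩
  | add E₁ E₂ h₁ h₂ =>
    intro D hD
    obtain ⟨a1, a2⟩ := h₁ D hD
    obtain ⟨b1, b2⟩ := h₂ _ a1
    rw [Finsupp.mapRange_add (fun x y => by push_cast; ring), ← add_assoc, map_add]
    exact ⟨b1, by omega⟩
  | single P n =>
    simp only [Finsupp.mapRange_single, degHom_single]
    induction n with
    | zero =>
      intro D hD
      rw [Nat.cast_zero, Finsupp.single_zero, add_zero]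
      exact ⟨hD, by omega⟩
    | succ n ih =>
      intro D hD
      obtain ⟨a1, a2⟩ := ih D hD
      obtain ⟨b1, b2⟩ := ell_add_single (D + Finsupp.single P (n : ℤ)) P
      rw [add_assoc, ← Finsupp.single_add] at b1 b2
      rw [Nat.cast_succ]
      refine ⟨b1, ?_⟩
      rw [add_mul, one_mul]
      omega

theorem exists_nat_of_le {D D' : Divisor (ZMod 2) K} (h : D ≤ D') :
    ∃ E : Place (ZMod 2) K →₀ ℕ, D' = D + E.mapRange (fun n : ℕ => (n : ℤ)) rfl := by
  refine ⟨(D' - D).mapRange Int.toNat rfl, ?_⟩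
  ext P
  have h2 : D P ≤ D' P := h P
  simp only [Finsupp.add_apply, Finsupp.mapRange_apply, Finsupp.sub_apply]
  omega

theorem finite_RRspace_of_le {D D' : Divisor (ZMod 2) K} (h : D ≤ D')
    (hD : Finite (RRspace (ZMod 2) D)) : Finite (RRspace (ZMod 2) D') := by
  obtain ⟨E, rfl⟩ := exists_nat_of_le h
  exact (ell_add_nat E D hD).1

theorem deg_sub_ell_mono {D D' : Divisor (ZMod 2) K} (h : D ≤ D')
    (hD : Finite (RRspace (ZMod 2) D)) :
    degHom (ZMod 2) K D - ell (ZMod 2) D ≤ degHom (ZMod 2) K D' - ell (ZMod 2) D' := by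
  obtain ⟨E, rfl⟩ := exists_nat_of_le h
  have := (ell_add_nat E D hD).2
  rw [map_add]
  omega

/-- Multiplication by a nonzero function identifies Riemann-Roch spaces of equivalent divisors. -/
theorem ell_sub_principal (D Z : Divisor (ZMod 2) K) {z : K} (hz : z ≠ 0)
    (hZ : ∀ P : Place (ZMod 2) K, Z P = ordAt P.1 z) :
    ell (ZMod 2) (D - Z) = ell (ZMod 2) D := by
  have key : ∀ f : K, f * z ∈ RRspace (ZMod 2) (D - Z) ↔ f ∈ RRspace (ZMod 2) D := by
    intro f
    rw [mem_RRspace, mem_RRspace]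
    by_cases hf : f = 0
    · simp [hf]
    simp only [hf, mul_eq_zero, hz, or_self, false_or]
    refine forall_congr' fun P => ?_
    rw [ordAt_mul hf hz, Finsupp.sub_apply, hZ]
    constructor <;> intro <;> omega
  let e : RRspace (ZMod 2) D ≃+ RRspace (ZMod 2) (D - Z) :=
    { toFun := fun f => ⟨f * z, (key f).2 f.2⟩
      invFun := fun g => ⟨g * z⁻¹, (key _).1 (by rw [inv_mul_cancel_right₀ hz]; exact g.2)⟩
      left_inv := fun f => Subtype.ext (mul_inv_cancel_right₀ hz _)
      right_inv := fun g => Subtype.ext (inv_mul_cancel_right₀ hz _)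
      map_add' := fun f g => Subtype.ext (add_mul _ _ _) }
  let l : RRspace (ZMod 2) D ≃ₗ[ZMod 2] RRspace (ZMod 2) (D - Z) :=
    { e with map_smul' := (AddMonoidHom.toZModLinearMap 2 e.toAddMonoidHom).map_smul }
  exact l.finrank_eq.symm

end RiemannRoch

section FivePlaces

open IsLocalRing Polynomial

theorem exists_place_of_irreducible {π : (ZMod 2)[X]} (hπ : Irreducible π) :
    ∃ p : Place (ZMod 2) k2, RatFunc.X ∈ p.1 ∧ polyToRat π ∈ p.1.nonunits := by
  have hπ0 := hπ.ne_zero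
  have : (Ideal.span {π}).IsPrime := (Ideal.span_singleton_prime hπ0).2 hπ.prime
  let v : IsDedekindDomain.HeightOneSpectrum (ZMod 2)[X] :=
    ⟨Ideal.span {π}, this, by rwa [Ne, Ideal.span_singleton_eq_bot]⟩
  let V := (v.valuation k2).valuationSubring
  have hlt : v.valuation k2 (polyToRat π) < 1 :=
    (v.valuation_lt_one_iff_mem (K := k2) _).2 (Ideal.mem_span_singleton_self π)
  have h0 : polyToRat π ≠ 0 := by simpa [polyToRat] using hπ0
  have hinv : (polyToRat π)⁻¹ ∉ V := by
    rw [Valuation.mem_valuationSubring_iff, map_inv₀, not_le]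
    exact (one_lt_inv₀ (zero_lt_iff.2 (by simpa using h0))).2 hlt
  refine ⟨⟨V, fun h => hinv (h ▸ ValuationSubring.mem_top _), constants_mem V⟩, ?_, ?_⟩
  · rw [Valuation.mem_valuationSubring_iff, ← RatFunc.algebraMap_X]
    exact v.valuation_le_one X
  · rw [ValuationSubring.mem_nonunits_iff_or]
    exact Or.inr hinv

theorem finitePlace_unique {π : (ZMod 2)[X]} (hπ : Irreducible π) {p p' : Place (ZMod 2) k2}
    (h : RatFunc.X ∈ p.1) (hp : polyToRat π ∈ p.1.nonunits)
    (h' : RatFunc.X ∈ p'.1) (hp' : polyToRat π ∈ p'.1.nonunits) : p = p' := by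
  have key : ∀ p : Place (ZMod 2) k2, RatFunc.X ∈ p.1 → polyToRat π ∈ p.1.nonunits →
      ∀ x : k2, x ∈ p.1 ↔ ∃ n s, ¬ π ∣ s ∧ x * polyToRat s = polyToRat n := by
    intro p hT hp x
    obtain ⟨ϖ, hϖ, h1, -, -, -, h2⟩ := finitePlace_exists_irreducible p hT
    have hass : Associated ϖ π := hϖ.associated_of_dvd hπ ((h1 π).1 hp)
    rw [h2]
    simp only [hass.dvd_iff_dvd_left]
  exact Subtype.ext (SetLike.ext fun x => by rw [key p h hp, key p' h' hp'])

theorem finitePlace_uniformizer {π : (ZMod 2)[X]} (hπ : Irreducible π) {p : Place (ZMod 2) k2}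
    (hT : RatFunc.X ∈ p.1) (hp : polyToRat π ∈ p.1.nonunits) :
    ordAt p.1 (polyToRat π) = 1 ∧ placeDegree (ZMod 2) p = π.natDegree := by
  obtain ⟨ϖ, hϖ, h1, h2, -, h3, -⟩ := finitePlace_exists_irreducible p hT
  obtain ⟨u, hu⟩ := hϖ.associated_of_dvd hπ ((h1 π).1 hp)
  have hu1 : (u : (ZMod 2)[X]) = 1 := by
    obtain ⟨c, hc, hcu⟩ := Polynomial.isUnit_iff.1 u.isUnit
    have : ∀ c : ZMod 2, IsUnit c → c = 1 := by decide
    rw [← hcu, this c hc, C_1]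
  rw [hu1, mul_one] at hu
  rw [← hu]
  exact ⟨h2, h3⟩

theorem ordAt_eq_zero_of_unit {K : Type*} [Field K] {O : ValuationSubring K}
    [IsDiscreteValuationRing O] {x : K} (h : x ∈ O) (h' : x ∉ O.nonunits) : ordAt O x = 0 := by
  have hx : x ≠ 0 := by
    rintro rfl
    exact h' (by rw [ValuationSubring.mem_nonunits_iff_or]; exact Or.inl rfl)
  have h1 := (ordAt_nonneg_iff (O := O) (f := x)).2 h
  have h2 := (mem_nonunits_iff_ordAt_pos (O := O) hx).not.1 h'
  omega

variable {K : Type*} [Field K] [Algebra (ZMod 2) K] [Algebra k2 K]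
variable [FiniteDimensional k2 K] [IsGalois k2 K]

omit [Algebra (ZMod 2) K] [IsGalois k2 K] in
theorem exists_poly_mul_integral (f : K) : ∃ d : (ZMod 2)[X], d ≠ 0 ∧
    ∀ V : ValuationSubring K, algebraMap k2 K RatFunc.X ∈ V → (∀ c : ZMod 2,
      algebraMap k2 K (algebraMap (ZMod 2) k2 c) ∈ V) →
      algebraMap k2 K (polyToRat d) * f ∈ V := by
  let := ((algebraMap k2 K).comp (algebraMap (ZMod 2)[X] k2)).toAlgebra
  have : IsScalarTower (ZMod 2)[X] k2 K := IsScalarTower.of_algebraMap_eq fun _ => rfl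
  have halg : IsAlgebraic (ZMod 2)[X] f :=
    (IsFractionRing.isAlgebraic_iff (ZMod 2)[X] k2 K).2 (Algebra.IsAlgebraic.isAlgebraic f)
  obtain ⟨d, hd, hdint⟩ := halg.exists_integral_multiple
  refine ⟨d, hd, fun V hX hc => ?_⟩
  rw [Algebra.smul_def] at hdint
  refine mem_of_isIntegral V (A := (ZMod 2)[X]) (fun g => ?_) hdint
  exact polyToRat_mem (V.comap (algebraMap k2 K)) hX hc g

omit [IsGalois k2 K] in
theorem polyToRat_mem_place {P : Place (ZMod 2) K} (hX : algebraMap k2 K RatFunc.X ∈ P.1)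
    (g : (ZMod 2)[X]) : algebraMap k2 K (polyToRat g) ∈ P.1 :=
  polyToRat_mem (placeBelow P).1 hX (constants_mem _) g

end FivePlaces

section FivePlaces

open IsLocalRing Polynomial

variable {K : Type*} [Field K] [Algebra (ZMod 2) K] [Algebra k2 K]
variable [FiniteDimensional k2 K] [IsGalois k2 K]

/-- `Q` is the only pole of `T`, and it has ramification index one over the infinite place. -/
structure IsInftyPlace (Q : Place (ZMod 2) K) : Prop where
  notMem : algebraMap k2 K RatFunc.X ∉ Q.1
  unique : ∀ P : Place (ZMod 2) K, algebraMap k2 K RatFunc.X ∉ P.1 → P = Q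
  ord : ∀ x : k2, x ≠ 0 → ordAt Q.1 (algebraMap k2 K x) = -x.intDegree

variable {Q : Place (ZMod 2) K} (hQ : IsInftyPlace Q)

include hQ

theorem IsInftyPlace.mem {P : Place (ZMod 2) K} (h : P ≠ Q) : algebraMap k2 K RatFunc.X ∈ P.1 :=
  not_not.1 fun h' => h (hQ.unique P h')

theorem IsInftyPlace.RRspace_neg : RRspace (ZMod 2) (-Finsupp.single Q 1) = ⊥ := by
  rw [eq_bot_iff]
  intro f hf
  rw [Submodule.mem_bot]
  by_contra hf0
  have hf := ((mem_RRspace _ f).1 hf).resolve_left hf0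
  have hall : ∀ P : Place (ZMod 2) K, f ∈ P.1 := by
    intro P
    rw [← ordAt_nonneg_iff]
    have := hf P
    by_cases h : Q = P
    · subst h; simp at this; omega
    · simpa [Finsupp.single_apply, h] using this
  have hQf : f ∈ Q.1.nonunits := by
    rw [mem_nonunits_iff_ordAt_pos hf0]
    have := hf Q
    simp at this
    omega
  let pl : (K ≃ₐ[k2] K) → Place (ZMod 2) K → Place (ZMod 2) K := fun σ P =>
    ⟨P.1.comap (σ : K →+* K), fun h => P.2.1 (by
      rw [eq_top_iff]
      intro x _
      have : σ.symm x ∈ P.1.comap (σ : K →+* K) := by rw [h]; exact ValuationSubring.mem_top _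
      simpa using this), constants_mem _⟩
  have hpl : ∀ σ P (x : K), x ∈ (pl σ P).1 ↔ σ x ∈ P.1 := fun σ P x => Iff.rfl
  have hplQ : ∀ σ, pl σ Q = Q := by
    intro σ
    apply hQ.unique
    rw [hpl, σ.commutes]
    exact hQ.notMem
  have hσ : ∀ σ : K ≃ₐ[k2] K, σ f ∈ Q.1.nonunits := by
    intro σ
    rw [ValuationSubring.mem_nonunits_iff_or, ← map_inv₀, ← hpl, hplQ, map_eq_zero,
      ← ValuationSubring.mem_nonunits_iff_or]
    exact hQf
  have hnorm := Algebra.norm_eq_prod_automorphisms k2 f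
  set N := Algebra.norm k2 f with hN
  have hN0 : N ≠ 0 := by
    rw [hN]; exact (Algebra.norm_ne_zero_iff).2 hf0
  have hNP : ∀ P : Place (ZMod 2) K, algebraMap k2 K N ∈ P.1 := by
    intro P
    rw [hnorm]
    exact P.1.toSubring.prod_mem fun σ _ => hall (pl σ P)
  have hNQ : algebraMap k2 K N ∈ Q.1.nonunits := by
    rw [hnorm, ← Finset.mul_prod_erase _ _ (Finset.mem_univ (1 : K ≃ₐ[k2] K))]
    have h1 : ∏ σ ∈ Finset.univ.erase (1 : K ≃ₐ[k2] K), σ f ∈ Q.1 :=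
      Q.1.toSubring.prod_mem fun σ _ => hall (pl σ Q)
    obtain ⟨ha, hb⟩ := ValuationSubring.mem_nonunits_iff_exists_mem_maximalIdeal.1 (hσ 1)
    rw [ValuationSubring.mem_nonunits_iff_exists_mem_maximalIdeal]
    exact ⟨Q.1.mul_mem _ _ ha h1, (maximalIdeal Q.1).mul_mem_right ⟨_, h1⟩ hb⟩
  rw [mem_nonunits_iff_ordAt_pos (by simpa using hN0), hQ.ord N hN0] at hNQ
  have hden : IsUnit N.denom := by
    by_contra hu
    obtain ⟨π, hπ, hd⟩ := WfDvdMonoid.exists_irreducible_factor hu N.denom_ne_zero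
    obtain ⟨p, hT, hp⟩ := exists_place_of_irreducible hπ
    obtain ⟨e, g, he, hg, hfin, hcard, -⟩ := galois_efr (K := K) p
    have : {P : Place (ZMod 2) K | LiesOver (ZMod 2) P p}.Nonempty := by
      rw [Set.nonempty_iff_ne_empty]
      intro h0
      rw [h0, Set.ncard_empty, zero_mul] at hcard
      exact Module.finrank_pos.ne hcard
    obtain ⟨P, hP⟩ := this
    have hP : LiesOver (ZMod 2) P p := hP
    have hNp : N ∈ p.1 := by rw [← hP]; exact hNP P
    have hdiv : ∀ g : (ZMod 2)[X], π ∣ g → polyToRat g ∈ p.1.nonunits := by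
      rintro g ⟨c, rfl⟩
      exact (polyToRat_mul_mem_nonunits p hT).2 (Or.inl hp)
    have hnum : polyToRat N.num ∈ p.1.nonunits := by
      have h1 : polyToRat N.num = N * polyToRat N.denom := by
        have h2 : polyToRat N.denom ≠ 0 := by simpa [polyToRat] using N.denom_ne_zero
        exact (div_eq_iff h2).1 (RatFunc.num_div_denom N)
      rw [h1]
      obtain ⟨ha, hb⟩ := ValuationSubring.mem_nonunits_iff_exists_mem_maximalIdeal.1 (hdiv _ hd)
      rw [ValuationSubring.mem_nonunits_iff_exists_mem_maximalIdeal]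
      exact ⟨p.1.mul_mem _ _ hNp ha, (maximalIdeal p.1).mul_mem_left ⟨_, hNp⟩ hb⟩
    have hcop := N.isCoprime_num_denom
    obtain ⟨a, b, hab⟩ := hcop
    obtain ⟨ϖ, hϖ, h1, -⟩ := finitePlace_exists_irreducible p hT
    have h2 := dvd_add ((h1 _).1 hnum |>.mul_left a) ((h1 _).1 (hdiv _ hd) |>.mul_left b)
    rw [hab] at h2
    exact hϖ.not_isUnit (isUnit_of_dvd_one h2)
  have hdeg := natDegree_eq_zero_of_isUnit hden
  rw [RatFunc.intDegree] at hNQ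
  omega

theorem IsInftyPlace.finite (D : Divisor (ZMod 2) K) : Finite (RRspace (ZMod 2) D) := by
  have h1 : Finite (RRspace (ZMod 2) (-Finsupp.single Q 1)) := by
    rw [hQ.RRspace_neg]; infer_instance
  have h2 : Finite (RRspace (ZMod 2) (D ⊓ -Finsupp.single Q 1)) :=
    Finite.of_injective _ (Submodule.inclusion_injective (RRspace_mono inf_le_right))
  exact finite_RRspace_of_le inf_le_left h2

theorem IsInftyPlace.ord_X_pow (n : ℕ) : ordAt Q.1 (algebraMap k2 K RatFunc.X ^ n) = -n := by
  have hX : (RatFunc.X : k2) ≠ 0 := RatFunc.X_ne_zero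
  rw [ordAt_pow (by simpa using hX), hQ.ord _ hX, RatFunc.intDegree_X]
  ring

/-- A lower bound for the Riemann-Roch spaces of multiples of the infinite place. -/
theorem IsInftyPlace.ell_single_ge {w : Fin 4 → K}
    (hlin : ∀ (a : k2) (b : Fin 4 → k2),
      algebraMap k2 K a + ∑ i, algebraMap k2 K (b i) * w i = 0 → a = 0 ∧ ∀ i, b i = 0)
    (hfin : ∀ i (P : Place (ZMod 2) K), algebraMap k2 K RatFunc.X ∈ P.1 → w i ∈ P.1)
    (hinf : ∀ i, (algebraMap k2 K RatFunc.X ^ 2)⁻¹ * w i ∈ Q.1) (n : ℕ) :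
    5 * n + 7 ≤ ell (ZMod 2) (Finsupp.single Q ((n : ℤ) + 2)) := by
  have hX : (algebraMap k2 K RatFunc.X : K) ≠ 0 := by simpa using RatFunc.X_ne_zero
  have hpoly : ∀ m : ℕ, ∀ a : degreeLT (ZMod 2) (m + 1),
      (algebraMap k2 K RatFunc.X ^ m)⁻¹ * algebraMap k2 K (polyToRat a) ∈ Q.1 := by
    intro m a
    by_cases ha : (a : (ZMod 2)[X]) = 0
    · rw [ha]; simp [polyToRat]
    have ha' : polyToRat (a : (ZMod 2)[X]) ≠ 0 := by simpa [polyToRat] using ha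
    rw [← ordAt_nonneg_iff, ordAt_mul (inv_ne_zero (pow_ne_zero _ hX)) (by simpa using ha'),
      ordAt_inv (pow_ne_zero _ hX), hQ.ord_X_pow, hQ.ord _ ha', RatFunc.intDegree_polynomial]
    have := mem_degreeLT.1 a.2
    rw [degree_eq_natDegree ha] at this
    have : (a : (ZMod 2)[X]).natDegree < m + 1 := by exact_mod_cast this
    omega
  let ψ : degreeLT (ZMod 2) (n + 2 + 1) × (Fin 4 → degreeLT (ZMod 2) (n + 1)) → K := fun x =>
    algebraMap k2 K (polyToRat x.1) + ∑ i, algebraMap k2 K (polyToRat (x.2 i)) * w i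
  have hmem : ∀ x, ψ x ∈ RRspace (ZMod 2) (Finsupp.single Q ((n : ℤ) + 2)) := by
    intro x
    rw [mem_RRspace]
    by_cases h0 : ψ x = 0
    · exact Or.inl h0
    refine Or.inr fun P => ?_
    by_cases hP : P = Q
    · subst hP
      have : (algebraMap k2 K RatFunc.X ^ (n + 2))⁻¹ * ψ x ∈ P.1 := by
        rw [mul_add, Finset.mul_sum]
        refine P.1.add_mem _ _ (hpoly _ _) (P.1.toSubring.sum_mem fun i _ => ?_)
        have h1 := P.1.mul_mem _ _ (hpoly _ (x.2 i)) (hinf i)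
        change _ ∈ P.1
        convert h1 using 1
        rw [pow_add, mul_inv]
        ring
      rw [← ordAt_nonneg_iff, ordAt_mul (inv_ne_zero (pow_ne_zero _ hX)) h0,
        ordAt_inv (pow_ne_zero _ hX), hQ.ord_X_pow] at this
      rw [Finsupp.single_eq_same]
      push_cast at this
      omega
    · rw [Finsupp.single_eq_of_ne hP, neg_zero, ordAt_nonneg_iff]
      have hXP := hQ.mem hP
      exact P.1.add_mem _ _ (polyToRat_mem_place hXP _) (P.1.toSubring.sum_mem fun i _ =>
        P.1.mul_mem _ _ (polyToRat_mem_place hXP _) (hfin i P hXP))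
  have hinj : Function.Injective fun x => (⟨ψ x, hmem x⟩ :
      RRspace (ZMod 2) (Finsupp.single Q ((n : ℤ) + 2))) := by
    intro x y h
    have h' : ψ x = ψ y := congrArg
      (fun x : RRspace (ZMod 2) (Finsupp.single Q ((n : ℤ) + 2)) => (x : K)) h
    have hinjp : ∀ a b : (ZMod 2)[X], polyToRat a - polyToRat b = 0 → a = b := by
      intro a b hab
      exact IsFractionRing.injective (ZMod 2)[X] k2 (sub_eq_zero.1 hab)
    obtain ⟨h1, h2⟩ := hlin (polyToRat x.1 - polyToRat y.1)
      (fun i => polyToRat (x.2 i) - polyToRat (y.2 i)) (by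
        simp only [map_sub, sub_mul, Finset.sum_sub_distrib]
        linear_combination h')
    exact Prod.ext (Subtype.ext (hinjp _ _ h1)) (funext fun i => Subtype.ext (hinjp _ _ (h2 i)))
  have := hQ.finite (Finsupp.single Q ((n : ℤ) + 2))
  have hle := Nat.card_le_card_of_injective _ hinj
  have hc : ∀ m, Nat.card (degreeLT (ZMod 2) m) = 2 ^ m := by
    intro m
    rw [Nat.card_congr (degreeLTEquiv (ZMod 2) m).toEquiv]
    simp
  rw [card_RRspace, Nat.card_prod, Nat.card_fun, hc, hc, Nat.card_fin, ← pow_mul, ← pow_add] at hle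
  have := (Nat.pow_le_pow_iff_right (by norm_num)).1 hle
  omega

end FivePlaces

section FivePlaces

open IsLocalRing Polynomial

variable {K : Type*} [Field K] [Algebra (ZMod 2) K] [Algebra k2 K]
variable [FiniteDimensional k2 K] [IsGalois k2 K]

variable {Q : Place (ZMod 2) K} (hQ : IsInftyPlace Q)

theorem ordAt_finite_of_lies {π : (ZMod 2)[X]} (hπ : Irreducible π) {p : Place (ZMod 2) k2}
    (hT : RatFunc.X ∈ p.1) (hp : polyToRat π ∈ p.1.nonunits) {P : Place (ZMod 2) K}
    (hP : algebraMap k2 K RatFunc.X ∈ P.1) (h : ¬ LiesOver (ZMod 2) P p) :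
    ordAt P.1 (algebraMap k2 K (polyToRat π)) = 0 := by
  refine ordAt_eq_zero_of_unit (polyToRat_mem_place hP π) fun h1 => h ?_
  rw [nonunits_comap (placeBelow P) (liesOver_placeBelow P)] at h1
  rw [← finitePlace_unique hπ (p := placeBelow P) hP h1 hT hp]
  exact liesOver_placeBelow P

omit [IsGalois k2 K] in
theorem polyToRat_map_ne_zero {d : (ZMod 2)[X]} (hd : d ≠ 0) :
    algebraMap k2 K (polyToRat d) ≠ 0 := by
  have : polyToRat d ≠ 0 := by simpa [polyToRat] using hd
  simpa using this

include hQ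

/-- The divisor of a polynomial exists and has degree zero. -/
theorem IsInftyPlace.divisor_poly (hQd : placeDegree (ZMod 2) Q = 5)
    (hK : Module.finrank k2 K = 5) (d : (ZMod 2)[X]) (hd : d ≠ 0) :
    ∃ Z : Divisor (ZMod 2) K, (∀ P : Place (ZMod 2) K,
      Z P = ordAt P.1 (algebraMap k2 K (polyToRat d))) ∧ degHom (ZMod 2) K Z = 0 := by
  induction d using WfDvdMonoid.induction_on_irreducible with
  | zero => exact absurd rfl hd
  | unit u hu =>
    obtain ⟨c, hc, hcu⟩ := Polynomial.isUnit_iff.1 hu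
    have : ∀ c : ZMod 2, IsUnit c → c = 1 := by decide
    refine ⟨0, fun P => ?_, map_zero _⟩
    rw [← hcu, this c hc, C_1, polyToRat, map_one, map_one, ordAt_one]
    rfl
  | mul a π ha hπ ih =>
    obtain ⟨Z, hZ, hZ0⟩ := ih ha
    obtain ⟨p, hT, hp⟩ := exists_place_of_irreducible hπ
    obtain ⟨h1, h2⟩ := finitePlace_uniformizer hπ hT hp
    obtain ⟨e, f, he, hf, hfin, hcard, hP⟩ := galois_efr (K := K) p
    have hπ0 : polyToRat π ≠ 0 := by simpa [polyToRat] using hπ.ne_zero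
    have hQp : ¬ LiesOver (ZMod 2) Q p := by
      intro h
      have h' : RatFunc.X ∈ Q.1.comap (algebraMap k2 K) := by rw [h]; exact hT
      exact hQ.notMem h'
    refine ⟨Z + (∑ P ∈ hfin.toFinset, Finsupp.single P (e : ℤ) -
      Finsupp.single Q (π.natDegree : ℤ)), fun P => ?_, ?_⟩
    · rw [show polyToRat (π * a) = polyToRat a * polyToRat π by
        rw [polyToRat, map_mul, mul_comm], map_mul, ordAt_mul (polyToRat_map_ne_zero ha)
        (polyToRat_map_ne_zero hπ.ne_zero), Finsupp.add_apply, hZ, Finsupp.sub_apply,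
        Finsupp.finsetSum_apply]
      congr 1
      simp only [Finsupp.single_apply, Finset.sum_ite_eq', Set.Finite.mem_toFinset,
        Set.mem_ofPred_eq]
      by_cases hPQ : Q = P
      · subst hPQ
        rw [if_neg hQp, if_pos rfl, hQ.ord _ hπ0, RatFunc.intDegree_polynomial]
        ring
      · rw [if_neg hPQ, sub_zero]
        split_ifs with h
        · rw [(hP P h).2.2 _ hπ0, h1, mul_one]
        · exact (ordAt_finite_of_lies hπ hT hp (hQ.mem (Ne.symm hPQ)) h).symm
    · rw [map_add, hZ0, map_sub, map_sum, degHom_single, hQd, zero_add,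
        Finset.sum_congr rfl (g := fun _ => ((e * f * π.natDegree : ℕ) : ℤ)) (fun P hPm => by
          rw [degHom_single, (hP P (by simpa using hPm)).2.1, h2]; push_cast; ring)]
      rw [Finset.sum_const, ← Set.ncard_eq_toFinset_card _ hfin, nsmul_eq_mul]
      have : ({P : Place (ZMod 2) K | LiesOver (ZMod 2) P p}.ncard : ℤ) * (e * f) = 5 := by
        rw [hK] at hcard; exact_mod_cast hcard
      push_cast
      linear_combination (π.natDegree : ℤ) * this

theorem IsInftyPlace.exists_poly_bound (D : Divisor (ZMod 2) K) : ∃ d : (ZMod 2)[X], d ≠ 0 ∧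
    ∀ P, P ≠ Q → D P ≤ ordAt P.1 (algebraMap k2 K (polyToRat d)) := by
  have hnn : ∀ d : (ZMod 2)[X], ∀ P, P ≠ Q → 0 ≤ ordAt P.1 (algebraMap k2 K (polyToRat d)) :=
    fun d P hP => ordAt_nonneg_iff.2 (polyToRat_mem_place (hQ.mem hP) d)
  induction D using Finsupp.induction_linear with
  | zero => exact ⟨1, one_ne_zero, fun P hP => hnn 1 P hP⟩
  | add D₁ D₂ h₁ h₂ =>
    obtain ⟨d, hd, h⟩ := h₁
    obtain ⟨d', hd', h'⟩ := h₂
    refine ⟨d * d', mul_ne_zero hd hd', fun P hP => ?_⟩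
    rw [polyToRat, map_mul, map_mul, ordAt_mul (polyToRat_map_ne_zero hd)
      (polyToRat_map_ne_zero hd')]
    exact add_le_add (h P hP) (h' P hP)
  | single P n =>
    by_cases hP : P = Q
    · refine ⟨1, one_ne_zero, fun P' hP' => ?_⟩
      rw [Finsupp.single_eq_of_ne (by rw [hP]; exact hP')]
      exact hnn 1 P' hP'
    · obtain ⟨π, hπ, h1, -⟩ := finitePlace_exists_irreducible (placeBelow P) (hQ.mem hP)
      refine ⟨π ^ n.natAbs, pow_ne_zero _ hπ.ne_zero, fun P' hP' => ?_⟩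
      by_cases h : P' = P
      · subst h
        have hpos : 0 < ordAt P'.1 (algebraMap k2 K (polyToRat π)) := by
          rw [← mem_nonunits_iff_ordAt_pos (polyToRat_map_ne_zero hπ.ne_zero),
            nonunits_comap (placeBelow P') (liesOver_placeBelow P')]
          exact (h1 π).2 dvd_rfl
        rw [Finsupp.single_eq_same, polyToRat, map_pow, map_pow,
          ordAt_pow (polyToRat_map_ne_zero hπ.ne_zero)]
        have h2 : n ≤ n.natAbs := Int.le_natAbs
        nlinarith [Int.natCast_nonneg n.natAbs]
      · rw [Finsupp.single_eq_of_ne h]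
        exact hnn _ P' hP'

/-- Riemann's inequality. -/
theorem IsInftyPlace.deg_sub_ell_le (hQd : placeDegree (ZMod 2) Q = 5)
    (hK : Module.finrank k2 K = 5)
    (hell : ∀ n : ℕ, 5 * n + 7 ≤ ell (ZMod 2) (Finsupp.single Q ((n : ℤ) + 2)))
    (D : Divisor (ZMod 2) K) : degHom (ZMod 2) K D - ell (ZMod 2) D ≤ 3 := by
  obtain ⟨d, hd, hD⟩ := hQ.exists_poly_bound D
  obtain ⟨Z, hZ, hZ0⟩ := hQ.divisor_poly hQd hK d hd
  have h1 := ell_sub_principal D Z (polyToRat_map_ne_zero hd) hZ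
  obtain ⟨m, hm⟩ : ∃ m : ℕ, (D - Z) Q ≤ m := ⟨_, Int.self_le_toNat _⟩
  have h2 : D - Z ≤ Finsupp.single Q ((m : ℤ) + 2) := by
    intro P
    by_cases hP : P = Q
    · subst hP
      rw [Finsupp.single_eq_same]
      omega
    · rw [Finsupp.single_eq_of_ne hP, Finsupp.sub_apply, hZ]
      have := hD P hP
      omega
  have h3 := deg_sub_ell_mono h2 (hQ.finite _)
  have h4 := hell m
  rw [map_sub, hZ0, h1, degHom_single, hQd] at h3
  push_cast at h3
  omega

theorem IsInftyPlace.exists_divisor (hQd : placeDegree (ZMod 2) Q = 5)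
    (hK : Module.finrank k2 K = 5) {f : K} (hf : f ≠ 0) :
    ∃ Z : Divisor (ZMod 2) K, ∀ P : Place (ZMod 2) K, Z P = ordAt P.1 f := by
  have key : ∀ f : K, f ≠ 0 → ∃ Z : Divisor (ZMod 2) K, ∀ P, P ≠ Q → -ordAt P.1 f ≤ Z P := by
    intro f hf
    obtain ⟨d, hd, h⟩ := exists_poly_mul_integral f
    obtain ⟨Z, hZ, -⟩ := hQ.divisor_poly hQd hK d hd
    refine ⟨Z, fun P hP => ?_⟩
    have h1 := h P.1 (hQ.mem hP) fun c => constants_mem (placeBelow P).1 c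
    rw [← ordAt_nonneg_iff, ordAt_mul (polyToRat_map_ne_zero hd) hf, ← hZ] at h1
    omega
  obtain ⟨Z, hZ⟩ := key f hf
  obtain ⟨Z', hZ'⟩ := key f⁻¹ (inv_ne_zero hf)
  have hfin : (Function.support fun P : Place (ZMod 2) K => ordAt P.1 f).Finite := by
    refine (insert Q (Z.support ∪ Z'.support)).finite_toSet.subset fun P hP => ?_
    rw [Function.mem_support] at hP
    by_contra h
    simp only [Finset.coe_insert, Finset.coe_union, Set.mem_insert_iff, Set.mem_union,
      Finset.mem_coe, Finsupp.mem_support_iff, not_or, not_not] at h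
    have h1 := hZ P h.1
    have h2 := hZ' P h.1
    rw [ordAt_inv hf] at h2
    omega
  exact ⟨Finsupp.ofSupportFinite _ hfin, fun P => rfl⟩

omit hQ in
theorem deg_principal
    (hdeg : ∀ D : Divisor (ZMod 2) K, degHom (ZMod 2) K D - ell (ZMod 2) D ≤ 3)
    {f : K} (hf : f ≠ 0) {Z : Divisor (ZMod 2) K} (hZ : ∀ P : Place (ZMod 2) K, Z P = ordAt P.1 f) :
    degHom (ZMod 2) K Z = 0 := by
  have key : ∀ {f : K} (hf : f ≠ 0) {Z : Divisor (ZMod 2) K},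
      (∀ P : Place (ZMod 2) K, Z P = ordAt P.1 f) → degHom (ZMod 2) K Z ≤ 0 := by
    intro f hf Z hZ
    by_contra! hpos
    set n : ℕ := 4 + ell (ZMod 2) (0 : Divisor (ZMod 2) K) with hn
    have h1 := hdeg (n • Z)
    have h2 := ell_sub_principal (n • Z) (n • Z) (pow_ne_zero n hf) fun P => by
      rw [ordAt_pow hf, Finsupp.smul_apply, hZ, nsmul_eq_mul]
    rw [sub_self] at h2
    rw [map_nsmul, nsmul_eq_mul, ← h2] at h1
    have : (n : ℤ) * 1 ≤ n * degHom (ZMod 2) K Z :=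
      mul_le_mul_of_nonneg_left (by omega) (by omega)
    omega
  refine le_antisymm (key hf hZ) ?_
  have := key (inv_ne_zero hf) (Z := -Z) fun P => by
    rw [ordAt_inv hf, Finsupp.neg_apply, hZ]
  rw [map_neg] at this
  omega

end FivePlaces

section ClassNumber

variable {K : Type*} [Field K] [Algebra (ZMod 2) K] [Algebra k2 K]
variable [FiniteDimensional k2 K] [IsGalois k2 K]

theorem degHom_nonneg {E : Divisor (ZMod 2) K} (hE : ∀ P, 0 ≤ E P) :
    0 ≤ degHom (ZMod 2) K E := by
  rw [degHom, Finsupp.liftAddHom_apply]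
  exact Finset.sum_nonneg fun P _ => mul_nonneg (hE P) (by positivity)

theorem eq_single_of_effective {Pm : Place (ZMod 2) K}
    (hPm : ∀ P : Place (ZMod 2) K, placeDegree (ZMod 2) P ≤ 4 → P = Pm)
    {E : Divisor (ZMod 2) K} (hE : ∀ P, 0 ≤ E P) (hdeg : degHom (ZMod 2) K E ≤ 4) :
    E = Finsupp.single Pm (E Pm) := by
  ext P
  by_cases h : P = Pm
  · rw [h, Finsupp.single_eq_same]
  rw [Finsupp.single_eq_of_ne h]
  by_contra h0
  have hP : 5 ≤ placeDegree (ZMod 2) P := by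
    by_contra! h'
    exact h (hPm P (by omega))
  have h1 := degHom_nonneg (E := E - Finsupp.single P 1) fun R => by
    have h2 := hE R
    have h3 := hE P
    by_cases hR : R = P
    · subst hR
      rw [Finsupp.sub_apply, Finsupp.single_eq_same]
      omega
    · rw [Finsupp.sub_apply, Finsupp.single_eq_of_ne hR]
      omega
  rw [map_sub, degHom_single] at h1
  omega

theorem exists_ne_zero_of_ell_pos {D : Divisor (ZMod 2) K} (h : ell (ZMod 2) D ≠ 0) :
    ∃ f : K, f ≠ 0 ∧ ∀ P : Place (ZMod 2) K, 0 ≤ D P + ordAt P.1 f := by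
  have hne : RRspace (ZMod 2) D ≠ ⊥ := by
    intro h0
    apply h
    rw [ell, h0, finrank_bot]
  obtain ⟨f, hf, hf0⟩ := Submodule.exists_mem_ne_zero_of_ne_bot hne
  refine ⟨f, hf0, fun P => ?_⟩
  have := ((mem_RRspace D f).1 hf).resolve_left hf0 P
  omega

/-- A quintic extension in which the only place of degree at most four has degree four, and in
which Riemann's inequality holds with constant four, has genus four and class number one. -/
theorem genus_classNumber {Pm : Place (ZMod 2) K} (hPd : placeDegree (ZMod 2) Pm = 4)
    (hPm : ∀ P : Place (ZMod 2) K, placeDegree (ZMod 2) P ≤ 4 → P = Pm)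
    {Q : Place (ZMod 2) K} (hQ : placeDegree (ZMod 2) Q = 5)
    (hdeg : ∀ D : Divisor (ZMod 2) K, degHom (ZMod 2) K D - ell (ZMod 2) D ≤ 3)
    (hdiv : ∀ f : K, f ≠ 0 → ∃ Z : Divisor (ZMod 2) K,
      (∀ P : Place (ZMod 2) K, Z P = ordAt P.1 f) ∧ degHom (ZMod 2) K Z = 0) :
    genus (ZMod 2) K = 4 ∧ classNumber (ZMod 2) K = 1 := by
  constructor
  · refine IsGreatest.csSup_eq ⟨⟨Finsupp.single Pm 2 - Finsupp.single Q 1, ?_⟩, ?_⟩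
    · have h0 : ell (ZMod 2) (Finsupp.single Pm 2 - Finsupp.single Q 1) = 0 := by
        by_contra h
        obtain ⟨f, hf, hE⟩ := exists_ne_zero_of_ell_pos h
        obtain ⟨Z, hZ, hZ0⟩ := hdiv f hf
        have hd : degHom (ZMod 2) K (Finsupp.single Pm 2 - Finsupp.single Q 1 + Z) = 3 := by
          rw [map_add, map_sub, degHom_single, degHom_single, hPd, hQ, hZ0]; norm_num
        have h1 := eq_single_of_effective hPm (E := Finsupp.single Pm 2 - Finsupp.single Q 1 + Z)
          (fun P => by rw [Finsupp.add_apply, hZ]; exact hE P) (by rw [hd]; norm_num)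
        rw [h1, degHom_single, hPd] at hd
        omega
      rw [h0, map_sub, degHom_single, degHom_single, hPd, hQ]
      norm_num
    · rintro g ⟨D, hg⟩
      have := hdeg D
      omega
  · have htop : (principalDivisors (ZMod 2) K).addSubgroupOf (zeroDivisors (ZMod 2) K) = ⊤ := by
      rw [AddSubgroup.addSubgroupOf_eq_top]
      intro D hD
      have hD0 : degHom (ZMod 2) K D = 0 := hD
      have h1 := hdeg (D + Finsupp.single Pm 1)
      have hd1 : degHom (ZMod 2) K (D + Finsupp.single Pm 1) = 4 := by
        rw [map_add, degHom_single, hD0, hPd]; norm_num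
      obtain ⟨f, hf, hE⟩ := exists_ne_zero_of_ell_pos (D := D + Finsupp.single Pm 1) (by omega)
      obtain ⟨Z, hZ, hZ0⟩ := hdiv f hf
      obtain ⟨E, hED⟩ : ∃ E : Divisor (ZMod 2) K, E = D + Finsupp.single Pm 1 + Z := ⟨_, rfl⟩
      have hd : degHom (ZMod 2) K E = 4 := by
        rw [hED, map_add, hd1, hZ0]; norm_num
      have h2 := eq_single_of_effective hPm (E := E)
        (fun P => by rw [hED, Finsupp.add_apply, hZ]; exact hE P) hd.le
      have h3 : E Pm = 1 := by
        rw [h2, degHom_single, hPd] at hd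
        omega
      rw [h3, hED] at h2
      refine AddSubgroup.subset_closure ⟨f⁻¹, inv_ne_zero hf, fun P => ?_⟩
      have h4 := DFunLike.congr_fun h2 P
      rw [Finsupp.add_apply, Finsupp.add_apply, hZ] at h4
      rw [ordAt_inv hf]
      omega
    have hsub : Subsingleton (ClassGroup0 (ZMod 2) K) := by
      unfold ClassGroup0
      rw [htop]
      exact QuotientAddGroup.subsingleton_quotient_top
    exact Nat.card_eq_one_iff_unique.2 ⟨hsub, ⟨0⟩⟩

end ClassNumber

section Quintic

open IsLocalRing Polynomial

variable {K : Type*} [Field K] [Algebra (ZMod 2) K] [Algebra k2 K]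

theorem sum_zmod_five {R : Type*} [AddCommMonoid R] (f : ZMod 5 → R) :
    ∑ i, f i = f 0 + f 1 + f 2 + f 3 + f 4 := Fin.sum_univ_five f

omit [Algebra (ZMod 2) K] in
theorem linearIndependent_of_gram {w : ZMod 5 → K} {σ : K ≃ₐ[k2] K}
    (hσ : ∀ i, σ (w i) = w (i + 1)) (hsum : ∑ i, w i = 0) (hS2 : ∑ i, w i * w (i + 2) = 0)
    (hS1 : ∑ i, w i * w (i + 1) ≠ 0) (h2 : (2 : K) = 0) (a : k2) (b : Fin 4 → k2)
    (h : algebraMap k2 K a + ∑ i, algebraMap k2 K (b i) * w ((Fin.succ i : Fin 5) : ZMod 5) = 0) :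
    a = 0 ∧ ∀ i, b i = 0 := by
  rw [sum_zmod_five] at hsum hS1 hS2
  change w 0 * w 1 + w 1 * w 2 + w 2 * w 3 + w 3 * w 4 + w 4 * w 0 ≠ 0 at hS1
  change w 0 * w 2 + w 1 * w 3 + w 2 * w 4 + w 3 * w 0 + w 4 * w 1 = 0 at hS2
  rw [Fin.sum_univ_four] at h
  change algebraMap k2 K a + (algebraMap k2 K (b 0) * w 1 + algebraMap k2 K (b 1) * w 2 +
    algebraMap k2 K (b 2) * w 3 + algebraMap k2 K (b 3) * w 4) = 0 at h
  have h01 : σ (w 0) = w 1 := hσ 0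
  have h12 : σ (w 1) = w 2 := hσ 1
  have h23 : σ (w 2) = w 3 := hσ 2
  have h34 : σ (w 3) = w 4 := hσ 3
  have h40 : σ (w 4) = w 0 := hσ 4
  have e1 := congrArg σ h
  simp only [map_add, map_mul, map_zero, σ.commutes, h12, h23, h34, h40] at e1
  have e2 := congrArg σ e1
  simp only [map_add, map_mul, map_zero, σ.commutes, h01, h23, h34, h40] at e2
  have e3 := congrArg σ e2
  simp only [map_add, map_mul, map_zero, σ.commutes, h01, h12, h34, h40] at e3
  have e4 := congrArg σ e3
  simp only [map_add, map_mul, map_zero, σ.commutes, h01, h12, h23, h40] at e4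
  have hG : w 0 ^ 2 + w 1 ^ 2 + w 2 ^ 2 + w 3 ^ 2 + w 4 ^ 2 = 0 := by
    linear_combination (w 0 + w 1 + w 2 + w 3 + w 4) * hsum -
      (w 0 * w 1 + w 0 * w 2 + w 0 * w 3 + w 0 * w 4 + w 1 * w 2 + w 1 * w 3 + w 1 * w 4 +
        w 2 * w 3 + w 2 * w 4 + w 3 * w 4) * h2
  generalize hA : algebraMap k2 K a = A at *
  generalize hB0 : algebraMap k2 K (b 0) = B₀ at *
  generalize hB1 : algebraMap k2 K (b 1) = B₁ at *
  generalize hB2 : algebraMap k2 K (b 2) = B₂ at *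
  generalize hB3 : algebraMap k2 K (b 3) = B₃ at *
  have z1 : B₁ = 0 := by
    refine (mul_eq_zero.1 ?_).resolve_left hS1
    linear_combination w 1 * h + w 2 * e1 + w 3 * e2 + w 4 * e3 + w 0 * e4 - A * hsum - B₀ * hG -
      (B₂ + B₃) * hS2
  have z3 : B₃ = 0 := by
    refine (mul_eq_zero.1 ?_).resolve_left hS1
    linear_combination w 3 * h + w 4 * e1 + w 0 * e2 + w 1 * e3 + w 2 * e4 - A * hsum - B₂ * hG -
      B₀ * hS2 - (w 0 * w 1 + w 1 * w 2 + w 2 * w 3 + w 3 * w 4 + w 4 * w 0) * z1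
  have z2 : B₂ = 0 := by
    refine (mul_eq_zero.1 ?_).resolve_left hS1
    linear_combination w 4 * h + w 0 * e1 + w 1 * e2 + w 2 * e3 + w 3 * e4 - A * hsum - B₃ * hG -
      (B₀ + B₁) * hS2
  have z0 : B₀ = 0 := by
    refine (mul_eq_zero.1 ?_).resolve_left hS1
    linear_combination w 0 * h + w 1 * e1 + w 2 * e2 + w 3 * e3 + w 4 * e4 - A * hsum -
      (w 0 * w 1 + w 1 * w 2 + w 2 * w 3 + w 3 * w 4 + w 4 * w 0) * z3 - (B₁ + B₂) * hS2
  rw [z0, z1, z2, z3] at h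
  have zA : A = 0 := by linear_combination h
  have inj : ∀ x : k2, algebraMap k2 K x = 0 → x = 0 := fun x hx => by simpa using hx
  refine ⟨inj _ (hA.trans zA), fun i => ?_⟩
  fin_cases i
  exacts [inj _ (hB0.trans z0), inj _ (hB1.trans z1), inj _ (hB2.trans z2), inj _ (hB3.trans z3)]

variable [FiniteDimensional k2 K] [IsGalois k2 K]

omit [Algebra (ZMod 2) K] [Algebra k2 K] [FiniteDimensional k2 K] [IsGalois k2 K] in
theorem ordAt_zero (O : ValuationSubring K) : ordAt O 0 = 0 := by
  have h : {n : ℕ | (⟨0, O.zero_mem⟩ : O) ∈ maximalIdeal O ^ n} = Set.univ :=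
    Set.eq_univ_of_forall fun n => (maximalIdeal O ^ n).zero_mem
  rw [ordAt, dif_pos O.zero_mem, ordAux, h, Nat.sSup_of_not_bddAbove not_bddAbove_univ]
  rfl

/-- If all conjugates have the same residue, then the quadratic invariant vanishes there. -/
theorem gram_mem_nonunits {P : Place (ZMod 2) K} {z : ZMod 5 → K} {c : K}
    (hz : ∀ i, z i ∈ P.1) (hc : c ∈ P.1) (hzc : ∀ i, z i - c ∈ P.1.nonunits)
    (hsum : ∑ i, z i = 0) : ∑ i, z i * z (i + 1) ∈ P.1.nonunits := by
  have h2K : (2 : K) = 0 := by linear_combination -char_two_neg (1 : K)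
  have h2 : (2 : ResidueField P.1) = 0 := by
    have : (2 : P.1) = 0 := Subtype.ext h2K
    rw [← map_ofNat (residue P.1) 2, this, map_zero]
  let Z : ZMod 5 → P.1 := fun i => ⟨z i, hz i⟩
  have hZ : ∀ i, residue P.1 (Z i) = residue P.1 ⟨c, hc⟩ := by
    intro i
    rw [← sub_eq_zero, ← map_sub, residue_eq_zero_iff, ← ValuationSubring.coe_mem_nonunits_iff]
    exact hzc i
  have hZs : ∑ i, Z i = 0 := by
    apply Subtype.ext
    exact (map_sum P.1.subtype Z Finset.univ).trans hsum
  have hC : residue P.1 ⟨c, hc⟩ = 0 := by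
    have := congrArg (residue P.1) hZs
    rw [map_sum, Finset.sum_congr rfl fun i _ => hZ i, Finset.sum_const, Finset.card_univ, ZMod.card,
      map_zero, nsmul_eq_mul] at this
    push_cast at this
    linear_combination this - 2 * residue P.1 ⟨c, hc⟩ * h2
  have key : ∑ i, Z i * Z (i + 1) ∈ maximalIdeal P.1 := by
    rw [← residue_eq_zero_iff, map_sum]
    refine Finset.sum_eq_zero fun i _ => ?_
    rw [map_mul, hZ, hC, zero_mul]
  rw [← ValuationSubring.coe_mem_nonunits_iff] at key
  convert key using 1
  exact (map_sum P.1.subtype (fun i => Z i * Z (i + 1)) Finset.univ).symm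

/-- A place whose Frobenius rotates the residues of the `z i` is inert. -/
theorem inert_of_frobenius (hK : Module.finrank k2 K = 5) {p : Place (ZMod 2) k2}
    {P : Place (ZMod 2) K} (hP : LiesOver (ZMod 2) P p) {z : ZMod 5 → K} (hz : ∀ i, z i ∈ P.1)
    (hsum : ∑ i, z i = 0) (hS : ∑ i, z i * z (i + 1) ∉ P.1.nonunits) {k : ZMod 5} (hk : k ≠ 0)
    (hfrob : ∀ i, z i ^ 2 ^ placeDegree (ZMod 2) p - z (i + k) ∈ P.1.nonunits) :
    IsInert (ZMod 2) K p ∧ IsUnramifiedAt (ZMod 2) K p := by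
  obtain ⟨e, f, he, hf, hfin, hcard, hall⟩ := galois_efr (K := K) p
  obtain ⟨hfinP, hdeg, -⟩ := hall P hP
  have hf5 : f = 5 := by
    have hdvd : f ∣ 5 := by rw [← hK, ← hcard, ← mul_assoc]; exact dvd_mul_left _ _
    rcases (Nat.dvd_prime (by norm_num : Nat.Prime 5)).1 hdvd with rfl | h
    · exfalso
      rw [one_mul] at hdeg
      have hstep : ∀ i, z (i + k) - z i ∈ P.1.nonunits := by
        intro i
        have h1 := hfrob i
        rw [← hdeg] at h1
        have h2 := residue_pow_two_pow P (residue P.1 ⟨z i, hz i⟩)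
        have h3 : residue P.1 (⟨z i, hz i⟩ ^ 2 ^ placeDegree (ZMod 2) P - ⟨z (i + k), hz _⟩) = 0 := by
          rw [residue_eq_zero_iff, ← ValuationSubring.coe_mem_nonunits_iff]
          exact h1
        rw [map_sub, map_pow, h2, sub_eq_zero] at h3
        have h4 : residue P.1 (⟨z (i + k), hz _⟩ - ⟨z i, hz i⟩) = 0 := by
          rw [map_sub, h3, sub_self]
        rw [residue_eq_zero_iff, ← ValuationSubring.coe_mem_nonunits_iff] at h4
        exact h4
      have hres : ∀ n : ℕ, residue P.1 ⟨z (n • k), hz _⟩ = residue P.1 ⟨z 0, hz 0⟩ := by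
        intro n
        induction n with
        | zero => simp only [zero_smul]
        | succ n ih =>
          rw [← ih, ← sub_eq_zero, ← map_sub, residue_eq_zero_iff,
            ← ValuationSubring.coe_mem_nonunits_iff]
          have := hstep (n • k)
          rw [← succ_nsmul] at this
          exact this
      refine hS (gram_mem_nonunits hz (hz 0) (fun i => ?_) hsum)
      obtain ⟨n, rfl⟩ : ∃ n : ℕ, n • k = i := by
        refine ⟨(i * k⁻¹).val, ?_⟩
        rw [nsmul_eq_mul, ZMod.natCast_zmod_val]
        have : Fact (Nat.Prime 5) := ⟨by norm_num⟩
        rw [inv_mul_cancel_right₀ hk]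
      have := hres n
      rw [← sub_eq_zero, ← map_sub, residue_eq_zero_iff,
        ← ValuationSubring.coe_mem_nonunits_iff] at this
      exact this
    · exact h
  rw [hf5, hK] at hcard
  have hre : {P : Place (ZMod 2) K | LiesOver (ZMod 2) P p}.ncard * e = 1 := by
    have : {P : Place (ZMod 2) K | LiesOver (ZMod 2) P p}.ncard * e * 5 = 1 * 5 := by
      rw [mul_assoc, hcard]
    exact Nat.eq_of_mul_eq_mul_right (by norm_num) this
  have hn1 := Nat.eq_one_of_mul_eq_one_right hre
  have he1 := Nat.eq_one_of_mul_eq_one_left hre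
  obtain ⟨P₀, hP₀⟩ := Set.ncard_eq_one.1 hn1
  have huniq : ∀ P', LiesOver (ZMod 2) P' p → P' = P₀ := by
    intro P' hP'
    have : P' ∈ {P : Place (ZMod 2) K | LiesOver (ZMod 2) P p} := hP'
    rwa [hP₀] at this
  have hPP := huniq P hP
  refine ⟨⟨P, hP, ?_, fun P' hP' => (huniq P' hP').trans hPP.symm⟩, fun P' hP' x => ?_⟩
  · rw [hdeg, hf5, hK]
  · by_cases hx : x = 0
    · subst hx
      rw [map_zero, ordAt_zero, ordAt_zero]
    · rw [(hall P' hP').2.2 x hx, he1]; simp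

end Quintic

section CyclicGenerators

open IsLocalRing Polynomial

variable {K : Type*} [Field K] [Algebra (ZMod 2) K] [Algebra k2 K]

/-- A cyclic family of integral elements of a quintic extension of `𝔽₂(T)`, with prescribed
quadratic invariants and reductions. -/
structure IsCyclicFamily (w : ZMod 5 → K) : Prop where
  exists_aut : ∃ σ : K ≃ₐ[k2] K, ∀ i, σ (w i) = w (i + 1)
  sum_eq : ∑ i, w i = 0
  gram_one : ∑ i, w i * w (i + 1) = algebraMap k2 K (polyToRat M0)
  gram_two : ∑ i, w i * w (i + 2) = 0
  mem : ∀ P : Place (ZMod 2) K, algebraMap k2 K RatFunc.X ∈ P.1 → ∀ i, w i ∈ P.1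
  nonunit : ∀ P : Place (ZMod 2) K, algebraMap k2 K RatFunc.X ∈ P.1 →
    algebraMap k2 K (polyToRat M0) ∈ P.1.nonunits → ∀ i, w i ∈ P.1.nonunits
  mem_infty : ∀ P : Place (ZMod 2) K, algebraMap k2 K RatFunc.X ∉ P.1 →
    ∀ i, (algebraMap k2 K RatFunc.X ^ 2)⁻¹ * w i ∈ P.1

variable [FiniteDimensional k2 K] [IsGalois k2 K] {w : ZMod 5 → K}

omit [FiniteDimensional k2 K] [IsGalois k2 K] in
theorem aut_mem_nonunits {p : Place (ZMod 2) k2} {P : Place (ZMod 2) K}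
    (hP : LiesOver (ZMod 2) P p) (hu : ∀ P', LiesOver (ZMod 2) P' p → P' = P)
    (σ : K ≃ₐ[k2] K) {x : K} (hx : x ∈ P.1.nonunits) : σ x ∈ P.1.nonunits := by
  let P' : Place (ZMod 2) K := ⟨P.1.comap (σ : K →+* K), fun h => P.2.1 (by
      rw [eq_top_iff]
      intro x _
      have : σ.symm x ∈ P.1.comap (σ : K →+* K) := by rw [h]; exact ValuationSubring.mem_top _
      simpa using this), constants_mem _⟩
  have hmem : ∀ x : K, x ∈ P'.1 ↔ σ x ∈ P.1 := fun x => Iff.rfl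
  have hP' : P' = P := by
    apply hu
    rw [LiesOver, ← hP]
    ext y
    change σ (algebraMap k2 K y) ∈ P.1 ↔ algebraMap k2 K y ∈ P.1
    rw [σ.commutes]
  rw [ValuationSubring.mem_nonunits_iff_or, ← map_inv₀, ← hmem, hP', map_eq_zero,
    ← ValuationSubring.mem_nonunits_iff_or]
  exact hx

/-- At a place with no conjugates where one conjugate is congruent to an element of the base
field, the discriminant vanishes. -/
theorem IsCyclicFamily.gram_of_const (hw : IsCyclicFamily w) {p : Place (ZMod 2) k2}
    {P : Place (ZMod 2) K} (hP : LiesOver (ZMod 2) P p)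
    (hu : ∀ P', LiesOver (ZMod 2) P' p → P' = P) (hX : algebraMap k2 K RatFunc.X ∈ P.1)
    {c : k2} (hc : c ∈ p.1) (h : w 0 - algebraMap k2 K c ∈ P.1.nonunits) :
    algebraMap k2 K (polyToRat M0) ∈ P.1.nonunits := by
  obtain ⟨σ, hσ⟩ := hw.exists_aut
  rw [← hw.gram_one]
  have hcP : algebraMap k2 K c ∈ P.1 := by
    rw [← hP] at hc; exact hc
  have hstep : ∀ n : ℕ, w n - algebraMap k2 K c ∈ P.1.nonunits := by
    intro n
    induction n with
    | zero => simpa using h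
    | succ n ih =>
      have := aut_mem_nonunits hP hu σ ih
      rwa [map_sub, σ.commutes, hσ, ← Nat.cast_succ] at this
  refine gram_mem_nonunits (hw.mem P hX) hcP (fun i => ?_) hw.sum_eq
  have := hstep i.val
  rwa [ZMod.natCast_zmod_val] at this

theorem exists_const_of_degree_eq {p : Place (ZMod 2) k2}
    {P : Place (ZMod 2) K} (hP : LiesOver (ZMod 2) P p)
    (hdeg : placeDegree (ZMod 2) P = placeDegree (ZMod 2) p) {x : K} (hx : x ∈ P.1) :
    ∃ c ∈ p.1, x - algebraMap k2 K c ∈ P.1.nonunits := by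
  have hfin := place_finite p
  have hmap : ∀ y : p.1, algebraMap k2 K y ∈ P.1 := by
    intro y
    have : (y : k2) ∈ P.1.comap (algebraMap k2 K) := by rw [hP]; exact y.2
    exact this
  choose lift hlift using residue_surjective (R := p.1)
  let φ : ResidueField p.1 → ResidueField P.1 := fun y => residue P.1 ⟨_, hmap (lift y)⟩
  have hinj : Function.Injective φ := by
    intro y y' hyy
    have h1 : residue P.1 (⟨_, hmap (lift y)⟩ - ⟨_, hmap (lift y')⟩) = 0 := by
      rw [map_sub, sub_eq_zero]; exact hyy
    rw [residue_eq_zero_iff, ← ValuationSubring.coe_mem_nonunits_iff] at h1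
    have h2 : algebraMap k2 K ((lift y : k2) - lift y') ∈ P.1.nonunits := by
      rw [map_sub]; exact h1
    rw [nonunits_comap p hP] at h2
    have h3 : lift y - lift y' ∈ maximalIdeal p.1 := ValuationSubring.coe_mem_nonunits_iff.1 h2
    rw [← residue_eq_zero_iff, map_sub, hlift, hlift, sub_eq_zero] at h3
    exact h3
  have hbij : Function.Bijective φ := by
    have : Fintype (ResidueField p.1) := Fintype.ofFinite _
    have : Fintype (ResidueField P.1) := Fintype.ofFinite _
    refine (Fintype.bijective_iff_injective_and_card φ).2 ⟨hinj, ?_⟩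
    rw [← Nat.card_eq_fintype_card, ← Nat.card_eq_fintype_card, card_residueField,
      card_residueField, hdeg]
  obtain ⟨y, hy⟩ := hbij.2 (residue P.1 ⟨x, hx⟩)
  refine ⟨lift y, (lift y).2, ?_⟩
  have h1 : residue P.1 (⟨x, hx⟩ - ⟨_, hmap (lift y)⟩) = 0 := by
    rw [map_sub, sub_eq_zero]; exact hy.symm
  rw [residue_eq_zero_iff, ← ValuationSubring.coe_mem_nonunits_iff] at h1
  exact h1

theorem IsCyclicFamily.unramified_finite (hw : IsCyclicFamily w) (hK : Module.finrank k2 K = 5)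
    {p : Place (ZMod 2) k2} (hX : RatFunc.X ∈ p.1) (hM : polyToRat M0 ∉ p.1.nonunits) :
    IsUnramifiedAt (ZMod 2) K p := by
  obtain ⟨e, f, he, hf, hfin, hcard, hall⟩ := galois_efr (K := K) p
  intro P hP x
  by_cases hx : x = 0
  · subst hx; rw [map_zero, ordAt_zero, ordAt_zero]
  obtain ⟨hfinP, hdeg, hord⟩ := hall P hP
  rw [hord x hx]
  have hdvd : e ∣ 5 := by rw [← hK, ← hcard]; exact (dvd_mul_right _ _).mul_left _
  rcases (Nat.dvd_prime (by norm_num : Nat.Prime 5)).1 hdvd with h | h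
  · rw [h]; simp
  · exfalso
    rw [h, hK] at hcard
    have hre : {P : Place (ZMod 2) K | LiesOver (ZMod 2) P p}.ncard * f = 1 := by
      have : {P : Place (ZMod 2) K | LiesOver (ZMod 2) P p}.ncard * f * 5 = 1 * 5 := by
        rw [mul_assoc, mul_comm f, hcard]
      exact Nat.eq_of_mul_eq_mul_right (by norm_num) this
    have hn1 := Nat.eq_one_of_mul_eq_one_right hre
    have hf1 := Nat.eq_one_of_mul_eq_one_left hre
    obtain ⟨P₀, hP₀⟩ := Set.ncard_eq_one.1 hn1
    have huniq : ∀ P', LiesOver (ZMod 2) P' p → P' = P₀ := by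
      intro P' hP'
      have : P' ∈ {P : Place (ZMod 2) K | LiesOver (ZMod 2) P p} := hP'
      rwa [hP₀] at this
    have hPX : algebraMap k2 K RatFunc.X ∈ P.1 := by
      have : RatFunc.X ∈ P.1.comap (algebraMap k2 K) := by rw [hP]; exact hX
      exact this
    obtain ⟨c, hc, hcw⟩ := exists_const_of_degree_eq hP (by rw [hdeg, hf1, one_mul])
      (hw.mem P hPX 0)
    have := hw.gram_of_const hP (fun P' hP' => (huniq P' hP').trans (huniq P hP).symm) hPX hc hcw
    rw [nonunits_comap p hP] at this
    exact hM this

/-- The place of `M` is totally ramified. -/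
theorem IsCyclicFamily.ramified (hw : IsCyclicFamily w) (hK : Module.finrank k2 K = 5)
    {p : Place (ZMod 2) k2} (hp : IsFinitePlaceOf p.1 M0) :
    ∃ P : Place (ZMod 2) K, placeDegree (ZMod 2) P = 4 ∧
      ∀ P', LiesOver (ZMod 2) P' p → P' = P := by
  obtain ⟨hX, hM⟩ := (isFinitePlaceOf_M0_iff p).1 hp
  obtain ⟨e, f, he, hf, hfin, hcard, hall⟩ := galois_efr (K := K) p
  have hne : {P : Place (ZMod 2) K | LiesOver (ZMod 2) P p}.Nonempty := by
    rw [Set.nonempty_iff_ne_empty]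
    intro h0
    rw [h0, Set.ncard_empty, zero_mul, hK] at hcard
    omega
  obtain ⟨P, hP⟩ := hne
  have hP : LiesOver (ZMod 2) P p := hP
  obtain ⟨hfinP, hdeg, hord⟩ := hall P hP
  have hPX : algebraMap k2 K RatFunc.X ∈ P.1 := by
    have : RatFunc.X ∈ P.1.comap (algebraMap k2 K) := by rw [hP]; exact hX
    exact this
  have hwP := hw.nonunit P hPX ((nonunits_comap p hP _).2 hM)
  have hM0 : polyToRat M0 ≠ 0 := by simpa [polyToRat] using M0_ne_zero
  have hord1 : ordAt p.1 (polyToRat M0) = 1 := by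
    obtain ⟨π, hπ, h1, h2, -, h3, -⟩ := finitePlace_exists_irreducible p hX
    obtain ⟨c, hc⟩ := (h1 M0).1 hM
    have hc0 : c ≠ 0 := by rintro rfl; exact M0_ne_zero (by rw [hc, mul_zero])
    have hd := congrArg natDegree hc
    rw [natDegree_mul hπ.ne_zero hc0, natDegree_M0, ← h3, placeDegree_of_M0 p hp] at hd
    have hc1 : c = 1 := by
      have h4 := eq_C_of_natDegree_eq_zero (by omega : c.natDegree = 0)
      have h5 : ∀ a : ZMod 2, a ≠ 0 → a = 1 := by decide
      have h6 : c.coeff 0 = 1 := h5 _ fun h => hc0 (by rw [h4, h, C_0])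
      rw [h4, h6, C_1]
    rw [hc1, mul_one] at hc
    rw [hc]
    exact h2
  have h2 : (2 : ℤ) ≤ ordAt P.1 (algebraMap k2 K (polyToRat M0)) := by
    have hmem : ∑ i, (⟨w i, hw.mem P hPX i⟩ : P.1) * ⟨w (i + 1), hw.mem P hPX _⟩ ∈
        maximalIdeal P.1 ^ 2 := by
      refine Ideal.sum_mem _ fun i _ => ?_
      rw [pow_two]
      exact Ideal.mul_mem_mul (ValuationSubring.coe_mem_nonunits_iff.1 (hwP i))
        (ValuationSubring.coe_mem_nonunits_iff.1 (hwP (i + 1)))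
    have hcoe : ((∑ i, (⟨w i, hw.mem P hPX i⟩ : P.1) * ⟨w (i + 1), hw.mem P hPX _⟩ : P.1) : K) =
        algebraMap k2 K (polyToRat M0) :=
      (map_sum P.1.subtype (fun i => (⟨w i, hw.mem P hPX i⟩ : P.1) *
        (⟨w (i + 1), hw.mem P hPX (i + 1)⟩ : P.1)) Finset.univ).trans hw.gram_one
    have h0 : ((∑ i, (⟨w i, hw.mem P hPX i⟩ : P.1) * ⟨w (i + 1), hw.mem P hPX _⟩ : P.1) : K) ≠ 0 := by
      intro h
      have h' := hcoe.symm.trans h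
      exact hM0 (by simpa using h')
    have := (mem_maximalIdeal_pow_iff P.1 h0 2).1 hmem
    exact this.trans (le_of_eq (congrArg _ hcoe))
  rw [hord _ hM0, hord1, mul_one] at h2
  have hdvd : e ∣ 5 := by rw [← hK, ← hcard]; exact (dvd_mul_right _ _).mul_left _
  rcases (Nat.dvd_prime (by norm_num : Nat.Prime 5)).1 hdvd with h | h
  · omega
  · rw [h, hK] at hcard
    have hre : {P : Place (ZMod 2) K | LiesOver (ZMod 2) P p}.ncard * f = 1 := by
      have : {P : Place (ZMod 2) K | LiesOver (ZMod 2) P p}.ncard * f * 5 = 1 * 5 := by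
        rw [mul_assoc, mul_comm f, hcard]
      exact Nat.eq_of_mul_eq_mul_right (by norm_num) this
    have hn1 := Nat.eq_one_of_mul_eq_one_right hre
    have hf1 := Nat.eq_one_of_mul_eq_one_left hre
    obtain ⟨P₀, hP₀⟩ := Set.ncard_eq_one.1 hn1
    have huniq : ∀ P', LiesOver (ZMod 2) P' p → P' = P₀ := by
      intro P' hP'
      have : P' ∈ {P : Place (ZMod 2) K | LiesOver (ZMod 2) P p} := hP'
      rwa [hP₀] at this
    refine ⟨P, by rw [hdeg, hf1, one_mul, placeDegree_of_M0 p hp],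
      fun P' hP' => (huniq P' hP').trans (huniq P hP).symm⟩

end CyclicGenerators

section CyclicFamilyInvariants

open IsLocalRing Polynomial

variable {K : Type*} [Field K] [Algebra (ZMod 2) K] [Algebra k2 K]

/-- The Frobenius elements of all small places away from `M`, and of the infinite place, act on
the reductions of the family as nontrivial shifts. -/
structure HasShiftFrobenius (w : ZMod 5 → K) : Prop where
  finite : ∀ (p : Place (ZMod 2) k2) (P : Place (ZMod 2) K), LiesOver (ZMod 2) P p →
    RatFunc.X ∈ p.1 → placeDegree (ZMod 2) p ≤ 4 → polyToRat M0 ∉ p.1.nonunits →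
    ∃ k : ZMod 5, k ≠ 0 ∧ ∀ i, w i ^ 2 ^ placeDegree (ZMod 2) p - w (i + k) ∈ P.1.nonunits
  infinite : ∀ P : Place (ZMod 2) K, algebraMap k2 K RatFunc.X ∉ P.1 →
    ∃ k : ZMod 5, k ≠ 0 ∧ ∀ i, ((algebraMap k2 K RatFunc.X ^ 2)⁻¹ * w i) ^ 2 -
      (algebraMap k2 K RatFunc.X ^ 2)⁻¹ * w (i + k) ∈ P.1.nonunits

variable [FiniteDimensional k2 K] [IsGalois k2 K] {w : ZMod 5 → K}

theorem intDegree_M0_div : ((RatFunc.X ^ 4 : k2)⁻¹ * polyToRat M0).intDegree = 0 := by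
  have hM : polyToRat M0 ≠ 0 := by simpa [polyToRat] using M0_ne_zero
  have hX : (RatFunc.X ^ 4 : k2) ≠ 0 := pow_ne_zero _ RatFunc.X_ne_zero
  have h4 : (RatFunc.X ^ 4 : k2) = polyToRat (X ^ 4) := by simp [polyToRat]
  rw [RatFunc.intDegree_mul (inv_ne_zero hX) hM, RatFunc.intDegree_inv, h4, polyToRat, polyToRat,
    RatFunc.intDegree_polynomial, RatFunc.intDegree_polynomial, natDegree_M0, natDegree_X_pow]
  rfl

theorem exists_place_above (p : Place (ZMod 2) k2) (hK : Module.finrank k2 K = 5) :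
    ∃ P : Place (ZMod 2) K, LiesOver (ZMod 2) P p := by
  obtain ⟨e, f, he, hf, hfin, hcard, hall⟩ := galois_efr (K := K) p
  have hne : {P : Place (ZMod 2) K | LiesOver (ZMod 2) P p}.Nonempty := by
    rw [Set.nonempty_iff_ne_empty]
    intro h0
    rw [h0, Set.ncard_empty, zero_mul, hK] at hcard
    omega
  exact hne

theorem liesOver_mem {p : Place (ZMod 2) k2} {P : Place (ZMod 2) K} (hP : LiesOver (ZMod 2) P p)
    (x : k2) : algebraMap k2 K x ∈ P.1 ↔ x ∈ p.1 := by
  have : x ∈ P.1.comap (algebraMap k2 K) ↔ x ∈ p.1 := by rw [hP]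
  exact this

theorem IsCyclicFamily.inert_infinite (hw : IsCyclicFamily w) (hs : HasShiftFrobenius w)
    (hK : Module.finrank k2 K = 5) {p : Place (ZMod 2) k2} (hX : RatFunc.X ∉ p.1) :
    IsInert (ZMod 2) K p ∧ IsUnramifiedAt (ZMod 2) K p := by
  obtain ⟨P, hP⟩ := exists_place_above (K := K) p hK
  have hPX : algebraMap k2 K RatFunc.X ∉ P.1 := by rwa [liesOver_mem hP]
  obtain ⟨k, hk, hfrob⟩ := hs.infinite P hPX
  refine inert_of_frobenius hK hP (hw.mem_infty P hPX) ?_ ?_ hk ?_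
  · rw [← Finset.mul_sum, hw.sum_eq, mul_zero]
  · have h1 : ∑ i, ((algebraMap k2 K RatFunc.X ^ 2)⁻¹ * w i) *
        ((algebraMap k2 K RatFunc.X ^ 2)⁻¹ * w (i + 1)) =
        algebraMap k2 K ((RatFunc.X ^ 4)⁻¹ * polyToRat M0) := by
      rw [map_mul, ← hw.gram_one, Finset.mul_sum]
      refine Finset.sum_congr rfl fun i _ => ?_
      rw [map_inv₀, map_pow]
      ring
    rw [h1, nonunits_comap p hP]
    have hM : polyToRat M0 ≠ 0 := by simpa [polyToRat] using M0_ne_zero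
    have hX4 : (RatFunc.X ^ 4 : k2) ≠ 0 := pow_ne_zero _ RatFunc.X_ne_zero
    have h0 := mul_ne_zero (inv_ne_zero hX4) hM
    have hdvr := place_isDVR p
    rw [mem_nonunits_iff_ordAt_pos h0, ordAt_infinitePlace p hX _ h0, intDegree_M0_div]
    simp
  · rw [infinitePlace_degree p hX]
    exact hfrob

theorem IsCyclicFamily.inert_finite (hw : IsCyclicFamily w) (hs : HasShiftFrobenius w)
    (hK : Module.finrank k2 K = 5) {p : Place (ZMod 2) k2} (hX : RatFunc.X ∈ p.1)
    (hd : placeDegree (ZMod 2) p ≤ 4) (hM : polyToRat M0 ∉ p.1.nonunits) :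
    IsInert (ZMod 2) K p ∧ IsUnramifiedAt (ZMod 2) K p := by
  obtain ⟨P, hP⟩ := exists_place_above (K := K) p hK
  have hPX : algebraMap k2 K RatFunc.X ∈ P.1 := by rwa [liesOver_mem hP]
  obtain ⟨k, hk, hfrob⟩ := hs.finite p P hP hX hd hM
  refine inert_of_frobenius hK hP (hw.mem P hPX) hw.sum_eq ?_ hk hfrob
  rwa [hw.gram_one, nonunits_comap p hP]

theorem IsCyclicFamily.inert (hw : IsCyclicFamily w) (hs : HasShiftFrobenius w)
    (hK : Module.finrank k2 K = 5) (p : Place (ZMod 2) k2) (hd : placeDegree (ZMod 2) p ≤ 4)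
    (hM : ¬ IsFinitePlaceOf p.1 M0) : IsInert (ZMod 2) K p := by
  by_cases hX : RatFunc.X ∈ p.1
  · exact (hw.inert_finite hs hK hX hd fun h => hM ((isFinitePlaceOf_M0_iff p).2 ⟨hX, h⟩)).1
  · exact (hw.inert_infinite hs hK hX).1

theorem IsCyclicFamily.unramified (hw : IsCyclicFamily w) (hs : HasShiftFrobenius w)
    (hK : Module.finrank k2 K = 5) (p : Place (ZMod 2) k2)
    (hM : ¬ IsFinitePlaceOf p.1 M0) : IsUnramifiedAt (ZMod 2) K p := by
  by_cases hX : RatFunc.X ∈ p.1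
  · exact hw.unramified_finite hK hX fun h => hM ((isFinitePlaceOf_M0_iff p).2 ⟨hX, h⟩)
  · exact (hw.inert_infinite hs hK hX).2

theorem IsCyclicFamily.genus_classNumber (hw : IsCyclicFamily w) (hs : HasShiftFrobenius w)
    (hK : Module.finrank k2 K = 5) : genus (ZMod 2) K = 4 ∧ classNumber (ZMod 2) K = 1 := by
  obtain ⟨m, hm⟩ := exists_place_M0
  obtain ⟨Pm, hPm4, hPmu⟩ := hw.ramified hK hm
  obtain ⟨p, hp⟩ := exists_infinitePlace
  obtain ⟨⟨Q, hQp, hQd, hQu⟩, hunr⟩ := hw.inert_infinite hs hK hp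
  rw [infinitePlace_degree p hp, hK, mul_one] at hQd
  have hQ : IsInftyPlace Q := by
    refine ⟨by rwa [liesOver_mem hQp], fun P hP => hQu P ?_, fun x hx => ?_⟩
    · have : placeBelow P = p := infinitePlace_unique _ _ hP hp
      rw [← this]
      exact liesOver_placeBelow P
    · rw [hunr Q hQp, ordAt_infinitePlace p hp x hx]
  have hM : polyToRat M0 ≠ 0 := by simpa [polyToRat] using M0_ne_zero
  obtain ⟨σ, hσ⟩ := hw.exists_aut
  have h2 : (2 : K) = 0 := by linear_combination -char_two_neg (1 : K)
  have hell := fun n => hQ.ell_single_ge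
    (linearIndependent_of_gram hσ hw.sum_eq hw.gram_two (by rw [hw.gram_one]; simpa using hM) h2)
    (fun i P hP => hw.mem P hP _) (fun i => hw.mem_infty Q hQ.notMem _) n
  have hdeg := hQ.deg_sub_ell_le hQd hK hell
  refine CFF.genus_classNumber hPm4 (fun P hP => ?_) hQd hdeg fun f hf => ?_
  · by_cases hPM : IsFinitePlaceOf (placeBelow P).1 M0
    · apply hPmu
      rw [← finitePlace_M0_unique _ _ hPM hm]
      exact liesOver_placeBelow P
    exfalso
    obtain ⟨e, f, he, hf, hfin, hcard, hall⟩ := galois_efr (K := K) (placeBelow P)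
    obtain ⟨-, hd, -⟩ := hall P (liesOver_placeBelow P)
    have hle : placeDegree (ZMod 2) (placeBelow P) ≤ 4 :=
      (Nat.le_mul_of_pos_left _ hf).trans (hd ▸ hP)
    obtain ⟨P', hP', hd', hu'⟩ := hw.inert hs hK _ hle hPM
    rw [← hu' P (liesOver_placeBelow P), hK] at hd'
    have := placeDegree_pos (placeBelow P)
    omega
  · obtain ⟨Z, hZ⟩ := hQ.exists_divisor hQd hK hf
    exact ⟨Z, hZ, deg_principal hdeg hf hZ⟩

end CyclicFamilyInvariants

section TwistedSums

open Polynomial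

variable {A B : Type*} [CommRing A] [CommRing B]

/-- The powers `x^(2^i)`, indexed by `ℤ/5`. -/
def conjSeq (x : A) (i : ZMod 5) : A := x ^ 2 ^ i.val

/-- The sums `∑ⱼ x^(2^(u(i+j))) eⱼ`. -/
def twist (u : ZMod 5) (x : A) (e : ZMod 5 → A) (i : ZMod 5) : A :=
  ∑ j, conjSeq x (u * (i + j)) * e j

/-- The norms to the quintic subfield of a sequence of torsion points. -/
def torsionNorm (l : ℕ → A) (j : ZMod 5) : A := l j.val * l (j.val + 5) * l (j.val + 10)

theorem map_conjSeq (φ : A →+* B) (x : A) (i : ZMod 5) : φ (conjSeq x i) = conjSeq (φ x) i :=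
  map_pow _ _ _

theorem map_twist (φ : A →+* B) (u : ZMod 5) (x : A) (e : ZMod 5 → A) (i : ZMod 5) :
    φ (twist u x e i) = twist u (φ x) (φ ∘ e) i := by
  simp only [twist, map_sum, map_mul, map_conjSeq, Function.comp]

theorem map_torsionNorm (φ : A →+* B) (l : ℕ → A) (j : ZMod 5) :
    φ (torsionNorm l j) = torsionNorm (φ ∘ l) j := by
  simp only [torsionNorm, map_mul, Function.comp]

/-- A sequence of points `C_{T^i}(λ)` of the Carlitz module killed by `T⁴ + T + 1`. -/
structure IsTorsionSeq (t : A) (l : ℕ → A) : Prop where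
  succ : ∀ i, l (i + 1) = l i ^ 2 + t * l i
  rel : ∀ i, l (i + 4) = l (i + 1) + l i

/-- The quintic equation whose roots form a self-dual normal basis of `𝔽₃₂`. -/
def IsNormalGen (x : A) : Prop := x ^ 5 + x ^ 4 + x ^ 2 + x + 1 = 0

theorem IsTorsionSeq.map {t : A} {l : ℕ → A} (h : IsTorsionSeq t l) (φ : A →+* B) :
    IsTorsionSeq (φ t) (φ ∘ l) :=
  ⟨fun i => by simp [h.succ i], fun i => by simp [h.rel i]⟩

theorem IsNormalGen.map {x : A} (h : IsNormalGen x) (φ : A →+* B) : IsNormalGen (φ x) := by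
  have := congrArg φ h
  simpa [IsNormalGen] using this

variable [CharP A 2]

section Torsion

variable {t : A} {l : ℕ → A} (h : IsTorsionSeq t l)
include h

theorem IsTorsionSeq.add_five (i : ℕ) : l (i + 5) = l (i + 2) + l (i + 1) := h.rel (i + 1)

theorem IsTorsionSeq.add_ten (i : ℕ) : l (i + 10) = l i + l (i + 1) + l (i + 2) := by
  have h1 := h.rel i
  have h2 := h.rel (i + 3)
  have h3 := h.rel (i + 6)
  have h4 := h.rel (i + 2)
  have h5 := h.rel (i + 1)
  have h6 := h.rel (i + 0)
  simp only [Nat.add_assoc] at *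
  norm_num at *
  grind

theorem IsTorsionSeq.add_fifteen (i : ℕ) : l (i + 15) = l i := by
  have h1 := h.add_ten (i + 5)
  have h2 := h.add_five i
  have h3 := h.add_five (i + 1)
  have h4 := h.add_five (i + 2)
  have h5 := h.rel i
  simp only [Nat.add_assoc] at *
  norm_num at *
  grind

theorem IsTorsionSeq.add_mul_fifteen (i n : ℕ) : l (i + 15 * n) = l i := by
  induction n with
  | zero => rfl
  | succ n ih => rw [Nat.mul_succ, ← add_assoc, h.add_fifteen, ih]

theorem IsTorsionSeq.mod (i : ℕ) : l (i % 15) = l i := by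
  conv_rhs => rw [← Nat.mod_add_div i 15, h.add_mul_fifteen]

theorem IsTorsionSeq.torsionNorm_natCast (n : ℕ) :
    torsionNorm l (n : ZMod 5) = l n * l (n + 5) * l (n + 10) := by
  rw [torsionNorm, ZMod.val_natCast]
  have key : ∀ m, l m * l (m + 5) * l (m + 10) = l (m + 5) * l (m + 5 + 5) * l (m + 5 + 10) := by
    intro m
    have := h.add_fifteen m
    simp only [add_assoc]
    norm_num
    rw [this]
    ring
  have key2 : ∀ m k, l m * l (m + 5) * l (m + 10) =
      l (m + 5 * k) * l (m + 5 * k + 5) * l (m + 5 * k + 10) := by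
    intro m k
    induction k with
    | zero => rfl
    | succ k ih => rw [ih, key, Nat.mul_succ, ← add_assoc]
  conv_rhs => rw [← Nat.mod_add_div n 5]
  exact key2 _ _

theorem IsTorsionSeq.torsionNorm_eq (n : ℕ) : torsionNorm l (n : ZMod 5) =
    l n * (l (n + 2) + l (n + 1)) * (l n + l (n + 1) + l (n + 2)) := by
  rw [h.torsionNorm_natCast, h.add_five, h.add_ten]

theorem IsTorsionSeq.torsionNorm_expand :
    torsionNorm l 0 = l 0 * (l 2 + l 1) * (l 0 + l 1 + l 2) ∧
    torsionNorm l 1 = l 1 * (l 3 + l 2) * (l 1 + l 2 + l 3) ∧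
    torsionNorm l 2 = l 2 * (l 1 + l 0 + l 3) * (l 2 + l 3 + l 1 + l 0) ∧
    torsionNorm l 3 = l 3 * (l 2 + l 0) * (l 3 + l 0 + l 2) ∧
    torsionNorm l 4 = (l 1 + l 0) * (l 3 + l 1) * (l 0 + l 3) := by
  have h0 := h.torsionNorm_eq 0
  have h1 := h.torsionNorm_eq 1
  have h2 := h.torsionNorm_eq 2
  have h3 := h.torsionNorm_eq 3
  have h4 := h.torsionNorm_eq 4
  have r0 := h.rel 0
  have r1 := h.rel 1
  have r2 := h.rel 2
  norm_num at *
  refine ⟨h0, h1, ?_, ?_, ?_⟩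
  · rw [h2, r0]; ring
  · rw [h3, r0, r1]; grind
  · rw [h4, r0, r1, r2]; grind

theorem IsTorsionSeq.sum_torsionNorm : ∑ j, torsionNorm l j = 0 := by
  obtain ⟨h0, h1, h2, h3, h4⟩ := h.torsionNorm_expand
  rw [sum_zmod_five, h0, h1, h2, h3, h4]
  grind

theorem IsTorsionSeq.gram_two : ∑ j, torsionNorm l j * torsionNorm l (j + 2) = 0 := by
  obtain ⟨h0, h1, h2, h3, h4⟩ := h.torsionNorm_expand
  rw [sum_zmod_five]
  change torsionNorm l 0 * torsionNorm l 2 + torsionNorm l 1 * torsionNorm l 3 +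
    torsionNorm l 2 * torsionNorm l 4 + torsionNorm l 3 * torsionNorm l 0 +
    torsionNorm l 4 * torsionNorm l 1 = 0
  rw [h0, h1, h2, h3, h4]
  have r0 := h.succ 0
  have r1 := h.succ 1
  have r2 := h.succ 2
  have r3 := h.succ 3
  have r4 := h.rel 0
  norm_num at r0 r1 r2 r3 r4
  rw [r4] at r3
  grind

theorem IsTorsionSeq.gram_one_mul :
    l 0 * ∑ j, torsionNorm l j * torsionNorm l (j + 1) = l 0 * (t ^ 4 + t + 1) := by
  obtain ⟨h0, h1, h2, h3, h4⟩ := h.torsionNorm_expand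
  rw [sum_zmod_five]
  change l 0 * (torsionNorm l 0 * torsionNorm l 1 + torsionNorm l 1 * torsionNorm l 2 +
    torsionNorm l 2 * torsionNorm l 3 + torsionNorm l 3 * torsionNorm l 4 +
    torsionNorm l 4 * torsionNorm l 0) = _
  rw [h0, h1, h2, h3, h4]
  have r0 := h.succ 0
  have r1 := h.succ 1
  have r2 := h.succ 2
  have r3 := h.succ 3
  have r4 := h.rel 0
  norm_num at r0 r1 r2 r3 r4
  rw [r4] at r3
  clear h0 h1 h2 h3 h4 h
  grind

end Torsion

end TwistedSums

section TwistedSumIdentities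

variable {A : Type*} [CommRing A] [CharP A 2] {x : A} (hx : IsNormalGen x)

include hx

theorem IsNormalGen.pow_thirtyTwo : x ^ 32 = x := by
  have h : x ^ 5 + x ^ 4 + x ^ 2 + x + 1 = 0 := hx
  grind

theorem IsNormalGen.conjSeq_natCast (n : ℕ) : conjSeq x (n : ZMod 5) = x ^ 2 ^ n := by
  have key : ∀ m k, x ^ 2 ^ (m + 5 * k) = x ^ 2 ^ m := by
    intro m k
    induction k with
    | zero => rfl
    | succ k ih =>
      rw [Nat.mul_succ, ← add_assoc, pow_add, mul_comm, pow_mul]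
      norm_num
      rw [hx.pow_thirtyTwo, ih]
  rw [conjSeq, ZMod.val_natCast]
  conv_rhs => rw [← Nat.mod_add_div n 5, key]

theorem IsNormalGen.conjSeq_pow (i : ZMod 5) (n : ℕ) :
    conjSeq x i ^ 2 ^ n = conjSeq x (i + n) := by
  have h := hx.conjSeq_natCast (i.val + n)
  rw [Nat.cast_add, ZMod.natCast_zmod_val] at h
  rw [h, conjSeq, ← pow_mul, ← pow_add]

theorem IsNormalGen.conjSeq_expand : conjSeq x 0 = x ∧ conjSeq x 1 = x ^ 2 ∧
    conjSeq x 2 = x ^ 4 ∧ conjSeq x 3 = x ^ 8 ∧ conjSeq x 4 = x ^ 16 := by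
  have h0 := hx.conjSeq_natCast 0
  have h1 := hx.conjSeq_natCast 1
  have h2 := hx.conjSeq_natCast 2
  have h3 := hx.conjSeq_natCast 3
  have h4 := hx.conjSeq_natCast 4
  norm_num at h0 h1 h2 h3 h4
  exact ⟨h0, h1, h2, h3, h4⟩

theorem IsNormalGen.sum_conjSeq : ∑ i, conjSeq x i = 1 := by
  obtain ⟨h0, h1, h2, h3, h4⟩ := hx.conjSeq_expand
  rw [sum_zmod_five, h0, h1, h2, h3, h4]
  have h : x ^ 5 + x ^ 4 + x ^ 2 + x + 1 = 0 := hx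
  grind

theorem IsNormalGen.gram_conjSeq (r : ZMod 5) :
    ∑ i, conjSeq x i * conjSeq x (i + r) = if r = 0 then 1 else 0 := by
  obtain ⟨h0, h1, h2, h3, h4⟩ := hx.conjSeq_expand
  have h : x ^ 5 + x ^ 4 + x ^ 2 + x + 1 = 0 := hx
  have h01 : (0 : ZMod 5) ≠ 1 := by decide
  rw [sum_zmod_five]
  have hr : r = 0 ∨ r = 1 ∨ r = 2 ∨ r = 3 ∨ r = 4 := by revert r; decide
  rcases hr with rfl | rfl | rfl | rfl | rfl
  · rw [if_pos rfl]
    change conjSeq x 0 * conjSeq x 0 + conjSeq x 1 * conjSeq x 1 + conjSeq x 2 * conjSeq x 2 +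
      conjSeq x 3 * conjSeq x 3 + conjSeq x 4 * conjSeq x 4 = 1
    rw [h0, h1, h2, h3, h4]
    clear h0 h1 h2 h3 h4
    grind
  · rw [if_neg (by decide)]
    change conjSeq x 0 * conjSeq x 1 + conjSeq x 1 * conjSeq x 2 + conjSeq x 2 * conjSeq x 3 +
      conjSeq x 3 * conjSeq x 4 + conjSeq x 4 * conjSeq x 0 = 0
    rw [h0, h1, h2, h3, h4]
    clear h0 h1 h2 h3 h4
    grind
  · rw [if_neg (by decide)]
    change conjSeq x 0 * conjSeq x 2 + conjSeq x 1 * conjSeq x 3 + conjSeq x 2 * conjSeq x 4 +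
      conjSeq x 3 * conjSeq x 0 + conjSeq x 4 * conjSeq x 1 = 0
    rw [h0, h1, h2, h3, h4]
    clear h0 h1 h2 h3 h4
    grind
  · rw [if_neg (by decide)]
    change conjSeq x 0 * conjSeq x 3 + conjSeq x 1 * conjSeq x 4 + conjSeq x 2 * conjSeq x 0 +
      conjSeq x 3 * conjSeq x 1 + conjSeq x 4 * conjSeq x 2 = 0
    rw [h0, h1, h2, h3, h4]
    clear h0 h1 h2 h3 h4
    grind
  · rw [if_neg (by decide)]
    change conjSeq x 0 * conjSeq x 4 + conjSeq x 1 * conjSeq x 0 + conjSeq x 2 * conjSeq x 1 +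
      conjSeq x 3 * conjSeq x 2 + conjSeq x 4 * conjSeq x 3 = 0
    rw [h0, h1, h2, h3, h4]
    clear h0 h1 h2 h3 h4
    grind

variable {u : ZMod 5} (hu : u ≠ 0)

include hu

omit [CharP A 2] hx in
theorem sum_affine {B : Type*} [AddCommMonoid B] (f : ZMod 5 → B) (c : ZMod 5) :
    ∑ i, f (u * (i + c)) = ∑ i, f i := by
  have : Fact (Nat.Prime 5) := ⟨by norm_num⟩
  exact Fintype.sum_equiv ((Equiv.addRight c).trans (Equiv.mulLeft₀ u hu)) _ _ fun i => rfl

theorem IsNormalGen.sum_twist (e : ZMod 5 → A) : ∑ i, twist u x e i = ∑ j, e j := by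
  simp only [twist]
  rw [Finset.sum_comm]
  refine Finset.sum_congr rfl fun j _ => ?_
  rw [← Finset.sum_mul, sum_affine hu (conjSeq x), hx.sum_conjSeq, one_mul]

theorem IsNormalGen.gram_twist (e : ZMod 5 → A) (d : ZMod 5) :
    ∑ i, twist u x e i * twist u x e (i + d) = ∑ j, e j * e (j + d) := by
  have : Fact (Nat.Prime 5) := ⟨by norm_num⟩
  have key : ∀ j j', ∑ i, conjSeq x (u * (i + j)) * e j * (conjSeq x (u * (i + d + j')) * e j') =
      if j' + d = j then e j * e j' else 0 := by
    intro j j'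
    have h := hx.gram_conjSeq (u * (d + j' - j))
    rw [← sum_affine hu (fun i => conjSeq x i * conjSeq x (i + u * (d + j' - j))) j] at h
    have h0 : u * (d + j' - j) = 0 ↔ j' + d = j := by
      rw [mul_eq_zero, or_iff_right hu, sub_eq_zero, add_comm]
    rw [if_congr h0 rfl rfl] at h
    calc _ = (∑ i, conjSeq x (u * (i + j)) * conjSeq x (u * (i + j) + u * (d + j' - j))) *
          (e j * e j') := by
          rw [Finset.sum_mul]
          refine Finset.sum_congr rfl fun i _ => ?_
          rw [show u * (i + d + j') = u * (i + j) + u * (d + j' - j) by ring]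
          ring
      _ = _ := by rw [h, ite_mul, one_mul, zero_mul]
  simp only [twist, Finset.sum_mul_sum]
  rw [Finset.sum_comm, Finset.sum_congr rfl fun j _ => Finset.sum_comm]
  simp only [key]
  rw [Finset.sum_comm]
  refine Finset.sum_congr rfl fun j _ => ?_
  rw [Finset.sum_ite_eq, if_pos (Finset.mem_univ _), mul_comm]

/-- If `q`-th powers shift `e` by `a`, then they shift the twisted sums too. -/
theorem IsNormalGen.twist_pow {e : ZMod 5 → A} {n : ℕ} {a : ZMod 5}
    (he : ∀ j, e j ^ 2 ^ n = e (j + a)) (i : ZMod 5) :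
    twist u x e i ^ 2 ^ n = twist u x e (i + (u⁻¹ * n - a)) := by
  have : Fact (Nat.Prime 5) := ⟨by norm_num⟩
  rw [twist, sum_pow_char_pow 2, twist]
  refine Fintype.sum_equiv (Equiv.addRight a) _ _ fun j => ?_
  rw [mul_pow, hx.conjSeq_pow, he, Equiv.coe_addRight]
  congr 2
  field_simp
  ring

end TwistedSumIdentities

section TorsionFrobenius

variable {A : Type*} [CommRing A] [CharP A 2] {t : A} {l : ℕ → A} (h : IsTorsionSeq t l)

include h

theorem IsTorsionSeq.pow_expand (i : ℕ) :
    l i ^ 2 = l (i + 1) + t * l i ∧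
    l i ^ 4 = l (i + 2) + (t + t ^ 2) * l (i + 1) + t ^ 3 * l i ∧
    l i ^ 8 = l (i + 3) + (t + t ^ 2 + t ^ 4) * l (i + 2) + (t ^ 3 + t ^ 5 + t ^ 6) * l (i + 1) +
      t ^ 7 * l i := by
  have h0 := h.succ i
  have h1 := h.succ (i + 1)
  have h2 := h.succ (i + 2)
  norm_num [add_assoc] at h0 h1 h2
  refine ⟨by grind, by grind, by grind⟩

theorem IsTorsionSeq.pow_sixteen (i : ℕ) :
    l i ^ 16 = l (i + 4) + (t + t ^ 2 + t ^ 4 + t ^ 8) * l (i + 3) +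
      (t ^ 3 + t ^ 5 + t ^ 6 + t ^ 9 + t ^ 10 + t ^ 12) * l (i + 2) +
      (t ^ 7 + t ^ 11 + t ^ 13 + t ^ 14) * l (i + 1) + t ^ 15 * l i := by
  obtain ⟨-, -, h8⟩ := h.pow_expand i
  have e0 := (h.pow_expand i).1
  have e1 := (h.pow_expand (i + 1)).1
  have e2 := (h.pow_expand (i + 2)).1
  have e3 := (h.pow_expand (i + 3)).1
  norm_num [add_assoc] at e0 e1 e2 e3
  have : l i ^ 16 = (l i ^ 8) ^ 2 := by ring
  rw [this, h8]
  clear h8 this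
  grind

theorem IsTorsionSeq.torsionNorm_pow {n b : ℕ} (hb : ∀ i, l i ^ 2 ^ n = l (i + b)) (j : ZMod 5) :
    torsionNorm l j ^ 2 ^ n = torsionNorm l (j + b) := by
  have h1 := h.torsionNorm_natCast (j.val + b)
  rw [Nat.cast_add, ZMod.natCast_zmod_val] at h1
  rw [h1, torsionNorm, mul_pow, mul_pow, hb, hb, hb, add_right_comm, add_right_comm _ _ b]

/-- The Frobenius shifts at the places of degree at most four. -/
theorem IsTorsionSeq.frobenius_X (ht : t = 0) (i : ℕ) : l i ^ 2 ^ 1 = l (i + 1) := by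
  rw [(h.succ i), ht]; ring

theorem IsTorsionSeq.frobenius_X_add_one (ht : t + 1 = 0) (i : ℕ) : l i ^ 2 ^ 1 = l (i + 4) := by
  have h1 := h.succ i
  have h2 := h.rel i
  norm_num
  grind

theorem IsTorsionSeq.frobenius_deg_two (ht : t ^ 2 + t + 1 = 0) (i : ℕ) :
    l i ^ 2 ^ 2 = l (i + 10) := by
  have h1 := (h.pow_expand i).2.1
  have h2 := h.add_ten i
  norm_num
  grind

theorem IsTorsionSeq.frobenius_deg_three (ht : t ^ 3 + t + 1 = 0) (i : ℕ) :
    l i ^ 2 ^ 3 = l (i + 7) := by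
  have h1 := (h.pow_expand i).2.2
  have h2 := h.rel (i + 3)
  have h3 := h.rel i
  norm_num [add_assoc] at h2 ⊢
  grind

theorem IsTorsionSeq.frobenius_deg_three' (ht : t ^ 3 + t ^ 2 + 1 = 0) (i : ℕ) :
    l i ^ 2 ^ 3 = l (i + 13) := by
  have h1 := (h.pow_expand i).2.2
  have h2 := h.add_ten (i + 3)
  have h3 := h.rel i
  have h4 := h.rel (i + 1)
  norm_num [add_assoc] at h2 h4 ⊢
  grind

theorem IsTorsionSeq.frobenius_deg_four (ht : t ^ 4 + t ^ 3 + 1 = 0) (i : ℕ) :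
    l i ^ 2 ^ 4 = l (i + 9) := by
  have h1 := h.pow_sixteen i
  have h2 := h.rel (i + 5)
  have h3 := h.add_five i
  have h4 := h.rel (i + 2)
  norm_num [add_assoc] at h2 h4 ⊢
  have h5 := h.rel i
  grind

theorem IsTorsionSeq.frobenius_deg_four' (ht : t ^ 4 + t ^ 3 + t ^ 2 + t + 1 = 0) (i : ℕ) :
    l i ^ 2 ^ 4 = l (i + 6) := by
  have h1 := h.pow_sixteen i
  have h2 := h.rel (i + 2)
  norm_num [add_assoc] at h2 ⊢
  have h5 := h.rel i
  grind

/-- Modulo `T⁴ + T + 1` the torsion points reduce to zero. -/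
theorem IsTorsionSeq.pow_sixteen_of_root (ht : t ^ 4 + t + 1 = 0) (i : ℕ) : l i ^ 16 = 0 := by
  have h1 := h.pow_sixteen i
  have h5 := h.rel i
  grind

end TorsionFrobenius

section CarlitzTorsion

open Polynomial

instance charP_k2 : CharP k2 2 := charP_of_injective_algebraMap' (ZMod 2) 2

instance charP_omega2 : CharP Omega2 2 := charP_of_injective_algebraMap' k2 2

/-- The orbit of a point under the Carlitz action of `T`. -/
def carlitzSeq (y : Omega2) : ℕ → Omega2
  | 0 => y
  | n + 1 => carlitzSeq y n ^ 2 + algebraMap k2 Omega2 RatFunc.X * carlitzSeq y n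

theorem aeval_carlitzIter (y : Omega2) (n : ℕ) : aeval y (carlitzIter n) = carlitzSeq y n := by
  induction n with
  | zero => simp [carlitzIter, carlitzSeq]
  | succ n ih => simp [carlitzIter, carlitzSeq, ih, carlitzT]

theorem carlitz_M0_eq : carlitz M0 = carlitzIter 4 + carlitzIter 1 + carlitzIter 0 := by
  rw [carlitz, Polynomial.sum_over_range' _ (by simp) 5 (by rw [natDegree_M0]; norm_num)]
  have hc : ∀ i, M0.coeff i = (if i = 4 then 1 else 0) + (if 1 = i then 1 else 0) +
      (if i = 0 then 1 else 0) := fun i => by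
    simp only [M0, coeff_add, coeff_X_pow, coeff_X, coeff_one]
  simp only [Finset.sum_range_succ, hc]
  simp
  ring

theorem natDegree_carlitzIter (n : ℕ) : (carlitzIter n).natDegree = 2 ^ n := by
  induction n with
  | zero => simp [carlitzIter]
  | succ n ih =>
    have : carlitzT.natDegree = 2 := by unfold carlitzT; compute_degree!
    rw [carlitzIter, natDegree_comp, ih, this, pow_succ']

theorem derivative_carlitzIter (n : ℕ) : derivative (carlitzIter n) = C (RatFunc.X ^ n) := by
  have h2 : (2 : k2) = 0 := CharTwo.two_eq_zero
  have : derivative carlitzT = C RatFunc.X := by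
    simp [carlitzT, one_add_one_eq_two, h2]
  induction n with
  | zero => simp [carlitzIter]
  | succ n ih => rw [carlitzIter, derivative_comp, ih, this, C_comp, ← C_mul, pow_succ]

theorem natDegree_carlitz_M0 : (carlitz M0).natDegree = 16 := by
  rw [carlitz_M0_eq, natDegree_add_eq_left_of_natDegree_lt, natDegree_add_eq_left_of_natDegree_lt,
    natDegree_carlitzIter]
  · norm_num
  · rw [natDegree_carlitzIter, natDegree_carlitzIter]; norm_num
  · rw [natDegree_add_eq_left_of_natDegree_lt, natDegree_carlitzIter, natDegree_carlitzIter]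
    · norm_num
    · rw [natDegree_carlitzIter, natDegree_carlitzIter]; norm_num

theorem carlitz_M0_ne_zero : carlitz M0 ≠ 0 := by
  intro h
  have := natDegree_carlitz_M0
  rw [h] at this
  simp at this

theorem polyToRat_M0 : polyToRat M0 = RatFunc.X ^ 4 + RatFunc.X + 1 := by
  simp [polyToRat, M0]

theorem polyToRat_M0_ne_zero : polyToRat M0 ≠ 0 := by
  simpa [polyToRat] using M0_ne_zero

theorem separable_carlitz_M0 : (carlitz M0).Separable := by
  have hd : derivative (carlitz M0) = C (polyToRat M0) := by
    rw [carlitz_M0_eq, derivative_add, derivative_add, derivative_carlitzIter,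
      derivative_carlitzIter, derivative_carlitzIter, polyToRat_M0]
    simp
  rw [Separable, hd]
  exact ⟨0, C (polyToRat M0)⁻¹, by
    rw [zero_mul, zero_add, ← C_mul, inv_mul_cancel₀ polyToRat_M0_ne_zero, C_1]⟩

theorem mem_rootSet_carlitz {y : Omega2} : y ∈ (carlitz M0).rootSet Omega2 ↔
    IsTorsionSeq (algebraMap k2 Omega2 RatFunc.X) (carlitzSeq y) := by
  rw [mem_rootSet_of_ne carlitz_M0_ne_zero, carlitz_M0_eq]
  simp only [map_add, aeval_carlitzIter]
  constructor
  · intro h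
    refine ⟨fun i => rfl, fun i => ?_⟩
    induction i with
    | zero =>
      have : carlitzSeq y 4 = carlitzSeq y 1 + carlitzSeq y 0 := by grind
      exact this
    | succ i ih =>
      have h4 : carlitzSeq y (i + 1 + 4) = carlitzSeq y (i + 4) ^ 2 +
        algebraMap k2 Omega2 RatFunc.X * carlitzSeq y (i + 4) := rfl
      have h1 : carlitzSeq y (i + 1 + 1) = carlitzSeq y (i + 1) ^ 2 +
        algebraMap k2 Omega2 RatFunc.X * carlitzSeq y (i + 1) := rfl
      have h0 : carlitzSeq y (i + 1) = carlitzSeq y i ^ 2 +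
        algebraMap k2 Omega2 RatFunc.X * carlitzSeq y i := rfl
      rw [h4, ih, h1]
      nth_rewrite 5 [h0]
      generalize carlitzSeq y (i + 1) = a
      generalize carlitzSeq y i = b
      grind
  · intro h
    have := h.rel 0
    norm_num at this
    grind

theorem card_rootSet_carlitz : Fintype.card ((carlitz M0).rootSet Omega2) = 16 := by
  rw [card_rootSet_eq_natDegree separable_carlitz_M0 (IsAlgClosed.splits _), natDegree_carlitz_M0]

theorem exists_torsion_ne_zero : ∃ y : Omega2, y ≠ 0 ∧ y ∈ (carlitz M0).rootSet Omega2 := by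
  by_contra! h
  have : (carlitz M0).rootSet Omega2 ⊆ {0} := fun y hy => by
    by_contra h0
    exact h y h0 hy
  have h1 := Set.card_le_card this
  rw [card_rootSet_carlitz] at h1
  simp at h1

theorem exists_isNormalGen : ∃ x : Omega2, IsNormalGen x := by
  have hdeg : (X ^ 5 + X ^ 4 + X ^ 2 + X + 1 : Omega2[X]).degree ≠ 0 := by
    have : (X ^ 5 + X ^ 4 + X ^ 2 + X + 1 : Omega2[X]).degree = 5 := by compute_degree!
    rw [this]; norm_num
  obtain ⟨x, hx⟩ := IsAlgClosed.exists_root _ hdeg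
  refine ⟨x, ?_⟩
  simpa [IsNormalGen] using hx

section Sequence

variable {A : Type*} [CommRing A] [CharP A 2] {t : A} {l : ℕ → A} (h : IsTorsionSeq t l)
include h

omit [CharP A 2] in
theorem IsTorsionSeq.eq_add {l' : ℕ → A} (h' : IsTorsionSeq t l') {i j : ℕ}
    (hij : l i = l' j) (n : ℕ) : l (i + n) = l' (j + n) := by
  induction n with
  | zero => exact hij
  | succ n ih => rw [← add_assoc, ← add_assoc, h.succ, h'.succ, ih]

theorem IsTorsionSeq.ne_zero (h0 : l 0 ≠ 0) (n : ℕ) : l n ≠ 0 := by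
  intro hn
  have h' : IsTorsionSeq t (fun _ => (0 : A)) := ⟨by simp, by simp⟩
  have := h.eq_add h' (j := 0) hn (14 * n)
  rw [show n + 14 * n = 0 + 15 * n by ring, h.add_mul_fifteen] at this
  exact h0 this

theorem IsTorsionSeq.not_periodic (h0 : l 0 ≠ 0) {b : ℕ} (hb0 : 0 < b) (hb : b < 15) :
    ∃ n, l (n + b) ≠ l n := by
  by_contra! hp
  have hpk : ∀ k n, l (n + b * k) = l n := by
    intro k n
    induction k with
    | zero => rfl
    | succ k ih => rw [Nat.mul_succ, ← add_assoc, hp, ih]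
  have hk : ∃ k, b * k % 15 = 1 ∨ b * k % 15 = 3 ∨ b * k % 15 = 5 := by
    have : ∀ b : Fin 15, b ≠ 0 → ∃ k : Fin 15, b.val * k.val % 15 = 1 ∨ b.val * k.val % 15 = 3 ∨
      b.val * k.val % 15 = 5 := by decide
    obtain ⟨k, hk⟩ := this ⟨b, hb⟩ (by intro h; simp [Fin.ext_iff] at h; omega)
    exact ⟨k, hk⟩
  obtain ⟨k, hk⟩ := hk
  have hr : ∀ n, l (n + b * k % 15) = l n := by
    intro n
    have := hpk k n
    rw [← Nat.mod_add_div (b * k) 15, ← add_assoc, h.add_mul_fifteen] at this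
    exact this
  have h4 := h.rel 0
  have h5 := h.add_five 0
  have h10 := h.add_ten 0
  apply h0
  rcases hk with hk | hk | hk <;> rw [hk] at hr
  · have e1 := hr 0
    have e2 := hr 1
    have e3 := hr 2
    have e4 := hr 3
    norm_num at *
    grind
  · have e1 := hr 1
    norm_num at *
    grind
  · have e1 := hr 0
    have e2 := hr 5
    norm_num at *
    grind

theorem IsTorsionSeq.injOn (h0 : l 0 ≠ 0) : Set.InjOn l (Set.Iio 15) := by
  have key : ∀ i j, i < j → j < 15 → l i ≠ l j := by
    intro i j hij hj he
    obtain ⟨n, hn⟩ := h.not_periodic h0 (b := j - i) (by omega) (by omega)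
    apply hn
    have h1 := h.eq_add h he (14 * i + n)
    rw [show i + (14 * i + n) = n + 15 * i by ring,
      show j + (14 * i + n) = n + (j - i) + 15 * i by omega, h.add_mul_fifteen,
      h.add_mul_fifteen] at h1
    exact h1.symm
  intro i hi j hj he
  rcases lt_trichotomy i j with h1 | h1 | h1
  · exact absurd he (key i j h1 hj)
  · exact h1
  · exact absurd he.symm (key j i h1 hi)

end Sequence

theorem exists_carlitzSeq_eq {y z : Omega2} (hy : y ∈ (carlitz M0).rootSet Omega2) (hy0 : y ≠ 0)
    (hz : z ∈ (carlitz M0).rootSet Omega2) (hz0 : z ≠ 0) : ∃ b, b < 15 ∧ z = carlitzSeq y b := by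
  have h := mem_rootSet_carlitz.1 hy
  have hsub : insert 0 ((Finset.range 15).image (carlitzSeq y)) ⊆
      ((carlitz M0).rootSet Omega2).toFinset := by
    intro x hx
    rw [Set.mem_toFinset]
    rw [Finset.mem_insert, Finset.mem_image] at hx
    rcases hx with rfl | ⟨b, hb, rfl⟩
    · rw [mem_rootSet_carlitz]
      have : carlitzSeq 0 = fun _ => 0 := by
        ext n
        induction n with
        | zero => rfl
        | succ n ih => rw [carlitzSeq, ih]; simp
      rw [this]
      exact ⟨by simp, by simp⟩
    · rw [mem_rootSet_carlitz]
      have : carlitzSeq (carlitzSeq y b) = fun n => carlitzSeq y (b + n) := by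
        ext n
        induction n with
        | zero => rfl
        | succ n ih => rw [carlitzSeq, ih]; rfl
      rw [this]
      exact ⟨fun i => rfl, fun i => h.rel (b + i)⟩
  have hcard : ((carlitz M0).rootSet Omega2).toFinset.card ≤
      (insert 0 ((Finset.range 15).image (carlitzSeq y))).card := by
    rw [Set.toFinset_card, card_rootSet_carlitz, Finset.card_insert_of_notMem,
      Finset.card_image_of_injOn, Finset.card_range]
    · intro i hi j hj
      exact h.injOn hy0 (by simpa using hi) (by simpa using hj)
    · rw [Finset.mem_image]
      rintro ⟨b, -, hb⟩
      exact h.ne_zero hy0 b hb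
  have heq := Finset.eq_of_subset_of_card_le hsub hcard
  have hzm : z ∈ ((carlitz M0).rootSet Omega2).toFinset := Set.mem_toFinset.2 hz
  rw [← heq, Finset.mem_insert, Finset.mem_image] at hzm
  rcases hzm with rfl | ⟨b, hb, rfl⟩
  · exact absurd rfl hz0
  · exact ⟨b, Finset.mem_range.1 hb, rfl⟩

end CarlitzTorsion

section ValuationRings

open IsLocalRing Polynomial

/-- Valuation rings extend to overfields. -/
theorem exists_comap_eq {k K : Type*} [Field k] [Field K] (f : k →+* K) (P : ValuationSubring k) :
    ∃ V : ValuationSubring K, V.comap f = P := by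
  obtain ⟨V, h, hloc⟩ := IsLocalRing.exists_factor_valuationRing (f.comp P.subtype)
  refine ⟨V, le_antisymm (fun x hx => ?_) (fun x hx => h ⟨x, hx⟩)⟩
  by_contra hxP
  have hx0 : x ≠ 0 := fun h0 => hxP (h0 ▸ P.zero_mem)
  have hxi := (P.mem_or_inv_mem x).resolve_left hxP
  have hu : IsUnit (⟨x⁻¹, hxi⟩ : P) := by
    apply hloc.map_nonunit
    refine IsUnit.of_mul_eq_one (⟨f x, hx⟩ : V) (Subtype.ext ?_)
    change f x⁻¹ * f x = 1
    rw [← map_mul, inv_mul_cancel₀ hx0, map_one]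
  obtain ⟨y, hy⟩ := hu.exists_right_inv
  have hy' : x⁻¹ * (y : k) = 1 := congrArg Subtype.val hy
  have : (y : k) = x := by
    rw [← mul_one x, ← hy', mul_inv_cancel_left₀ hx0]
  exact hxP (this ▸ y.2)

theorem nonunits_of_comap_eq {k K : Type*} [Field k] [Field K] {f : k →+* K}
    {P : ValuationSubring k} {V : ValuationSubring K} (h : V.comap f = P) (x : k) :
    f x ∈ V.nonunits ↔ x ∈ P.nonunits := by
  rw [ValuationSubring.mem_nonunits_iff_or, ValuationSubring.mem_nonunits_iff_or, map_eq_zero,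
    ← map_inv₀, ← h]
  rfl

variable {K : Type*} [Field K] (V : ValuationSubring K)

theorem residue_eq_zero_iff_mem_nonunits (x : V) : residue V x = 0 ↔ (x : K) ∈ V.nonunits := by
  rw [residue_eq_zero_iff, ValuationSubring.mem_nonunits_iff_exists_mem_maximalIdeal]
  exact ⟨fun h => ⟨x.2, h⟩, fun ⟨_, h⟩ => h⟩

theorem mem_of_recursion {y : ℕ → K} {c d : K} {n : ℕ} (hn : 0 < n) (hc0 : c ≠ 0) (hc : c⁻¹ ∈ V)
    (hd : d ∈ V) (hp : ∀ i, y (i + n) = y i) (hr : ∀ i, y (i + 1) = c * (y i * (y i + d))) (i : ℕ) :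
    y i ∈ V := by
  have hc1 : 1 ≤ V.valuation c := by
    rw [← V.valuation_le_one_iff, map_inv₀] at hc
    exact (inv_le_one₀ (zero_lt_iff.2 ((_root_.map_ne_zero _).2 hc0))).1 hc
  rw [← V.valuation_le_one_iff] at hd
  rw [← V.valuation_le_one_iff]
  by_contra! hi
  have step : ∀ j, 1 < V.valuation (y j) → V.valuation (y j) < V.valuation (y (j + 1)) := by
    intro j hj
    have h0 : 0 < V.valuation (y j) := zero_lt_one.trans hj
    have hadd : V.valuation (y j + d) = V.valuation (y j) :=
      Valuation.map_add_eq_of_lt_left _ (hd.trans_lt hj)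
    rw [hr, map_mul, map_mul, hadd]
    calc V.valuation (y j) = 1 * (V.valuation (y j) * 1) := by simp
      _ < 1 * (V.valuation (y j) * V.valuation (y j)) := by
        rw [one_mul, one_mul]; exact mul_lt_mul_of_pos_left hj h0
      _ ≤ _ := mul_le_mul_left hc1 _
  have mono : ∀ m, V.valuation (y i) < V.valuation (y (i + (m + 1))) := by
    intro m
    induction m with
    | zero => exact step i hi
    | succ m ih => exact ih.trans (step _ (hi.trans ih))
  obtain ⟨m, rfl⟩ := Nat.exists_eq_succ_of_ne_zero hn.ne'
  have := mono m
  rw [Nat.succ_eq_add_one] at hp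
  rw [hp] at this
  exact this.false

theorem IsNormalGen.mem [CharP K 2] {x : K} (hx : IsNormalGen x) : x ∈ V := by
  rcases V.mem_or_inv_mem x with h | h
  · exact h
  · have h32 := hx.pow_thirtyTwo
    by_cases h0 : x = 0
    · rw [h0]; exact V.zero_mem
    · have : x = x⁻¹ ^ 30 := by
        field_simp
        have h1 : x * (x ^ 31) = x * 1 := by rw [mul_one, ← pow_succ', h32]
        exact mul_left_cancel₀ h0 h1
      rw [this]
      exact pow_mem h _

variable [CharP K 2]

instance charP_valuationSubring : CharP V 2 :=
  CharTwo.of_one_ne_zero_of_two_eq_zero one_ne_zero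
    (Subtype.ext (CharTwo.two_eq_zero : (2 : K) = 0))

theorem charP_residueField : CharP (ResidueField V) 2 := by
  have h : (2 : V) = 0 := CharTwo.two_eq_zero
  have : (2 : ResidueField V) = 0 := by
    rw [← map_ofNat (residue V) 2, h, map_zero]
  exact CharTwo.of_one_ne_zero_of_two_eq_zero one_ne_zero this

variable {t : K} {l : ℕ → K} (hl : IsTorsionSeq t l) {x : K} (hx : IsNormalGen x) {u : ZMod 5}
  (hu : u ≠ 0)

include hl in
theorem IsTorsionSeq.mem (ht : t ∈ V) (i : ℕ) : l i ∈ V :=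
  mem_of_recursion V (c := 1) (d := t) (n := 15) (by norm_num) one_ne_zero
    (by rw [inv_one]; exact V.one_mem) ht hl.add_fifteen (fun i => by rw [hl.succ]; ring) i

omit [CharP K 2] in
include hl in
theorem IsTorsionSeq.exists_lift (ht : t ∈ V) (hm : ∀ i, l i ∈ V) :
    IsTorsionSeq (⟨t, ht⟩ : V) (fun i => ⟨l i, hm i⟩) :=
  ⟨fun i => Subtype.ext (hl.succ i), fun i => Subtype.ext (hl.rel i)⟩

omit [CharP K 2] in
theorem coe_twist_torsionNorm {l' : ℕ → V} {x' : V} (hll : ∀ i, (l' i : K) = l i)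
    (hxx : (x' : K) = x) (i : ZMod 5) :
    ((twist u x' (torsionNorm l') i : V) : K) = twist u x (torsionNorm l) i := by
  have := map_twist V.subtype u x' (torsionNorm l') i
  refine this.trans ?_
  congr 1
  funext j
  refine (map_torsionNorm V.subtype l' j).trans ?_
  exact congrFun (congrArg torsionNorm (funext hll)) j

omit [CharP K 2] in
theorem residue_twist_torsionNorm (l' : ℕ → V) (x' : V) (i : ZMod 5) :
    residue V (twist u x' (torsionNorm l') i) =
      twist u (residue V x') (torsionNorm (residue V ∘ l')) i := by
  rw [map_twist]
  congr 1

include hl hx in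
theorem twist_mem (ht : t ∈ V) (i : ZMod 5) : twist u x (torsionNorm l) i ∈ V := by
  rw [← coe_twist_torsionNorm V (l' := fun i => ⟨l i, hl.mem V ht i⟩) (x' := ⟨x, hx.mem V⟩)
    (fun _ => rfl) rfl]
  exact Subtype.prop _

include hl hx in
theorem twist_mem_nonunits (ht : t ∈ V) (hM : t ^ 4 + t + 1 ∈ V.nonunits) (i : ZMod 5) :
    twist u x (torsionNorm l) i ∈ V.nonunits := by
  have := charP_residueField V
  have hl' := (hl.exists_lift V ht (hl.mem V ht)).map (residue V)
  have h0 : ∀ i, (residue V ∘ fun i => (⟨l i, hl.mem V ht i⟩ : V)) i = 0 := fun i =>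
    eq_zero_of_pow_eq_zero (hl'.pow_sixteen_of_root
      ((residue_eq_zero_iff_mem_nonunits V (⟨t, ht⟩ ^ 4 + ⟨t, ht⟩ + 1)).2 hM) i)
  rw [← coe_twist_torsionNorm V (l' := fun i => ⟨l i, hl.mem V ht i⟩) (x' := ⟨x, hx.mem V⟩)
    (fun _ => rfl) rfl, ← residue_eq_zero_iff_mem_nonunits, residue_twist_torsionNorm]
  have h1 : (residue V ∘ fun i => (⟨l i, hl.mem V ht i⟩ : V)) = fun _ => 0 := funext h0
  rw [h1]
  simp [twist, torsionNorm]

include hl hx hu in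
/-- The Frobenius at a finite place shifts the twisted sums. -/
theorem twist_frobenius (ht : t ∈ V) {n b : ℕ}
    (hb : ∀ l' : ℕ → ResidueField V, IsTorsionSeq (residue V ⟨t, ht⟩) l' →
      ∀ i, l' i ^ 2 ^ n = l' (i + b)) (i : ZMod 5) :
    twist u x (torsionNorm l) i ^ 2 ^ n - twist u x (torsionNorm l) (i + (u⁻¹ * n - b)) ∈
      V.nonunits := by
  have := charP_residueField V
  have hl' := (hl.exists_lift V ht (hl.mem V ht)).map (residue V)
  have hx' : IsNormalGen (residue V ⟨x, hx.mem V⟩) := by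
    have : IsNormalGen (⟨x, hx.mem V⟩ : V) := Subtype.ext hx
    exact this.map _
  have key := hx'.twist_pow hu (hl'.torsionNorm_pow (hb _ hl')) i
  rw [← residue_twist_torsionNorm, ← residue_twist_torsionNorm, ← map_pow, ← sub_eq_zero, ← map_sub,
    residue_eq_zero_iff_mem_nonunits] at key
  rw [← coe_twist_torsionNorm V (l' := fun i => ⟨l i, hl.mem V ht i⟩) (x' := ⟨x, hx.mem V⟩)
    (fun _ => rfl) rfl, ← coe_twist_torsionNorm V (l' := fun i => ⟨l i, hl.mem V ht i⟩)
    (x' := ⟨x, hx.mem V⟩) (fun _ => rfl) rfl]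
  exact key

/-- An element of a valuation ring which is idempotent in the residue field. -/
def IsResiduallyIdempotent (z : K) : Prop := ∃ h : z ∈ V, residue V ⟨z, h⟩ ^ 2 = residue V ⟨z, h⟩

omit [CharP K 2] in
variable {V} in
theorem IsResiduallyIdempotent.mul {y z : K} (hy : IsResiduallyIdempotent V y)
    (hz : IsResiduallyIdempotent V z) : IsResiduallyIdempotent V (y * z) := by
  obtain ⟨hy, h1⟩ := hy
  obtain ⟨hz, h2⟩ := hz
  refine ⟨mul_mem hy hz, ?_⟩
  have : (⟨y * z, mul_mem hy hz⟩ : V) = ⟨y, hy⟩ * ⟨z, hz⟩ := rfl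
  rw [this, map_mul, mul_pow, h1, h2]

include hl in
theorem isResiduallyIdempotent_torsionNorm (ht : t ∉ V) (j : ZMod 5) :
    IsResiduallyIdempotent V ((t ^ 2)⁻¹ * torsionNorm l j) := by
  have := charP_residueField V
  have ht0 : t ≠ 0 := fun h => ht (h ▸ V.zero_mem)
  have hti := (V.mem_or_inv_mem t).resolve_left ht
  have hr : ∀ i, t⁻¹ * l (i + 1) = t * (t⁻¹ * l i * (t⁻¹ * l i + 1)) := by
    intro i
    rw [hl.succ]
    field_simp
  have hy : ∀ i, t⁻¹ * l i ∈ V :=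
    mem_of_recursion V (y := fun i => t⁻¹ * l i) (c := t) (d := 1) (n := 15) (by norm_num) ht0 hti
      V.one_mem (fun i => by rw [hl.add_fifteen]) hr
  have htr : residue V ⟨t⁻¹, hti⟩ = 0 := by
    rw [residue_eq_zero_iff_mem_nonunits, ValuationSubring.mem_nonunits_iff_or, inv_inv]
    exact Or.inr ht
  have hz : ∀ i, residue V ⟨_, hy i⟩ ^ 2 = residue V ⟨_, hy i⟩ := by
    intro i
    have : (⟨_, hy i⟩ : V) ^ 2 = ⟨_, hti⟩ * ⟨_, hy (i + 1)⟩ - ⟨_, hy i⟩ := by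
      apply Subtype.ext
      change (t⁻¹ * l i) ^ 2 = t⁻¹ * (t⁻¹ * l (i + 1)) - t⁻¹ * l i
      rw [hr, inv_mul_cancel_left₀ ht0]
      ring
    rw [← map_pow, this, map_sub, map_mul, htr, zero_mul, zero_sub, CharTwo.neg_eq]
  have hid : ∀ i, IsResiduallyIdempotent V (t⁻¹ * l i) := fun i => ⟨hy i, hz i⟩
  have hlift : ∀ i, residue V ⟨_, hy i⟩ = 0 → IsResiduallyIdempotent V (l i) := by
    intro i hi
    have hu : residue V (⟨_, hy i⟩ + 1) = 1 := by rw [map_add, hi, map_one, zero_add]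
    have hun : IsUnit ((⟨_, hy i⟩ : V) + 1) := by
      rw [← residue_ne_zero_iff_isUnit, hu]
      exact one_ne_zero
    obtain ⟨q, hq⟩ := hun.exists_right_inv
    have hq' : (t⁻¹ * l i + 1) * q = 1 := congrArg Subtype.val hq
    have hle : l i = ((⟨_, hy (i + 1)⟩ * q : V) : K) := by
      change l i = t⁻¹ * l (i + 1) * q
      rw [hr]
      calc l i = t * t⁻¹ * l i * 1 := by rw [mul_inv_cancel₀ ht0, one_mul, mul_one]
        _ = t * t⁻¹ * l i * ((t⁻¹ * l i + 1) * q) := by rw [hq']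
        _ = _ := by ring
    rw [hle]
    refine ⟨Subtype.prop _, ?_⟩
    have hqr : residue V q = 1 := by
      have := congrArg (residue V) hq
      rwa [map_mul, hu, one_mul, map_one] at this
    change residue V (_ * q) ^ 2 = residue V (_ * q)
    rw [map_mul, hqr, mul_one, hz]
  have hsum : residue V ⟨_, hy j.val⟩ + residue V ⟨_, hy (j.val + 5)⟩ +
      residue V ⟨_, hy (j.val + 10)⟩ = 0 := by
    rw [← map_add, ← map_add, ← map_zero (residue V)]
    congr 1
    apply Subtype.ext
    change t⁻¹ * l j.val + t⁻¹ * l (j.val + 5) + t⁻¹ * l (j.val + 10) = 0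
    rw [hl.add_ten, hl.add_five]
    grind
  have h01 : ∀ i, residue V ⟨_, hy i⟩ = 0 ∨ residue V ⟨_, hy i⟩ = 1 := by
    intro i
    have h : residue V ⟨_, hy i⟩ * (residue V ⟨_, hy i⟩ - 1) = 0 := by
      rw [mul_sub, mul_one, ← pow_two, hz, sub_self]
    rcases mul_eq_zero.1 h with h | h
    · exact Or.inl h
    · exact Or.inr (sub_eq_zero.1 h)
  have e0 : (t ^ 2)⁻¹ * torsionNorm l j =
      l j.val * (t⁻¹ * l (j.val + 5)) * (t⁻¹ * l (j.val + 10)) := by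
    rw [torsionNorm]; field_simp
  have e1 : (t ^ 2)⁻¹ * torsionNorm l j =
      (t⁻¹ * l j.val) * l (j.val + 5) * (t⁻¹ * l (j.val + 10)) := by
    rw [torsionNorm]; field_simp
  have e2 : (t ^ 2)⁻¹ * torsionNorm l j =
      (t⁻¹ * l j.val) * (t⁻¹ * l (j.val + 5)) * l (j.val + 10) := by
    rw [torsionNorm]; field_simp
  rcases h01 j.val with h0 | h0
  · rw [e0]; exact ((hlift _ h0).mul (hid _)).mul (hid _)
  rcases h01 (j.val + 5) with h1 | h1
  · rw [e1]; exact ((hid _).mul (hlift _ h1)).mul (hid _)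
  rcases h01 (j.val + 10) with h2 | h2
  · rw [e2]; exact ((hid _).mul (hid _)).mul (hlift _ h2)
  rw [h0, h1, h2, CharTwo.add_self_eq_zero, zero_add] at hsum
  exact absurd hsum one_ne_zero

omit [CharP K 2] in
theorem mul_twist {A : Type*} [CommRing A] (u : ZMod 5) (x : A) (c : A) (e : ZMod 5 → A)
    (i : ZMod 5) : c * twist u x e i = twist u x (fun j => c * e j) i := by
  simp only [twist, Finset.mul_sum]
  exact Finset.sum_congr rfl fun j _ => by ring

include hl hx in
theorem twist_mem_infty (ht : t ∉ V) (i : ZMod 5) :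
    (t ^ 2)⁻¹ * twist u x (torsionNorm l) i ∈ V := by
  rw [mul_twist]
  exact sum_mem fun j _ => mul_mem (pow_mem (hx.mem V) _)
    (isResiduallyIdempotent_torsionNorm V hl ht j).1

include hl hx hu in
/-- The Frobenius at an infinite place shifts the twisted sums. -/
theorem twist_frobenius_infty (ht : t ∉ V) (i : ZMod 5) :
    ((t ^ 2)⁻¹ * twist u x (torsionNorm l) i) ^ 2 -
      (t ^ 2)⁻¹ * twist u x (torsionNorm l) (i + u⁻¹) ∈ V.nonunits := by
  have := charP_residueField V
  have hid := isResiduallyIdempotent_torsionNorm V hl ht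
  let e : ZMod 5 → V := fun j => ⟨_, (hid j).1⟩
  have hx1 : IsNormalGen (⟨x, hx.mem V⟩ : V) := Subtype.ext hx
  have hx' : IsNormalGen (residue V ⟨x, hx.mem V⟩) := hx1.map _
  have hcoe : ∀ i, ((twist u ⟨x, hx.mem V⟩ e i : V) : K) =
      (t ^ 2)⁻¹ * twist u x (torsionNorm l) i := by
    intro i
    rw [mul_twist]
    exact map_twist V.subtype u _ e i
  have he : ∀ j, (residue V ∘ e) j ^ 2 ^ 1 = (residue V ∘ e) (j + 0) := by
    intro j
    rw [pow_one, add_zero]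
    exact (hid j).2
  have key := hx'.twist_pow hu he i
  rw [← map_twist, ← map_twist, ← map_pow, ← sub_eq_zero, ← map_sub,
    residue_eq_zero_iff_mem_nonunits, Nat.cast_one, mul_one, sub_zero, pow_one] at key
  rw [← hcoe, ← hcoe]
  exact key

end ValuationRings

section GeneratorFamilies

open IsLocalRing Polynomial

/-- `T` in the algebraic closure. -/
abbrev omegaT : Omega2 := algebraMap k2 Omega2 RatFunc.X

theorem algebraMap_polyToRat (g : (ZMod 2)[X]) :
    algebraMap k2 Omega2 (polyToRat g) = aeval omegaT g := by
  rw [omegaT, aeval_algebraMap_apply, polyToRat, ← RatFunc.algebraMap_X, aeval_algebraMap_apply,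
    aeval_X_left_apply]

theorem residue_eq_zero_of_aeval {V : ValuationSubring Omega2} {p : Place (ZMod 2) k2}
    (hV : V.comap (algebraMap k2 Omega2) = p.1) {g : (ZMod 2)[X]}
    (hg : polyToRat g ∈ p.1.nonunits) (z : V) (hz : (z : Omega2) = aeval omegaT g) :
    residue V z = 0 := by
  rw [residue_eq_zero_iff_mem_nonunits, hz, ← algebraMap_polyToRat, nonunits_of_comap_eq hV]
  exact hg

theorem exists_frobenius_shift {V : ValuationSubring Omega2} {p : Place (ZMod 2) k2}
    (hV : V.comap (algebraMap k2 Omega2) = p.1) (hT : omegaT ∈ V)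
    (hd : placeDegree (ZMod 2) p ≤ 4) (hM : polyToRat M0 ∉ p.1.nonunits) :
    ∃ b : ℕ, (∀ l : ℕ → ResidueField V, IsTorsionSeq (residue V ⟨omegaT, hT⟩) l →
      ∀ i, l i ^ 2 ^ placeDegree (ZMod 2) p = l (i + b)) ∧
      ((placeDegree (ZMod 2) p : ℕ) : ZMod 5) ≠ 2 * b ∧
      ((placeDegree (ZMod 2) p : ℕ) : ZMod 5) ≠ 3 * b := by
  have := charP_residueField V
  have hX : RatFunc.X ∈ p.1 := by rw [← hV]; exact hT
  let s : V := ⟨omegaT, hT⟩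
  have key : ∀ {g : (ZMod 2)[X]}, polyToRat g ∈ p.1.nonunits → ∀ z : V,
      (z : Omega2) = aeval omegaT g → residue V z = 0 :=
    fun hg z hz => residue_eq_zero_of_aeval hV hg z hz
  rcases finitePlace_cases p hX hd with ⟨hn, h | h⟩ | ⟨hn, h⟩ | ⟨hn, h | h⟩ | ⟨hn, h | h | h⟩
  all_goals rw [hn]
  · exact ⟨1, fun l hl => hl.frobenius_X (key h s (by simp [s])), by decide⟩
  · refine ⟨4, fun l hl => hl.frobenius_X_add_one ?_, by decide⟩
    exact key h (s + 1) (by simp [s])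
  · refine ⟨10, fun l hl => hl.frobenius_deg_two ?_, by decide⟩
    exact key h (s ^ 2 + s + 1) (by simp [s])
  · refine ⟨7, fun l hl => hl.frobenius_deg_three ?_, by decide⟩
    exact key h (s ^ 3 + s + 1) (by simp [s])
  · refine ⟨13, fun l hl => hl.frobenius_deg_three' ?_, by decide⟩
    exact key h (s ^ 3 + s ^ 2 + 1) (by simp [s])
  · exact absurd h hM
  · refine ⟨9, fun l hl => hl.frobenius_deg_four ?_, by decide⟩
    exact key h (s ^ 4 + s ^ 3 + 1) (by simp [s])
  · refine ⟨6, fun l hl => hl.frobenius_deg_four' ?_, by decide⟩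
    exact key h (s ^ 4 + s ^ 3 + s ^ 2 + s + 1) (by simp [s])

/-- The generators of the quintic subfields attached to a torsion point `y` and a normal
generator `x` of `𝔽₃₂`. -/
def generator (y x : Omega2) (u i : ZMod 5) : Omega2 := twist u x (torsionNorm (carlitzSeq y)) i

variable {y x : Omega2} (hy : IsTorsionSeq omegaT (carlitzSeq y)) (hy0 : y ≠ 0)
  (hx : IsNormalGen x) {u : ZMod 5} (hu : u ≠ 0)

include hy hx hu in
theorem sum_generator : ∑ i, generator y x u i = 0 :=
  (hx.sum_twist hu _).trans hy.sum_torsionNorm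

include hy hx hu hy0 in
theorem gram_one_generator : ∑ i, generator y x u i * generator y x u (i + 1) =
    algebraMap k2 Omega2 (polyToRat M0) := by
  refine (hx.gram_twist hu _ 1).trans ?_
  have := hy.gram_one_mul
  rw [mul_right_inj' (show carlitzSeq y 0 ≠ 0 from hy0)] at this
  rw [this, polyToRat_M0]
  simp

include hy hx hu in
theorem gram_two_generator : ∑ i, generator y x u i * generator y x u (i + 2) = 0 :=
  (hx.gram_twist hu _ 2).trans hy.gram_two

variable {R : IntermediateField k2 Omega2} {w : ZMod 5 → R}
  (hw : ∀ i, (w i : Omega2) = generator y x u i)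

include hy hy0 hx hu hw in
theorem isCyclicFamily_of_coe_eq (σ : R ≃ₐ[k2] R) (hσ : ∀ i, σ (w i) = w (i + 1)) :
    IsCyclicFamily w where
  exists_aut := ⟨σ, hσ⟩
  sum_eq := by
    apply Subtype.val_injective
    refine Eq.trans ?_ (sum_generator hy hx hu)
    simp [hw]
  gram_one := by
    apply Subtype.val_injective
    refine Eq.trans ?_ (gram_one_generator hy hy0 hx hu)
    simp [hw]
  gram_two := by
    apply Subtype.val_injective
    refine Eq.trans ?_ (gram_two_generator hy hx hu)
    simp [hw]
  mem := fun P hP i => by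
    obtain ⟨V, hV⟩ := exists_comap_eq (algebraMap R Omega2) P.1
    rw [← hV] at hP ⊢
    change (w i : Omega2) ∈ V
    rw [hw]
    exact twist_mem V hy hx hP i
  nonunit := fun P hP hM i => by
    obtain ⟨V, hV⟩ := exists_comap_eq (algebraMap R Omega2) P.1
    rw [← nonunits_of_comap_eq hV] at hM ⊢
    rw [← hV] at hP
    change (w i : Omega2) ∈ _
    rw [hw]
    refine twist_mem_nonunits V hy hx hP ?_ i
    rw [← IsScalarTower.algebraMap_apply, polyToRat_M0] at hM
    simpa using hM
  mem_infty := fun P hP i => by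
    obtain ⟨V, hV⟩ := exists_comap_eq (algebraMap R Omega2) P.1
    rw [← hV] at hP ⊢
    have := twist_mem_infty V hy hx (u := u) hP i
    change algebraMap R Omega2 ((algebraMap k2 R RatFunc.X ^ 2)⁻¹ * w i) ∈ V
    rw [map_mul, map_inv₀, map_pow, ← IsScalarTower.algebraMap_apply]
    change _ * (w i : Omega2) ∈ V
    rw [hw]
    exact this

include hy hx hw in
theorem hasShiftFrobenius_of_coe_eq (hu : u = 2 ∨ u = 3) : HasShiftFrobenius w where
  finite := fun p P hP hX hd hM => by
    have : Fact (Nat.Prime 5) := ⟨by norm_num⟩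
    have hu0 : u ≠ 0 := by rcases hu with rfl | rfl <;> exact of_decide_eq_true rfl
    obtain ⟨V, hV⟩ := exists_comap_eq (algebraMap R Omega2) P.1
    have hVp : V.comap (algebraMap k2 Omega2) = p.1 := by
      rw [← hP, ← hV]; rfl
    have hT : omegaT ∈ V := by rw [← hVp] at hX; exact hX
    obtain ⟨b, hb, h2, h3⟩ := exists_frobenius_shift hVp hT hd hM
    refine ⟨u⁻¹ * (placeDegree (ZMod 2) p : ℕ) - b, ?_, fun i => ?_⟩
    · intro h
      rw [sub_eq_zero, inv_mul_eq_iff_eq_mul₀ hu0] at h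
      rcases hu with rfl | rfl
      · exact h2 h
      · exact h3 h
    · have := twist_frobenius V hy hx hu0 hT hb i
      rw [← nonunits_of_comap_eq hV, map_sub, map_pow]
      change (w _ : Omega2) ^ _ - (w _ : Omega2) ∈ _
      rw [hw, hw]
      exact this
  infinite := fun P hP => by
    have : Fact (Nat.Prime 5) := ⟨by norm_num⟩
    have hu0 : u ≠ 0 := by rcases hu with rfl | rfl <;> exact of_decide_eq_true rfl
    obtain ⟨V, hV⟩ := exists_comap_eq (algebraMap R Omega2) P.1
    refine ⟨u⁻¹, inv_ne_zero hu0, fun i => ?_⟩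
    rw [← hV] at hP
    have := twist_frobenius_infty V hy hx hu0 hP i
    rw [← nonunits_of_comap_eq hV, map_sub, map_pow, map_mul, map_mul, map_inv₀, map_pow,
      ← IsScalarTower.algebraMap_apply]
    change (_ * (w _ : Omega2)) ^ _ - _ * (w _ : Omega2) ∈ _
    rw [hw, hw]
    exact this

end GeneratorFamilies

section GaloisAction

open IsLocalRing Polynomial

/-- Elements fixed by all automorphisms over an intermediate field lie in that field, if they are
separable. -/
theorem mem_of_fixed {F : IntermediateField k2 Omega2} {z : Omega2} (hz : IsSeparable k2 z)
    (h : ∀ τ : Omega2 ≃ₐ[k2] Omega2, (∀ a ∈ F, τ a = a) → τ z = z) : z ∈ F := by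
  by_contra hF
  have hsep : IsSeparable F z := IsSeparable.tower_top F hz
  have hb : z ∉ (⊥ : Subalgebra F Omega2) := by
    rw [Algebra.mem_bot]
    rintro ⟨a, rfl⟩
    exact hF a.2
  obtain ⟨y, hne, hconj⟩ := (notMem_iff_exists_ne_and_isConjRoot hsep
    (IsAlgClosed.splits _)).1 hb
  obtain ⟨σ, hσ⟩ := isConjRoot_iff_exists_algEquiv.1 hconj.symm
  have := h (σ.restrictScalars k2) (fun a ha => σ.commutes ⟨a, ha⟩)
  exact hne (this.symm.trans hσ)

/-- The action of an automorphism on the torsion norms and on the normal basis. -/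
structure ActsBy (y x : Omega2) (τ : Omega2 ≃ₐ[k2] Omega2) (a c : ZMod 5) : Prop where
  torsion : ∀ j, τ (torsionNorm (carlitzSeq y) j) = torsionNorm (carlitzSeq y) (j + a)
  const : ∀ i, τ (conjSeq x i) = conjSeq x (i + c)

variable {y x : Omega2}

theorem map_carlitzSeq (τ : Omega2 ≃ₐ[k2] Omega2) (n : ℕ) :
    τ (carlitzSeq y n) = carlitzSeq (τ y) n := by
  induction n with
  | zero => rfl
  | succ n ih => rw [carlitzSeq, carlitzSeq, map_add, map_pow, map_mul, τ.commutes, ih]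

theorem carlitzSeq_add (b n : ℕ) : carlitzSeq (carlitzSeq y b) n = carlitzSeq y (b + n) := by
  induction n with
  | zero => rfl
  | succ n ih => rw [carlitzSeq, ih]; rfl

theorem exists_map_torsion (hy : IsTorsionSeq omegaT (carlitzSeq y)) (hy0 : y ≠ 0)
    (τ : Omega2 ≃ₐ[k2] Omega2) : ∃ b < 15, τ y = carlitzSeq y b := by
  refine exists_carlitzSeq_eq (mem_rootSet_carlitz.2 hy) hy0 ?_ (by simpa using hy0)
  have := hy.map (τ : Omega2 →+* Omega2)
  rw [mem_rootSet_carlitz]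
  convert this using 1
  · exact (τ.commutes _).symm
  · exact funext fun n => (map_carlitzSeq τ n).symm

theorem map_torsionNorm_of_map (hy : IsTorsionSeq omegaT (carlitzSeq y))
    {τ : Omega2 ≃ₐ[k2] Omega2} {b : ℕ} (hb : τ y = carlitzSeq y b) (j : ZMod 5) :
    τ (torsionNorm (carlitzSeq y) j) = torsionNorm (carlitzSeq y) (j + b) := by
  have h1 := hy.torsionNorm_natCast (j.val + b)
  rw [Nat.cast_add, ZMod.natCast_zmod_val] at h1
  rw [h1, torsionNorm]
  simp only [map_mul, map_carlitzSeq, hb, carlitzSeq_add]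
  rw [show j.val + b = b + j.val from add_comm _ _, add_assoc b, add_assoc b]

theorem IsNormalGen.eq_conjSeq (hx : IsNormalGen x) {z : Omega2} (hz : IsNormalGen z) :
    ∃ c, z = conjSeq x c := by
  have hprod : ∏ i, (z - conjSeq x i) = 0 := by
    obtain ⟨h0, h1, h2, h3, h4⟩ := hx.conjSeq_expand
    have hx' : x ^ 5 + x ^ 4 + x ^ 2 + x + 1 = 0 := hx
    have hz' : z ^ 5 + z ^ 4 + z ^ 2 + z + 1 = 0 := hz
    have : ∏ i, (z - conjSeq x i) = (z - conjSeq x 0) * (z - conjSeq x 1) * (z - conjSeq x 2) *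
      (z - conjSeq x 3) * (z - conjSeq x 4) := Fin.prod_univ_five (fun i => z - conjSeq x i)
    rw [this, h0, h1, h2, h3, h4]
    clear this h0 h1 h2 h3 h4 hx hz
    have h8 : x ^ 8 = x ^ 3 + x := by grind
    have h16 : x ^ 16 = x ^ 4 + x ^ 3 + x ^ 2 + 1 := by grind
    rw [h8, h16]
    grind
  obtain ⟨c, -, hc⟩ := Finset.prod_eq_zero_iff.1 hprod
  exact ⟨c, sub_eq_zero.1 hc⟩

theorem exists_actsBy (hy : IsTorsionSeq omegaT (carlitzSeq y)) (hy0 : y ≠ 0)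
    (hx : IsNormalGen x) (τ : Omega2 ≃ₐ[k2] Omega2) : ∃ a c, ActsBy y x τ a c := by
  obtain ⟨b, -, hb⟩ := exists_map_torsion hy hy0 τ
  obtain ⟨c, hc⟩ := hx.eq_conjSeq (hx.map (τ : Omega2 →+* Omega2))
  refine ⟨b, c, map_torsionNorm_of_map hy hb, fun i => ?_⟩
  have hc : τ x = conjSeq x c := hc
  rw [conjSeq, map_pow, hc, hx.conjSeq_pow, ZMod.natCast_zmod_val, add_comm]

theorem ActsBy.trans {τ τ' : Omega2 ≃ₐ[k2] Omega2} {a c a' c' : ZMod 5} (h : ActsBy y x τ a c)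
    (h' : ActsBy y x τ' a' c') : ActsBy y x (τ.trans τ') (a + a') (c + c') :=
  ⟨fun j => by rw [AlgEquiv.trans_apply, h.torsion, h'.torsion, add_assoc],
    fun j => by rw [AlgEquiv.trans_apply, h.const, h'.const, add_assoc]⟩

theorem ActsBy.symm {τ : Omega2 ≃ₐ[k2] Omega2} {a c : ZMod 5} (h : ActsBy y x τ a c) :
    ActsBy y x τ.symm (-a) (-c) :=
  ⟨fun j => by rw [AlgEquiv.symm_apply_eq, h.torsion, neg_add_cancel_right],
    fun j => by rw [AlgEquiv.symm_apply_eq, h.const, neg_add_cancel_right]⟩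

theorem ActsBy.refl : ActsBy y x AlgEquiv.refl 0 0 :=
  ⟨fun j => by simp, fun j => by simp⟩

theorem ActsBy.exists_nsmul {τ : Omega2 ≃ₐ[k2] Omega2} {a c : ZMod 5} (h : ActsBy y x τ a c)
    (n : ZMod 5) : ∃ τ' : Omega2 ≃ₐ[k2] Omega2, ActsBy y x τ' (n * a) (n * c) ∧
      ∀ z, τ z = z → τ' z = z := by
  have key : ∀ n : ℕ, ∃ τ' : Omega2 ≃ₐ[k2] Omega2, ActsBy y x τ' (n * a) (n * c) ∧
      ∀ z, τ z = z → τ' z = z := by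
    intro n
    induction n with
    | zero => exact ⟨AlgEquiv.refl, by simpa using ActsBy.refl, fun _ _ => rfl⟩
    | succ n ih =>
      obtain ⟨τ', h', hf⟩ := ih
      refine ⟨τ'.trans τ, ?_, fun z hz => ?_⟩
      · have := h'.trans h
        rwa [← add_one_mul, ← add_one_mul, ← Nat.cast_succ] at this
      · rw [AlgEquiv.trans_apply, hf z hz, hz]
  have := key n.val
  rwa [ZMod.natCast_zmod_val] at this

theorem ActsBy.generator {τ : Omega2 ≃ₐ[k2] Omega2} {a c u : ZMod 5}
    (hu : u ≠ 0) (h : ActsBy y x τ a c) (i : ZMod 5) :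
    τ (generator y x u i) = generator y x u (i + (-a + u⁻¹ * c)) := by
  have : Fact (Nat.Prime 5) := ⟨by norm_num⟩
  rw [CFF.generator, twist, map_sum, CFF.generator, twist]
  refine Fintype.sum_equiv (Equiv.addRight a) _ _ fun j => ?_
  rw [map_mul, h.torsion, h.const, Equiv.coe_addRight]
  congr 2
  field_simp
  ring

theorem ordAt_M0 {p : Place (ZMod 2) k2} (hp : IsFinitePlaceOf p.1 M0) :
    ordAt p.1 (polyToRat M0) = 1 := by
  obtain ⟨hX, hM⟩ := (isFinitePlaceOf_M0_iff p).1 hp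
  obtain ⟨π, hπ, h1, h2, -, h3, -⟩ := finitePlace_exists_irreducible p hX
  obtain ⟨c, hc⟩ := (h1 M0).1 hM
  have hc0 : c ≠ 0 := by rintro rfl; exact M0_ne_zero (by rw [hc, mul_zero])
  have hd := congrArg natDegree hc
  rw [natDegree_mul hπ.ne_zero hc0, natDegree_M0, ← h3, placeDegree_of_M0 p hp] at hd
  have hc1 : c = 1 := by
    have h4 := eq_C_of_natDegree_eq_zero (by omega : c.natDegree = 0)
    have h5 : ∀ a : ZMod 2, a ≠ 0 → a = 1 := by decide
    have h6 : c.coeff 0 = 1 := h5 _ fun h => hc0 (by rw [h4, h, C_0])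
    rw [h4, h6, C_1]
  rw [hc1, mul_one] at hc
  rw [hc]
  exact h2

theorem gram_ne_M0 {p : Place (ZMod 2) k2} (hp : IsFinitePlaceOf p.1 M0) {z : ZMod 5 → k2}
    (hz : ∀ i, z i ∈ p.1.nonunits) : ∑ i, z i * z (i + 1) ≠ polyToRat M0 := by
  intro h
  have hM0 := polyToRat_M0_ne_zero
  have hdiv : ∀ i, (polyToRat M0)⁻¹ * z i ∈ p.1 := by
    intro i
    by_cases h0 : z i = 0
    · rw [h0, mul_zero]; exact p.1.zero_mem
    · rw [← ordAt_nonneg_iff, ordAt_mul (inv_ne_zero hM0) h0, ordAt_inv hM0, ordAt_M0 hp]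
      have := (mem_nonunits_iff_ordAt_pos h0).1 (hz i)
      omega
  have h1 : (1 : k2) = polyToRat M0 *
      ∑ i, ((polyToRat M0)⁻¹ * z i) * ((polyToRat M0)⁻¹ * z (i + 1)) := by
    have : ∑ i, ((polyToRat M0)⁻¹ * z i) * ((polyToRat M0)⁻¹ * z (i + 1)) =
        ((polyToRat M0)⁻¹) ^ 2 * ∑ i, z i * z (i + 1) := by
      rw [Finset.mul_sum]
      exact Finset.sum_congr rfl fun i _ => by ring
    rw [this, h]
    field_simp
  have hM := ((isFinitePlaceOf_M0_iff p).1 hp).2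
  have hmem : ∑ i, ((polyToRat M0)⁻¹ * z i) * ((polyToRat M0)⁻¹ * z (i + 1)) ∈ p.1 :=
    sum_mem fun i _ => mul_mem (hdiv i) (hdiv _)
  rw [ValuationSubring.mem_nonunits_iff_or] at hM
  rcases hM with hM | hM
  · exact hM0 hM
  · apply hM
    rw [← one_mul (polyToRat M0)⁻¹]
    nth_rewrite 1 [h1]
    rw [mul_right_comm, mul_inv_cancel₀ hM0, one_mul]
    exact hmem

end GaloisAction

section Equivariant

open IsLocalRing Polynomial

variable {y x : Omega2}

theorem isSeparable_of_torsion (hy : IsTorsionSeq omegaT (carlitzSeq y)) : IsSeparable k2 y := by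
  have h := mem_rootSet_carlitz.2 hy
  have h1 : aeval y (carlitz M0) = 0 := (mem_rootSet.1 h).2
  exact separable_carlitz_M0.of_dvd (minpoly.dvd _ _ h1)

theorem IsNormalGen.isSeparable (hx : IsNormalGen x) : IsSeparable k2 x := by
  have h1 : aeval x (X ^ 32 - X : k2[X]) = 0 := by
    simp [hx.pow_thirtyTwo]
  refine Separable.of_dvd ?_ (minpoly.dvd _ _ h1)
  have hd : derivative (X ^ 32 - X : k2[X]) = -1 := by
    have h2 : (31 : k2) = -1 := by linear_combination 16 * CharTwo.two_eq_zero (R := k2)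
    simp [h2]
  rw [Separable, hd]
  exact isCoprime_one_right.neg_right

theorem carlitzSeq_mem (F : IntermediateField k2 Omega2) (h : y ∈ F) (n : ℕ) :
    carlitzSeq y n ∈ F := by
  induction n with
  | zero => exact h
  | succ n ih => exact F.add_mem (pow_mem ih 2) (F.mul_mem (F.algebraMap_mem _) ih)

theorem torsionNorm_mem {F : IntermediateField k2 Omega2} (h : y ∈ F) (j : ZMod 5) :
    torsionNorm (carlitzSeq y) j ∈ F :=
  mul_mem (mul_mem (carlitzSeq_mem F h _) (carlitzSeq_mem F h _)) (carlitzSeq_mem F h _)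

theorem generator_mem {F : IntermediateField k2 Omega2}
    (hη : ∀ j, torsionNorm (carlitzSeq y) j ∈ F) (hθ : ∀ i, conjSeq x i ∈ F) (u i : ZMod 5) :
    generator y x u i ∈ F := by
  rw [generator, twist]
  exact sum_mem fun _ _ => mul_mem (hθ _) (hη _)

/-- A family in the compositum on which the automorphisms act by shifts, the shift being a linear
form in the parameters of the automorphism. -/
structure IsEquivariant (y x : Omega2) (α β : ZMod 5) (e : ZMod 5 → Omega2) : Prop where
  isSeparable : ∀ i, IsSeparable k2 (e i)
  map : ∀ {τ a c}, ActsBy y x τ a c → ∀ i, τ (e i) = e (i + (α * a + β * c))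
  notMem : ∃ i, e i ∉ (⊥ : IntermediateField k2 Omega2)

theorem exists_notMem_of_gram {e : ZMod 5 → Omega2} (he : ∀ V : ValuationSubring Omega2,
      omegaT ∈ V → omegaT ^ 4 + omegaT + 1 ∈ V.nonunits → ∀ i, e i ∈ V.nonunits)
    (hg : ∑ i, e i * e (i + 1) = algebraMap k2 Omega2 (polyToRat M0)) :
    ∃ i, e i ∉ (⊥ : IntermediateField k2 Omega2) := by
  by_contra! h
  simp only [IntermediateField.mem_bot] at h
  choose z hz using h
  obtain ⟨m, hm⟩ := exists_place_M0
  obtain ⟨hX, hM⟩ := (isFinitePlaceOf_M0_iff m).1 hm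
  obtain ⟨V, hV⟩ := exists_comap_eq (algebraMap k2 Omega2) m.1
  refine gram_ne_M0 hm (z := z) (fun i => ?_) ?_
  · rw [← nonunits_of_comap_eq hV, hz]
    refine he V ?_ ?_ i
    · rw [← hV] at hX; exact hX
    · rw [← nonunits_of_comap_eq hV, polyToRat_M0] at hM
      simpa using hM
  · apply (algebraMap k2 Omega2).injective
    rw [← hg, map_sum]
    simp [hz]

theorem torsionNorm_mem_nonunits (V : ValuationSubring Omega2) {t : Omega2} {l : ℕ → Omega2}
    (hl : IsTorsionSeq t l) (ht : t ∈ V) (hM : t ^ 4 + t + 1 ∈ V.nonunits) (j : ZMod 5) :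
    torsionNorm l j ∈ V.nonunits := by
  have := charP_residueField V
  have hl' := (hl.exists_lift V ht (hl.mem V ht)).map (residue V)
  have h0 := hl'.pow_sixteen_of_root
      ((residue_eq_zero_iff_mem_nonunits V (⟨t, ht⟩ ^ 4 + ⟨t, ht⟩ + 1)).2 hM) j.val
  have h1 : residue V (⟨l j.val, hl.mem V ht _⟩ * ⟨l (j.val + 5), hl.mem V ht _⟩ *
      ⟨l (j.val + 10), hl.mem V ht _⟩) = 0 := by
    rw [map_mul, map_mul]
    have h2 : residue V ⟨l j.val, hl.mem V ht _⟩ = 0 := eq_zero_of_pow_eq_zero h0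
    rw [h2, zero_mul, zero_mul]
  exact (residue_eq_zero_iff_mem_nonunits V _).1 h1

theorem isEquivariant_torsionNorm (hy : IsTorsionSeq omegaT (carlitzSeq y)) (hy0 : y ≠ 0) :
    IsEquivariant y x 1 0 (torsionNorm (carlitzSeq y)) where
  isSeparable := fun i => mem_separableClosure_iff.1
    (torsionNorm_mem (mem_separableClosure_iff.2 (isSeparable_of_torsion hy)) i)
  map := fun h i => by rw [h.torsion, one_mul, zero_mul, add_zero]
  notMem := by
    refine exists_notMem_of_gram (fun V hT hM => torsionNorm_mem_nonunits V hy hT hM) ?_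
    have := hy.gram_one_mul
    rw [mul_right_inj' (show carlitzSeq y 0 ≠ 0 from hy0)] at this
    rw [this, polyToRat_M0]
    simp

theorem IsNormalGen.conjSeq_mem_separableClosure (hx : IsNormalGen x) (i : ZMod 5) :
    conjSeq x i ∈ separableClosure k2 Omega2 :=
  pow_mem (mem_separableClosure_iff.2 hx.isSeparable) _

theorem IsNormalGen.isEquivariant_conjSeq (hx : IsNormalGen x) :
    IsEquivariant y x 0 1 (conjSeq x) where
  isSeparable := fun i => mem_separableClosure_iff.1 (hx.conjSeq_mem_separableClosure i)
  map := fun h i => by rw [h.const, one_mul, zero_mul, zero_add]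
  notMem := by
    refine ⟨0, fun h => ?_⟩
    rw [IntermediateField.mem_bot] at h
    obtain ⟨z, hz⟩ := h
    rw [hx.conjSeq_expand.1] at hz
    have hz' : IsNormalGen z := by
      apply (algebraMap k2 Omega2).injective
      have : x ^ 5 + x ^ 4 + x ^ 2 + x + 1 = 0 := hx
      simpa [hz] using this
    obtain ⟨p, hp⟩ := exists_infinitePlace
    have h1 : IsNormalGen (⟨z, hz'.mem p.1⟩ : p.1) := Subtype.ext hz'
    have h2 : _ = (0 : ResidueField p.1) := h1.map (residue p.1)
    have := charP_residueField p.1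
    rcases infinitePlace_residue p hp (residue p.1 ⟨z, hz'.mem p.1⟩) with h | h
    · rw [h] at h2; simp at h2
    · rw [h] at h2
      have h3 : (2 : ResidueField p.1) = 0 := CharTwo.two_eq_zero
      apply one_ne_zero (α := ResidueField p.1)
      linear_combination h2 - 2 * h3

theorem isEquivariant_generator (hy : IsTorsionSeq omegaT (carlitzSeq y)) (hy0 : y ≠ 0)
    (hx : IsNormalGen x) {u : ZMod 5} (hu : u ≠ 0) :
    IsEquivariant y x (-1) u⁻¹ (generator y x u) where
  isSeparable := fun i => mem_separableClosure_iff.1 <| generator_mem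
    (torsionNorm_mem (mem_separableClosure_iff.2 (isSeparable_of_torsion hy)))
    hx.conjSeq_mem_separableClosure u i
  map := fun h i => by rw [h.generator hu, neg_one_mul]
  notMem := exists_notMem_of_gram (fun V hT hM => twist_mem_nonunits V hy hx hT hM)
    (gram_one_generator hy hy0 hx hu)

section Family

variable {α β : ZMod 5} {e : ZMod 5 → Omega2} (hy : IsTorsionSeq omegaT (carlitzSeq y))
  (hy0 : y ≠ 0) (hx : IsNormalGen x) (he : IsEquivariant y x α β e)

include hy hy0 hx he

theorem IsEquivariant.exists_shift : ∃ τ a c, ActsBy y x τ a c ∧ α * a + β * c = 1 := by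
  have : Fact (Nat.Prime 5) := ⟨by norm_num⟩
  obtain ⟨i, hi⟩ := he.notMem
  have : ∃ τ a c, ActsBy y x τ a c ∧ α * a + β * c ≠ 0 := by
    by_contra! h
    refine hi (mem_of_fixed (he.isSeparable i) fun τ _ => ?_)
    obtain ⟨a, c, hac⟩ := exists_actsBy hy hy0 hx τ
    rw [he.map hac, h τ a c hac, add_zero]
  obtain ⟨τ, a, c, hac, h0⟩ := this
  obtain ⟨τ', h', -⟩ := hac.exists_nsmul (α * a + β * c)⁻¹
  refine ⟨τ', _, _, h', ?_⟩
  field_simp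

theorem IsEquivariant.injective : Function.Injective e := by
  obtain ⟨τ, a, c, hac, h1⟩ := he.exists_shift hy hy0 hx
  have : Fact (Nat.Prime 5) := ⟨by norm_num⟩
  intro i j hij
  by_contra hne
  have key : ∀ d, e (i + d) = e (j + d) := by
    intro d
    obtain ⟨τ', h', -⟩ := hac.exists_nsmul d
    have h2 : α * (d * a) + β * (d * c) = d := by linear_combination d * h1
    have := congrArg τ' hij
    rwa [he.map h', he.map h', h2] at this
  have key2 : ∀ n : ℕ, ∀ d, e (d + n * (j - i)) = e d := by
    intro n
    induction n with
    | zero => intro d; simp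
    | succ n ih =>
      intro d
      rw [← ih d]
      have := key (d + n * (j - i) - i)
      rw [add_sub_cancel] at this
      rw [this]
      congr 1
      push_cast
      ring
  obtain ⟨k, hk⟩ := he.notMem
  refine hk (mem_of_fixed (he.isSeparable k) fun τ _ => ?_)
  obtain ⟨a', c', h'⟩ := exists_actsBy hy hy0 hx τ
  rw [he.map h']
  have h3 := key2 ((α * a' + β * c') * (j - i)⁻¹).val k
  rw [ZMod.natCast_zmod_val, inv_mul_cancel_right₀ (sub_ne_zero.2 (Ne.symm hne))] at h3
  exact h3

end Family

theorem exists_actsBy_of_params (hy : IsTorsionSeq omegaT (carlitzSeq y)) (hy0 : y ≠ 0)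
    (hx : IsNormalGen x) (a c : ZMod 5) : ∃ τ, ActsBy y x τ a c := by
  have : Fact (Nat.Prime 5) := ⟨by norm_num⟩
  obtain ⟨τ₁, a₁, c₁, h₁, ha₁⟩ :=
    (isEquivariant_torsionNorm (x := x) hy hy0).exists_shift hy hy0 hx
  obtain rfl : a₁ = 1 := by simpa using ha₁
  obtain ⟨τ₂, a₂, c₂, h₂, hd⟩ : ∃ τ a c, ActsBy y x τ a c ∧ c - c₁ * a ≠ 0 := by
    by_cases hc : c₁ = 0
    · obtain ⟨τ, a, c, h, h1⟩ := (hx.isEquivariant_conjSeq (y := y)).exists_shift hy hy0 hx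
      refine ⟨τ, a, c, h, ?_⟩
      rw [hc, zero_mul, sub_zero]
      rintro rfl
      simp at h1
    · obtain ⟨τ, a, c, h, h1⟩ := (isEquivariant_generator hy hy0 hx hc).exists_shift hy hy0 hx
      refine ⟨τ, a, c, h, fun h2 => ?_⟩
      rw [sub_eq_zero] at h2
      rw [h2, inv_mul_cancel_left₀ hc] at h1
      simp at h1
  obtain ⟨σ₂, hσ₂, -⟩ := h₂.exists_nsmul ((c - c₁ * a) / (c₂ - c₁ * a₂))
  obtain ⟨σ₁, hσ₁, -⟩ := h₁.exists_nsmul (a - (c - c₁ * a) / (c₂ - c₁ * a₂) * a₂)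
  refine ⟨σ₁.trans σ₂, ?_⟩
  convert hσ₁.trans hσ₂ using 1
  · ring
  · field_simp
    ring

end Equivariant

section FamilyField

open IsLocalRing Polynomial IntermediateField

variable {y x : Omega2}

theorem apply_eq_of_mem_adjoin {S : Set Omega2} {τ τ' : Omega2 ≃ₐ[k2] Omega2}
    (h : ∀ z ∈ S, τ z = τ' z) {z : Omega2} (hz : z ∈ adjoin k2 S) : τ z = τ' z := by
  induction hz using IntermediateField.adjoin_induction with
  | mem z hz => exact h z hz
  | algebraMap a => rw [τ.commutes, τ'.commutes]
  | add a b _ _ ha hb => rw [map_add, map_add, ha, hb]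
  | inv a _ ha => rw [map_inv₀, map_inv₀, ha]
  | mul a b _ _ ha hb => rw [map_mul, map_mul, ha, hb]

/-- The field generated by a family. -/
def familyField (e : ZMod 5 → Omega2) : IntermediateField k2 Omega2 := adjoin k2 (Set.range e)

theorem mem_familyField (e : ZMod 5 → Omega2) (i : ZMod 5) : e i ∈ familyField e :=
  subset_adjoin _ _ ⟨i, rfl⟩

theorem apply_eq_of_mem_familyField {e : ZMod 5 → Omega2} {τ τ' : Omega2 ≃ₐ[k2] Omega2}
    (h : ∀ i, τ (e i) = τ' (e i)) {z : Omega2} (hz : z ∈ familyField e) : τ z = τ' z := by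
  refine apply_eq_of_mem_adjoin ?_ hz
  rintro _ ⟨i, rfl⟩
  exact h i

variable {α β : ZMod 5} {e : ZMod 5 → Omega2} (hy : IsTorsionSeq omegaT (carlitzSeq y))
  (hy0 : y ≠ 0) (hx : IsNormalGen x) (he : IsEquivariant y x α β e)

include he in
theorem IsEquivariant.finiteDimensional : FiniteDimensional k2 (familyField e) := by
  have := Set.finite_range e
  exact finiteDimensional_adjoin fun z _ => Algebra.IsIntegral.isIntegral z

include hy hy0 hx he

theorem IsEquivariant.isGalois : IsGalois k2 (familyField e) := by
  have h1 : Algebra.IsSeparable k2 (familyField e) := by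
    refine (isSeparable_adjoin_iff_isSeparable _ _).2 ?_
    rintro _ ⟨i, rfl⟩
    exact he.isSeparable i
  have h2 : Normal k2 (familyField e) := by
    rw [normal_iff_forall_map_le']
    intro τ
    rw [familyField, adjoin_map, adjoin_le_iff]
    rintro _ ⟨_, ⟨i, rfl⟩, rfl⟩
    obtain ⟨a, c, hac⟩ := exists_actsBy hy hy0 hx τ
    have := he.map hac i
    change τ (e i) ∈ _
    rw [this]
    exact mem_familyField e _
  exact ⟨⟩

theorem IsEquivariant.exists_aut (d : ZMod 5) :
    ∃ σ : familyField e ≃ₐ[k2] familyField e,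
      ∀ i, σ ⟨e i, mem_familyField e i⟩ = ⟨e (i + d), mem_familyField e _⟩ := by
  have := he.isGalois hy hy0 hx
  obtain ⟨τ, a, c, hac, h1⟩ := he.exists_shift hy hy0 hx
  obtain ⟨τ', h', -⟩ := hac.exists_nsmul d
  refine ⟨τ'.restrictNormal (familyField e), fun i => Subtype.ext ?_⟩
  refine (AlgEquiv.restrictNormal_commutes τ' (familyField e) _).trans ?_
  have h2 : α * (d * a) + β * (d * c) = d := by linear_combination d * h1
  exact (he.map h' i).trans (by rw [h2])

theorem IsEquivariant.finrank : Module.finrank k2 (familyField e) = 5 := by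
  have := he.isGalois hy hy0 hx
  have := he.finiteDimensional
  choose s hs using he.exists_aut hy hy0 hx
  rw [← IsGalois.card_aut_eq_finrank]
  have hinj := he.injective hy hy0 hx
  have hb : Function.Bijective s := by
    refine ⟨fun d d' h => ?_, fun φ => ?_⟩
    · have h1 := hs d 0
      rw [h, hs d' 0] at h1
      have h2 := hinj (congrArg Subtype.val h1)
      simpa using h2.symm
    · obtain ⟨a, c, hac⟩ := exists_actsBy hy hy0 hx (φ.liftNormal Omega2)
      refine ⟨α * a + β * c, ?_⟩
      have h1 : ∀ i, φ ⟨e i, mem_familyField e i⟩ =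
          s (α * a + β * c) ⟨e i, mem_familyField e i⟩ := by
        intro i
        rw [hs]
        apply Subtype.ext
        refine Eq.trans ?_ (he.map hac i)
        exact (φ.liftNormal_commutes Omega2 ⟨e i, mem_familyField e i⟩).symm
      ext z
      have h3 := apply_eq_of_mem_familyField
        (τ := (s (α * a + β * c)).liftNormal Omega2) (τ' := φ.liftNormal Omega2) (e := e)
        (fun i => ?_) z.2
      · have e1 := (s (α * a + β * c)).liftNormal_commutes Omega2 z
        have e2 := φ.liftNormal_commutes Omega2 z
        exact e1.symm.trans (h3.trans e2)
      · have e1 := (s (α * a + β * c)).liftNormal_commutes Omega2 ⟨e i, mem_familyField e i⟩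
        have e2 := φ.liftNormal_commutes Omega2 ⟨e i, mem_familyField e i⟩
        refine e1.trans (Eq.trans ?_ e2.symm)
        rw [h1]
  have := Nat.card_congr (Equiv.ofBijective s hb)
  rw [← this, Nat.card_eq_fintype_card, ZMod.card]

end FamilyField

section Subfields

open IsLocalRing Polynomial IntermediateField

variable {y x : Omega2}

theorem familyField_le {e : ZMod 5 → Omega2} {F : IntermediateField k2 Omega2}
    (h : ∀ i, e i ∈ F) : familyField e ≤ F := by
  rw [familyField, adjoin_le_iff]
  rintro _ ⟨i, rfl⟩
  exact h i

theorem IsNormalGen.constExt32_eq (hx : IsNormalGen x) : constExt32 = familyField (conjSeq x) := by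
  apply le_antisymm
  · rw [constExt32, adjoin_le_iff]
    intro z hz
    replace hz : z ^ 32 = z := hz
    have hfrob : ∀ j : ZMod 5, conjSeq z j ^ 2 = conjSeq z (j + 1) := by
      have h : ∀ n < 5, (z ^ 2 ^ n) ^ 2 = z ^ 2 ^ ((n + 1) % 5) := by
        intro n hn
        interval_cases n <;> norm_num [← pow_mul, hz]
      intro j
      have h1 := h j.val j.val_lt
      rwa [show (j.val + 1) % 5 = (j + 1).val from by
        rw [ZMod.val_add]; rfl] at h1
    let ε : ZMod 5 → Omega2 := fun i => ∑ j, conjSeq z j * conjSeq x (i + j)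
    have hε : ∀ i, ε i = 0 ∨ ε i = 1 := by
      intro i
      have h1 : ε i ^ 2 = ε i := by
        rw [CharTwo.sum_sq]
        refine Fintype.sum_equiv (Equiv.addRight 1) _ _ fun j => ?_
        have := hx.conjSeq_pow (i + j) 1
        rw [mul_pow, hfrob, Equiv.coe_addRight, ← add_assoc, ← Nat.cast_one, ← this, pow_one]
      have h2 : ε i * (ε i - 1) = 0 := by linear_combination h1
      rcases mul_eq_zero.1 h2 with h | h
      · exact Or.inl h
      · exact Or.inr (sub_eq_zero.1 h)
    have hz2 : z = ∑ i, ε i * conjSeq x i := by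
      have h1 : ∑ i, ε i * conjSeq x i =
          ∑ j, conjSeq z j * ∑ i, conjSeq x i * conjSeq x (i + j) := by
        simp only [ε, Finset.sum_mul, Finset.mul_sum]
        rw [Finset.sum_comm]
        exact Finset.sum_congr rfl fun i _ => Finset.sum_congr rfl fun j _ => by ring
      simp only [h1, hx.gram_conjSeq, mul_ite, mul_one, mul_zero]
      rw [Finset.sum_ite_eq' Finset.univ (0 : ZMod 5) (conjSeq z)]
      simp [conjSeq]
    rw [hz2]
    refine sum_mem fun i _ => mul_mem ?_ (mem_familyField _ i)
    rcases hε i with h | h <;> rw [h]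
    · exact zero_mem _
    · exact one_mem _
  · refine familyField_le fun i => subset_adjoin _ _ ?_
    change (x ^ 2 ^ i.val) ^ 32 = x ^ 2 ^ i.val
    rw [← pow_mul, mul_comm, pow_mul, hx.pow_thirtyTwo]

/-- A quintic subfield of the compositum fixed by a nontrivial automorphism of it is generated by
any family fixed by that automorphism. -/
theorem eq_familyField_of_fixed (hy : IsTorsionSeq omegaT (carlitzSeq y)) (hy0 : y ≠ 0)
    (hx : IsNormalGen x) {α β : ZMod 5} {e : ZMod 5 → Omega2} (he : IsEquivariant y x α β e)
    {R : IntermediateField k2 Omega2}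
    (hRE : R ≤ familyField (torsionNorm (carlitzSeq y)) ⊔ familyField (conjSeq x))
    (hR : Module.finrank k2 R = 5) {τ : Omega2 ≃ₐ[k2] Omega2} {a c : ZMod 5}
    (hτ : ActsBy y x τ a c) (h0 : a ≠ 0 ∨ c ≠ 0) (hfix : ∀ z ∈ R, τ z = z)
    (hac : α * a + β * c = 0) : R = familyField e := by
  have : Fact (Nat.Prime 5) := ⟨by norm_num⟩
  have hfin := he.finiteDimensional
  refine eq_of_le_of_finrank_eq (fun z hz => ?_) (by rw [hR, he.finrank hy hy0 hx])
  have hsepE : familyField (torsionNorm (carlitzSeq y)) ⊔ familyField (conjSeq x) ≤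
      separableClosure k2 Omega2 :=
    sup_le (familyField_le (torsionNorm_mem (mem_separableClosure_iff.2
      (isSeparable_of_torsion hy)))) (familyField_le hx.conjSeq_mem_separableClosure)
  refine mem_of_fixed (mem_separableClosure_iff.1 (hsepE (hRE hz))) fun τ' hτ' => ?_
  obtain ⟨a', c', h'⟩ := exists_actsBy hy hy0 hx τ'
  have hac' : α * a' + β * c' = 0 := by
    have h1 := hτ' _ (mem_familyField e 0)
    rw [he.map h'] at h1
    have := he.injective hy hy0 hx h1
    simpa using this
  obtain ⟨n, hna, hnc⟩ : ∃ n, n * a = a' ∧ n * c = c' := by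
    obtain ⟨_, a₁, c₁, -, h1⟩ := he.exists_shift hy hy0 hx
    have hdet : a * c' = a' * c := by
      linear_combination (-(a * c' - a' * c)) * h1 + (a₁ * c' - c₁ * a') * hac +
        (-a₁ * c + c₁ * a) * hac'
    rcases h0 with h0 | h0
    · refine ⟨a' / a, by field_simp, by field_simp; exact hdet.symm⟩
    · refine ⟨c' / c, by field_simp; linear_combination hdet, by field_simp⟩
  obtain ⟨σ, hσ, hσfix⟩ := hτ.exists_nsmul n
  rw [hna, hnc] at hσ
  have hz' := hRE hz
  rw [familyField, familyField, ← adjoin_union] at hz'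
  refine Eq.trans (apply_eq_of_mem_adjoin ?_ hz') (hσfix z (hfix z hz))
  rintro _ (⟨i, rfl⟩ | ⟨i, rfl⟩)
  · rw [h'.torsion, hσ.torsion]
  · rw [h'.const, hσ.const]

/-- A quintic subfield of the compositum is fixed by a nontrivial automorphism of it. -/
theorem exists_fixing (hy : IsTorsionSeq omegaT (carlitzSeq y)) (hy0 : y ≠ 0)
    (hx : IsNormalGen x) {R : IntermediateField k2 Omega2} (hR : Module.finrank k2 R = 5) :
    ∃ τ a c, ActsBy y x τ a c ∧ (a ≠ 0 ∨ c ≠ 0) ∧ ∀ z ∈ R, τ z = z := by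
  have hfin : FiniteDimensional k2 R := Module.finite_of_finrank_pos (by omega)
  choose T hT using fun q : ZMod 5 × ZMod 5 => exists_actsBy_of_params hy hy0 hx q.1 q.2
  have hcard : Fintype.card (R →ₐ[k2] Omega2) ≤ 5 := by
    rw [← hR, Fintype.card_eq_nat_card]
    exact card_algHom_le_finrank k2 R Omega2
  obtain ⟨q, q', hne, hq⟩ := Fintype.exists_ne_map_eq_of_card_lt
    (fun q : ZMod 5 × ZMod 5 => ((T q : Omega2 →ₐ[k2] Omega2).comp R.val)) (by
      rw [Fintype.card_prod, ZMod.card]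
      omega)
  refine ⟨(T q).trans (T q').symm, _, _, (hT q).trans (hT q').symm, ?_, fun z hz => ?_⟩
  · by_contra! h
    exact hne (Prod.ext (add_neg_eq_zero.1 h.1) (add_neg_eq_zero.1 h.2))
  · rw [AlgEquiv.trans_apply, AlgEquiv.symm_apply_eq]
    exact DFunLike.congr_fun hq ⟨z, hz⟩

/-- The quintic subfield of the cyclotomic function field is generated by the torsion norms. -/
theorem eq_familyField_torsionNorm (hy : IsTorsionSeq omegaT (carlitzSeq y)) (hy0 : y ≠ 0)
    (hx : IsNormalGen x) {L : IntermediateField k2 Omega2} (hL : L ≤ cycloField M0)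
    (hLdeg : Module.finrank k2 L = 5) : L = familyField (torsionNorm (carlitzSeq y)) := by
  have hfin : FiniteDimensional k2 L := Module.finite_of_finrank_pos (by omega)
  have he := isEquivariant_torsionNorm (x := x) hy hy0
  have hcyc : cycloField M0 ≤ adjoin k2 {y} := by
    rw [cycloField, adjoin_le_iff]
    intro z hz
    by_cases hz0 : z = 0
    · rw [hz0]; exact zero_mem _
    · obtain ⟨b, -, rfl⟩ := exists_carlitzSeq_eq (mem_rootSet_carlitz.2 hy) hy0 hz hz0
      exact carlitzSeq_mem _ (mem_adjoin_simple_self k2 y) b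
  have hagree : ∀ τ τ' : Omega2 ≃ₐ[k2] Omega2, τ y = τ' y → ∀ z ∈ L, τ z = τ' z := by
    intro τ τ' h z hz
    refine apply_eq_of_mem_adjoin (S := {y}) ?_ (hcyc (hL hz))
    rintro _ rfl
    exact h
  symm
  refine eq_of_le_of_finrank_eq (familyField_le fun j => ?_)
    (by rw [hLdeg, he.finrank hy hy0 hx])
  refine mem_of_fixed (he.isSeparable j) fun τ hτ => ?_
  obtain ⟨b, hb, hτy⟩ := exists_map_torsion hy hy0 τ
  rw [map_torsionNorm_of_map hy hτy]
  suffices h5 : b % 5 = 0 by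
    rw [(ZMod.natCast_eq_zero_iff b 5).2 (Nat.dvd_of_mod_eq_zero h5), add_zero]
  by_contra h5
  have hsep : Algebra.IsSeparable k2 L := by
    refine (le_separableClosure_iff k2 Omega2 L).1 ((hL.trans hcyc).trans ?_)
    rw [adjoin_simple_le_iff, mem_separableClosure_iff]
    exact isSeparable_of_torsion hy
  have hcard : Fintype.card (L →ₐ[k2] Omega2) = 5 := by
    rw [← hLdeg]
    exact AlgHom.card k2 L Omega2
  have hlift : ∀ φ : L →ₐ[k2] Omega2, ∃ s : Fin 15, ∃ σ : Omega2 ≃ₐ[k2] Omega2,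
      σ y = carlitzSeq y s ∧ ∀ z : L, φ z = σ z := by
    intro φ
    obtain ⟨ψ, hψ⟩ := exists_algHom_of_splits (L := L) (E := Omega2)
      (fun z => ⟨Algebra.IsIntegral.isIntegral z, IsAlgClosed.splits _⟩) φ
    let σ : Omega2 ≃ₐ[k2] Omega2 :=
      AlgEquiv.ofBijective ψ (Algebra.IsAlgebraic.algHom_bijective ψ)
    obtain ⟨s, hs, hσ⟩ := exists_map_torsion hy hy0 σ
    exact ⟨⟨s, hs⟩, σ, hσ, fun z => (DFunLike.congr_fun hψ z).symm⟩
  choose s σ hσy hσ using hlift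
  have hpow : ∀ n : ℕ, (τ ^ n) y = carlitzSeq y (n * b) ∧ ∀ z ∈ L, (τ ^ n) z = z := by
    intro n
    induction n with
    | zero => exact ⟨by simp [carlitzSeq], fun _ _ => rfl⟩
    | succ n ih =>
      refine ⟨?_, fun z hz => ?_⟩
      · rw [pow_succ', AlgEquiv.mul_apply, ih.1, map_carlitzSeq, hτy, carlitzSeq_add]
        congr 1
        ring
      · rw [pow_succ', AlgEquiv.mul_apply, ih.2 z hz, hτ z hz]
  obtain ⟨φ, φ', hne, hφ⟩ := Fintype.exists_ne_map_eq_of_card_lt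
    (fun φ : L →ₐ[k2] Omega2 => (⟨(s φ).val % 3, Nat.mod_lt _ (by norm_num)⟩ : Fin 3)) (by
      rw [hcard, Fintype.card_fin]; norm_num)
  have hmod : ∀ b : Fin 15, b.val % 5 ≠ 0 → ∀ s s' : Fin 15, s.val % 3 = s'.val % 3 →
      ∃ n : Fin 15, (s.val + n * b) % 15 = s' := by decide
  obtain ⟨n, hn⟩ := hmod ⟨b, hb⟩ h5 (s φ) (s φ') (congrArg Fin.val hφ)
  apply hne
  ext z
  rw [hσ, hσ]
  have h1 := hagree ((τ ^ n.val).trans (σ φ)) (σ φ') ?_ z z.2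
  · rwa [AlgEquiv.trans_apply, (hpow n).2 z z.2] at h1
  · rw [AlgEquiv.trans_apply, (hpow n).1, map_carlitzSeq, hσy, hσy, carlitzSeq_add, ← hy.mod, hn]

end Subfields

section Classification

open IsLocalRing Polynomial IntermediateField

variable {y x : Omega2} (hy : IsTorsionSeq omegaT (carlitzSeq y)) (hy0 : y ≠ 0)
  (hx : IsNormalGen x)

/-- The member of the family in the field it generates. -/
def familyGen (e : ZMod 5 → Omega2) (i : ZMod 5) : familyField e := ⟨e i, mem_familyField e i⟩

include hy hy0 hx

theorem isCyclicFamily_familyGen {u : ZMod 5} (hu : u ≠ 0) :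
    IsCyclicFamily (familyGen (generator y x u)) := by
  obtain ⟨σ, hσ⟩ := (isEquivariant_generator hy hy0 hx hu).exists_aut hy hy0 hx 1
  exact isCyclicFamily_of_coe_eq hy hy0 hx hu (fun _ => rfl) σ hσ

theorem not_isInert_of_shift_eq_zero {u : ZMod 5} (hu : u ≠ 0) {p : Place (ZMod 2) k2}
    {a : ℕ} (hX : RatFunc.X ∈ p.1) (hg : polyToRat (X + (a : (ZMod 2)[X])) ∈ p.1.nonunits)
    (hd : placeDegree (ZMod 2) p = 1) {b : ℕ} (hub : u⁻¹ = b)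
    (hb : ∀ {A : Type} [CommRing A] [CharP A 2] (t : A) (l : ℕ → A), t + a = 0 →
      IsTorsionSeq t l → ∀ i, l i ^ 2 ^ 1 = l (i + b)) :
    ¬ IsInert (ZMod 2) (familyField (generator y x u)) p := by
  rintro ⟨P, hP, -, huniq⟩
  have he := isEquivariant_generator hy hy0 hx hu
  have := he.isGalois hy hy0 hx
  have := he.finiteDimensional
  have hw := isCyclicFamily_familyGen hy hy0 hx hu
  have hXP : algebraMap k2 (familyField (generator y x u)) RatFunc.X ∈ P.1 := by
    rwa [liesOver_mem hP]
  obtain ⟨V, hV⟩ := exists_comap_eq (algebraMap (familyField (generator y x u)) Omega2) P.1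
  have hVp : V.comap (algebraMap k2 Omega2) = p.1 := by
    rw [← hP, ← hV]; rfl
  have hT : omegaT ∈ V := by rw [← hVp] at hX; exact hX
  have := charP_residueField V
  have hfrob := twist_frobenius V hy hx hu hT (n := 1) (b := b) (fun l hl i => by
    refine hb _ l ?_ hl i
    rw [← map_natCast (residue V), ← map_add]
    exact residue_eq_zero_of_aeval hVp hg _ (by simp)) 0
  rw [hub, Nat.cast_one, mul_one, sub_self, add_zero] at hfrob
  have hw0 : familyGen (generator y x u) 0 ^ 2 - familyGen (generator y x u) 0 ∈ P.1.nonunits := by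
    rw [← nonunits_of_comap_eq hV]
    exact hfrob
  have hmem := hw.mem P hXP 0
  have hres : residue P.1 ⟨_, hmem⟩ ^ 2 - residue P.1 ⟨_, hmem⟩ = 0 := by
    rw [← map_pow, ← map_sub]
    exact (residue_eq_zero_iff_mem_nonunits P.1 _).2 hw0
  obtain ⟨c, hc, hcw⟩ : ∃ c ∈ p.1, familyGen (generator y x u) 0 -
      algebraMap k2 (familyField (generator y x u)) c ∈ P.1.nonunits := by
    have h1 : residue P.1 ⟨_, hmem⟩ * (residue P.1 ⟨_, hmem⟩ - 1) = 0 := by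
      linear_combination hres
    rcases mul_eq_zero.1 h1 with h | h
    · refine ⟨0, zero_mem _, ?_⟩
      rw [map_zero, sub_zero]
      exact (residue_eq_zero_iff_mem_nonunits P.1 _).1 h
    · refine ⟨1, one_mem _, ?_⟩
      rw [map_one]
      rw [← map_one (residue P.1), ← map_sub] at h
      exact (residue_eq_zero_iff_mem_nonunits P.1 _).1 h
  have hM := hw.gram_of_const hP huniq hXP hc hcw
  rw [nonunits_comap p hP] at hM
  have := placeDegree_of_M0 p ((isFinitePlaceOf_M0_iff p).2 ⟨hX, hM⟩)
  omega

theorem exists_not_isInert {u : ZMod 5} (hu : u = 1 ∨ u = 4) :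
    ∃ p : Place (ZMod 2) k2, placeDegree (ZMod 2) p ≤ 4 ∧ ¬ IsFinitePlaceOf p.1 M0 ∧
      ¬ IsInert (ZMod 2) (familyField (generator y x u)) p := by
  have : Fact (Nat.Prime 5) := ⟨by norm_num⟩
  have hdeg : ∀ {g : (ZMod 2)[X]} {p : Place (ZMod 2) k2}, g.natDegree = 1 → RatFunc.X ∈ p.1 →
      polyToRat g ∈ p.1.nonunits → placeDegree (ZMod 2) p = 1 := by
    intro g p h1 hX hg
    have h2 := placeDegree_le_natDegree p hX (by rintro rfl; simp at h1) hg
    have h3 := placeDegree_pos p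
    omega
  have key : ∀ a : ℕ, ∃ p : Place (ZMod 2) k2, RatFunc.X ∈ p.1 ∧
      polyToRat (X + (a : (ZMod 2)[X])) ∈ p.1.nonunits ∧ placeDegree (ZMod 2) p = 1 := by
    intro a
    have hg := degree_X_add_C (a : ZMod 2)
    have hn := natDegree_X_add_C (a : ZMod 2)
    rw [map_natCast] at hg hn
    obtain ⟨p, hX, hM⟩ := exists_place_of_irreducible (irreducible_of_degree_eq_one hg)
    exact ⟨p, hX, hM, hdeg hn hX hM⟩
  rcases hu with rfl | rfl
  · obtain ⟨p, hX, hg, hd⟩ := key 0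
    refine ⟨p, by omega, fun h => ?_, not_isInert_of_shift_eq_zero hy hy0 hx one_ne_zero hX hg hd
      (b := 1) (by simp) fun t l ht hl => hl.frobenius_X (by simpa using ht)⟩
    have := placeDegree_of_M0 p h
    omega
  · obtain ⟨p, hX, hg, hd⟩ := key 1
    have h4 : (4 : ZMod 5) ≠ 0 := of_decide_eq_true rfl
    refine ⟨p, by omega, fun h => ?_, not_isInert_of_shift_eq_zero hy hy0 hx h4 hX hg hd
      (b := 4) ?_ fun t l ht hl => hl.frobenius_X_add_one (by simpa using ht)⟩
    · have := placeDegree_of_M0 p h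
      omega
    · rw [inv_eq_iff_eq_inv, eq_comm, inv_eq_of_mul_eq_one_left]
      exact of_decide_eq_true rfl

/-- Families with independent shift forms generate distinct fields. -/
theorem familyField_ne {α β α' β' : ZMod 5} {e e' : ZMod 5 → Omega2}
    (he : IsEquivariant y x α β e) (he' : IsEquivariant y x α' β' e')
    (h : α * β' ≠ α' * β) : familyField e ≠ familyField e' := by
  intro heq
  obtain ⟨τ, hτ⟩ := exists_actsBy_of_params hy hy0 hx (-β) α
  have h1 := apply_eq_of_mem_familyField (τ := τ) (τ' := AlgEquiv.refl) (e := e) (fun i => by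
    rw [he.map hτ, show α * -β + β * α = 0 by ring, add_zero]; rfl)
    (heq ▸ mem_familyField e' 0)
  rw [he'.map hτ] at h1
  have h2 := he'.injective hy hy0 hx h1
  apply h
  linear_combination h2

end Classification

section Candidates

open IntermediateField

variable {y x : Omega2} (hy : IsTorsionSeq omegaT (carlitzSeq y)) (hy0 : y ≠ 0)
  (hx : IsNormalGen x)

include hy hy0 hx

theorem isStirpeCandidate_familyField {u : ZMod 5} (hu : u = 2 ∨ u = 3)
    {L : IntermediateField k2 Omega2} (hL : L = familyField (torsionNorm (carlitzSeq y))) :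
    IsStirpeCandidate L (familyField (generator y x u)) ∧
    (∀ p : Place (ZMod 2) k2, ¬ IsFinitePlaceOf p.1 M0 →
      IsUnramifiedAt (ZMod 2) (familyField (generator y x u)) p) ∧
    genus (ZMod 2) (familyField (generator y x u)) = 4 ∧
    classNumber (ZMod 2) (familyField (generator y x u)) = 1 := by
  have : Fact (Nat.Prime 5) := ⟨by norm_num⟩
  have hu0 : u ≠ 0 := by rcases hu with rfl | rfl <;> exact of_decide_eq_true rfl
  have he := isEquivariant_generator hy hy0 hx hu0
  have hK := he.finrank hy hy0 hx
  have := he.isGalois hy hy0 hx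
  have := he.finiteDimensional
  have hw := isCyclicFamily_familyGen hy hy0 hx hu0
  have hs : HasShiftFrobenius (familyGen (generator y x u)) :=
    hasShiftFrobenius_of_coe_eq hy hx (fun _ => rfl) hu
  refine ⟨⟨?_, hK, ?_, ?_, hw.inert hs hK⟩, hw.unramified hs hK, hw.genus_classNumber hs hK⟩
  · rw [hL, hx.constExt32_eq]
    refine familyField_le fun i => generator_mem (fun j => ?_) (fun j => ?_) u i
    · exact (le_sup_left : _ ≤ _ ⊔ familyField (conjSeq x)) (mem_familyField _ j)
    · exact (le_sup_right : _ ≤ familyField (torsionNorm (carlitzSeq y)) ⊔ _)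
        (mem_familyField _ j)
  · rw [hL]
    refine familyField_ne hy hy0 hx he (isEquivariant_torsionNorm hy hy0) ?_
    simpa using hu0.symm
  · rw [hx.constExt32_eq]
    refine familyField_ne hy hy0 hx he hx.isEquivariant_conjSeq ?_
    simp

theorem IsStirpeCandidate.eq_familyField {L : IntermediateField k2 Omega2}
    (hL : L = familyField (torsionNorm (carlitzSeq y))) {R : IntermediateField k2 Omega2}
    (h : IsStirpeCandidate L R) :
    R = familyField (generator y x 2) ∨ R = familyField (generator y x 3) := by
  have : Fact (Nat.Prime 5) := ⟨by norm_num⟩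
  obtain ⟨hRE, hR, hRL, hRc, hinert⟩ := h
  rw [hL, hx.constExt32_eq] at hRE
  rw [hL] at hRL
  rw [hx.constExt32_eq] at hRc
  obtain ⟨τ, a, c, hτ, h0, hfix⟩ := exists_fixing hy hy0 hx hR
  have ha : a ≠ 0 := fun ha => hRL <| eq_familyField_of_fixed hy hy0 hx
    (isEquivariant_torsionNorm hy hy0) hRE hR hτ h0 hfix (by simp [ha])
  have hc : c ≠ 0 := fun hc => hRc <| eq_familyField_of_fixed hy hy0 hx
    hx.isEquivariant_conjSeq hRE hR hτ h0 hfix (by simp [hc])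
  have hu : c / a ≠ 0 := div_ne_zero hc ha
  have hRu := eq_familyField_of_fixed hy hy0 hx (isEquivariant_generator hy hy0 hx hu)
    hRE hR hτ h0 hfix (by field_simp; ring)
  have hex : ¬ (c / a = 1 ∨ c / a = 4) := by
    intro h
    obtain ⟨p, hp, hM, hn⟩ := exists_not_isInert hy hy0 hx h
    rw [← hRu] at hn
    exact hn (hinert p hp hM)
  have hcases : ∀ u : ZMod 5, u ≠ 0 → ¬ (u = 1 ∨ u = 4) → u = 2 ∨ u = 3 := of_decide_eq_true rfl
  rcases hcases _ hu hex with h | h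
  · exact Or.inl (h ▸ hRu)
  · exact Or.inr (h ▸ hRu)

end Candidates

end CFF

open CFF in
/-- Let `L` be the degree-`5` subfield of the Carlitz cyclotomic function field
`k(Λ_M)`, `M = T⁴+T+1`, and let `L₅ = L·k₅` be its compositum with the
constant field extension `k₅ = k·𝔽₃₂`  (so `Gal(L₅/k) ≅ C₅ × C₅`).  Among the
intermediate fields of `L₅/k` of degree `5` other than `L` and `k₅`, exactly
two fields `R₁`, `R₂` have the property that every place of `k` of degree at
most `4` other than the place `𝔪` of `M` is inert in them; in `R₁` and `R₂`
the place `𝔪` is the only ramified place, and both have genus `4` and class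
number `1`. -/
theorem exactly_two_inert_candidates
    (L : IntermediateField k2 Omega2)
    (hL : L ≤ cycloField M0)
    (hLdeg : Module.finrank k2 L = 5) :
    ∃ R₁ R₂ : IntermediateField k2 Omega2, R₁ ≠ R₂ ∧
      IsStirpeCandidate L R₁ ∧ IsStirpeCandidate L R₂ ∧
      (∀ R : IntermediateField k2 Omega2, IsStirpeCandidate L R → R = R₁ ∨ R = R₂) ∧
      (∀ p : Place (ZMod 2) k2, ¬ IsFinitePlaceOf p.1 M0 →
        IsUnramifiedAt (ZMod 2) R₁ p ∧ IsUnramifiedAt (ZMod 2) R₂ p) ∧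
      genus (ZMod 2) R₁ = 4 ∧ classNumber (ZMod 2) R₁ = 1 ∧
      genus (ZMod 2) R₂ = 4 ∧ classNumber (ZMod 2) R₂ = 1 := by
  obtain ⟨y, hy0, hyr⟩ := exists_torsion_ne_zero
  obtain ⟨x, hx⟩ := exists_isNormalGen
  have hy : IsTorsionSeq omegaT (carlitzSeq y) := mem_rootSet_carlitz.1 hyr
  have hLη := eq_familyField_torsionNorm hy hy0 hx hL hLdeg
  obtain ⟨hc₁, hr₁, hg₁, hh₁⟩ := isStirpeCandidate_familyField hy hy0 hx (Or.inl rfl) hLη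
  obtain ⟨hc₂, hr₂, hg₂, hh₂⟩ := isStirpeCandidate_familyField hy hy0 hx (Or.inr rfl) hLη
  refine ⟨_, _, ?_, hc₁, hc₂, fun R h => h.eq_familyField hy hy0 hx hLη,
    fun p hp => ⟨hr₁ p hp, hr₂ p hp⟩, hg₁, hh₁, hg₂, hh₂⟩
  have : Fact (Nat.Prime 5) := ⟨by norm_num⟩
  refine familyField_ne hy hy0 hx (isEquivariant_generator hy hy0 hx (of_decide_eq_true rfl))
    (isEquivariant_generator hy hy0 hx (of_decide_eq_true rfl)) ?_
  rw [neg_one_mul, neg_one_mul, Ne, neg_inj, inv_inj]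
  exact of_decide_eq_true rfl
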